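/- For every ρ ∈ (0,∞), the fractional Sobolev ball U_ρ := { R_{ρ+1/2} g : g ∈ L²([0,1], dt), ∫₀¹ g(t)² dt ≤ Γ(ρ+1/2)² } satisfies e_n(U_ρ) ~ ((ρ+1/2)/π)^{ρ+1/2} · Γ(ρ+1/2) · (log n)^{−(ρ+1/2)} as n → ∞. -/

import Mathlib

open MeasureTheory ProbabilityTheory Filter Real
open scoped RealInnerProductSpace NNReal

/-- Lebesgue measure on `[0,1]`. -/
noncomputable def μ01 : MeasureTheory.Measure ℝ := MeasureTheory.volume.restrict (Set.Icc (0:ℝ) 1)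

/-- The `n`-th (Kolmogorov) entropy number of a subset `K` of `H`. -/
noncomputable def entropyNum {H : Type*} [NormedAddCommGroup H] (K : Set H) (n : ℕ) : ℝ :=
  sInf { r : ℝ | ∃ α : Finset H, α.Nonempty ∧ α.card ≤ n ∧
    r = sSup ((fun x => sInf ((fun a => ‖x - a‖) '' (α : Set H))) '' K) }

/-- The fractional Sobolev ball
`U_ρ = R_{ρ+1/2}(g) : ∫₀¹ g² ≤ Γ(ρ+1/2)²}` in `L²([0,1],dt)`, where
`R_β g(t) = (1/Γ(β)) ∫₀^t (t-s)^{β-1} g(s) ds` is the Riemann–Liouville fractional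
integral operator. -/
noncomputable def sobolevBall (ρ : ℝ) : Set (Lp ℝ 2 μ01) :=
  { h : Lp ℝ 2 μ01 | ∃ g : Lp ℝ 2 μ01,
      (∫ t in (0:ℝ)..1, (g t) ^ 2) ≤ Real.Gamma (ρ + 1/2) ^ 2 ∧
      ∀ᵐ t ∂μ01, h t = (Real.Gamma (ρ + 1/2))⁻¹ *
        ∫ s in (0:ℝ)..t, (t - s) ^ (ρ + 1/2 - 1) * g s }

/-- `K` is covered by at most `N` closed balls of radius `ε`. -/
def Coverable {H : Type*} [NormedAddCommGroup H] (K : Set H) (ε N : ℝ) : Prop :=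
  ∃ α : Finset H, (α.card : ℝ) ≤ N ∧ ∀ x ∈ K, ∃ a ∈ α, ‖x - a‖ ≤ ε

/-- The ellipsoid with semi-axes `a i` along the coordinate axes. -/
def ellipsoid {ι : Type*} [Fintype ι] (a : ι → ℝ) : Set (EuclideanSpace ℝ ι) :=
  {y | ∃ x : EuclideanSpace ℝ ι, ‖x‖ ≤ 1 ∧ ∀ i, y i = a i * x i}

theorem exists_maximal_separated_net {X : Type*} [NormedAddCommGroup X] (K : Set X) {τ : ℝ}
    (hτ : 0 ≤ τ) (M : ℕ)
    (h : ∀ s : Finset X, (s : Set X) ⊆ K →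
      (∀ x ∈ s, ∀ y ∈ s, x ≠ y → τ < ‖x - y‖) → s.card ≤ M) :
    ∃ s : Finset X, (s : Set X) ⊆ K ∧ s.card ≤ M ∧ ∀ x ∈ K, ∃ y ∈ s, ‖x - y‖ ≤ τ := by
  classical
  let S : Set ℕ := {n | ∃ s : Finset X, (s : Set X) ⊆ K ∧
      (∀ x ∈ s, ∀ y ∈ s, x ≠ y → τ < ‖x - y‖) ∧ s.card = n}
  have hne : S.Nonempty := ⟨0, ∅, by simp⟩
  have hbd : BddAbove S := ⟨M, by rintro n ⟨s, h1, h2, rfl⟩; exact h s h1 h2⟩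
  obtain ⟨s, h1, h2, h3⟩ := Nat.sSup_mem hne hbd
  refine ⟨s, h1, h s h1 h2, fun x hx => ?_⟩
  by_contra! hc
  have hxs : x ∉ s := fun hxs => by
    have := hc x hxs
    simp only [sub_self, norm_zero] at this
    linarith
  have hS : (insert x s).card ∈ S := by
    refine ⟨insert x s, ?_, ?_, rfl⟩
    · intro y hy
      rcases Finset.mem_insert.1 (by simpa using hy) with rfl | hy
      · exact hx
      · exact h1 hy
    · intro y hy z hz hyz
      rcases Finset.mem_insert.1 hy with rfl | hy' <;> rcases Finset.mem_insert.1 hz with rfl | hz'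
      · exact absurd rfl hyz
      · exact hc z hz'
      · rw [norm_sub_rev]; exact hc y hy'
      · exact h2 y hy' z hz' hyz
  have := le_csSup hbd hS
  rw [Finset.card_insert_of_notMem hxs] at this
  omega

theorem det_diagonal_toLpLin {ι : Type*} [Fintype ι] [DecidableEq ι] (a : ι → ℝ) :
    LinearMap.det (Matrix.toLpLin 2 2 (Matrix.diagonal a)) = ∏ i, a i := by
  rw [Matrix.toLpLin_eq_toLin, LinearMap.det_toLin, Matrix.det_diagonal]

theorem ellipsoid_eq_image {ι : Type*} [Fintype ι] [DecidableEq ι] (a : ι → ℝ) :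
    ellipsoid a = Matrix.toLpLin 2 2 (Matrix.diagonal a) ''
      Metric.closedBall (0 : EuclideanSpace ℝ ι) 1 := by
  ext y
  constructor
  · rintro ⟨x, hx, hy⟩
    refine ⟨x, by simpa using hx, ?_⟩
    ext i
    simp [Matrix.mulVec_diagonal, hy]
  · rintro ⟨x, hx, rfl⟩
    refine ⟨x, by simpa using hx, fun i => ?_⟩
    simp [Matrix.mulVec_diagonal]

theorem volume_ellipsoid {ι : Type*} [Fintype ι] (a : ι → ℝ) (ha : ∀ i, 0 ≤ a i) :
    volume (ellipsoid a) =
      ENNReal.ofReal (∏ i, a i) * volume (Metric.closedBall (0 : EuclideanSpace ℝ ι) 1) := by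
  classical
  rw [ellipsoid_eq_image, Measure.addHaar_image_linearMap, det_diagonal_toLpLin,
    abs_of_nonneg (Finset.prod_nonneg fun i _ => ha i)]

theorem card_le_of_separated_ellipsoid {ι : Type*} [Fintype ι] (a : ι → ℝ) {τ : ℝ} (hτ : 0 < τ)
    (ha : ∀ i, τ / 2 ≤ a i) (s : Finset (EuclideanSpace ℝ ι))
    (hs : (s : Set (EuclideanSpace ℝ ι)) ⊆ ellipsoid a)
    (hsep : ∀ x ∈ s, ∀ y ∈ s, x ≠ y → τ < ‖x - y‖) :
    (s.card : ℝ) ≤ ∏ i, (4 * a i / τ) := by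
  classical
  have hapos : ∀ i, 0 < a i := fun i => lt_of_lt_of_le (by positivity) (ha i)
  set v := volume (Metric.closedBall (0 : EuclideanSpace ℝ ι) 1) with hv
  have hv0 : v ≠ 0 := (Metric.measure_closedBall_pos _ _ one_pos).ne'
  have hvt : v ≠ ⊤ := measure_closedBall_lt_top.ne
  have hsub : (⋃ x ∈ s, Metric.closedBall x (τ / 2)) ⊆ ellipsoid (fun i => 2 * a i) := by
    intro y hy
    simp only [Set.mem_iUnion, Metric.mem_closedBall, dist_eq_norm] at hy
    obtain ⟨x, hx, hyx⟩ := hy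
    obtain ⟨u, hu, hxu⟩ := hs hx
    let w : EuclideanSpace ℝ ι := WithLp.toLp 2 fun i => (y i - x i) / a i
    have hw : ‖w‖ ≤ 1 := by
      have h1 : ‖w‖ ^ 2 ≤ (2 / τ * ‖y - x‖) ^ 2 := by
        rw [mul_pow, EuclideanSpace.norm_sq_eq, EuclideanSpace.norm_sq_eq, Finset.mul_sum]
        refine Finset.sum_le_sum fun i _ => ?_
        have : ‖w i‖ ≤ 2 / τ * ‖(y - x) i‖ := by
          simp only [w, norm_div, PiLp.sub_apply, Real.norm_eq_abs, abs_of_pos (hapos i)]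
          rw [div_le_iff₀ (hapos i)]
          have : 1 ≤ 2 / τ * a i := by
            have := ha i
            rw [div_mul_eq_mul_div, le_div_iff₀ hτ]; linarith
          nlinarith [abs_nonneg (y i - x i)]
        rw [← mul_pow]
        gcongr
      have h2 : ‖w‖ ≤ 2 / τ * ‖y - x‖ := by
        refine le_of_sq_le_sq h1 (by positivity) 
      refine h2.trans ?_
      rw [div_mul_eq_mul_div, div_le_one hτ]
      linarith
    refine ⟨(1 / 2 : ℝ) • (u + w), ?_, fun i => ?_⟩
    · rw [norm_smul]
      have := norm_add_le u w
      norm_num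
      linarith
    · have := hxu i
      have h3 := (hapos i).ne'
      simp only [PiLp.smul_apply, PiLp.add_apply, smul_eq_mul, w]
      field_simp
      linarith
  have hdisj : Set.PairwiseDisjoint (s : Set (EuclideanSpace ℝ ι))
      (fun x => Metric.closedBall x (τ / 2)) := by
    intro x hx y hy hxy
    refine Metric.closedBall_disjoint_closedBall ?_
    rw [dist_eq_norm]
    have := hsep x hx y hy hxy
    linarith
  have hvol := measure_mono (μ := volume) hsub
  rw [measure_biUnion_finset hdisj (fun x _ => Metric.isClosed_closedBall.measurableSet),
    volume_ellipsoid _ (fun i => by have := hapos i; positivity)] at hvol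
  have hb : ∀ x ∈ s, volume (Metric.closedBall x (τ / 2)) =
      ENNReal.ofReal ((τ / 2) ^ Fintype.card ι) * v := by
    intro x _
    rw [Measure.addHaar_closedBall' _ _ (by positivity), finrank_euclideanSpace]
  rw [Finset.sum_congr rfl hb, Finset.sum_const, nsmul_eq_mul, ← mul_assoc,
    ENNReal.mul_le_mul_iff_left hv0 hvt, ← ENNReal.ofReal_natCast,
    ← ENNReal.ofReal_mul (by positivity), ENNReal.ofReal_le_ofReal_iff
      (Finset.prod_nonneg fun i _ => by have := hapos i; positivity)] at hvol
  have hp : ∏ i, (4 * a i / τ) = (∏ i, 2 * a i) / (τ / 2) ^ Fintype.card ι := by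
    rw [← Finset.card_univ, ← Finset.prod_const, ← Finset.prod_div_distrib]
    refine Finset.prod_congr rfl fun i _ => ?_
    field_simp; ring
  rw [hp, le_div_iff₀ (by positivity)]
  exact hvol

/-- Volumetric covering bound for ellipsoids, with centres in the prescribed subset. -/
theorem exists_net_subset_ellipsoid {ι : Type*} [Fintype ι] (a : ι → ℝ) {τ : ℝ} (hτ : 0 < τ)
    (ha : ∀ i, τ / 2 ≤ a i) (K : Set (EuclideanSpace ℝ ι)) (hK : K ⊆ ellipsoid a) :
    ∃ s : Finset (EuclideanSpace ℝ ι), (s : Set _) ⊆ K ∧ (s.card : ℝ) ≤ ∏ i, (4 * a i / τ) ∧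
      ∀ x ∈ K, ∃ y ∈ s, ‖x - y‖ ≤ τ := by
  have hapos : ∀ i, 0 < a i := fun i => lt_of_lt_of_le (by positivity) (ha i)
  have h0 : 0 ≤ ∏ i, (4 * a i / τ) :=
    Finset.prod_nonneg fun i _ => by have := hapos i; positivity
  obtain ⟨s, h1, h2, h3⟩ := exists_maximal_separated_net K hτ.le ⌊∏ i, (4 * a i / τ)⌋₊
    (fun s hs hsep => Nat.le_floor (card_le_of_separated_ellipsoid a hτ ha s (hs.trans hK) hsep))
  exact ⟨s, h1, (Nat.cast_le.2 h2).trans (Nat.floor_le h0), h3⟩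

theorem closedBall_subset_ellipsoid {ι : Type*} [Fintype ι] {R : ℝ} (hR : 0 < R) :
    Metric.closedBall (0 : EuclideanSpace ℝ ι) R ⊆ ellipsoid fun _ => R := by
  intro x hx
  refine ⟨R⁻¹ • x, ?_, fun i => ?_⟩
  · rw [norm_smul, norm_inv, Real.norm_of_nonneg hR.le, inv_mul_le_one₀ hR]
    simpa using hx
  · simp [hR.ne']

theorem exists_net_subset_closedBall {ι : Type*} [Fintype ι] {R τ : ℝ} (hτ : 0 < τ) (hR : τ / 2 ≤ R)
    (K : Set (EuclideanSpace ℝ ι)) (hK : K ⊆ Metric.closedBall 0 R) :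
    ∃ s : Finset (EuclideanSpace ℝ ι), (s : Set _) ⊆ K ∧
      (s.card : ℝ) ≤ (4 * R / τ) ^ Fintype.card ι ∧ ∀ x ∈ K, ∃ y ∈ s, ‖x - y‖ ≤ τ := by
  have h := exists_net_subset_ellipsoid (fun _ : ι => R) hτ (fun _ => hR) K
    (hK.trans (closedBall_subset_ellipsoid (by linarith)))
  simpa only [Finset.prod_const, Finset.card_univ] using h

/-- One step of the greedy covering argument: some point lies in a proportion `p` of the sets. -/
theorem exists_hit_fraction {X : Type*} [MeasurableSpace X] (P : Measure X) [IsProbabilityMeasure P]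
    (S : X → Set X) (hS : ∀ x, MeasurableSet (S x)) {p : ℝ} (F : Finset X)
    (hp : ∀ x ∈ F, p ≤ P.real (S x)) [∀ x y, Decidable (y ∈ S x)] :
    ∃ y, ((F.filter fun x => y ∉ S x).card : ℝ) ≤ (1 - p) * F.card := by
  have hintegr : ∀ x, Integrable ((S x).indicator fun _ => (1 : ℝ)) P := fun x =>
    (integrable_const (1 : ℝ)).indicator (hS x)
  obtain ⟨y, hy⟩ := exists_integral_le (μ := P)
    (f := fun y => ∑ x ∈ F, (S x).indicator (fun _ => (1 : ℝ)) y)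
    (integrable_finsetSum _ fun x _ => hintegr x)
  refine ⟨y, ?_⟩
  rw [integral_finsetSum _ fun x _ => hintegr x] at hy
  have h1 : p * F.card ≤ ∑ x ∈ F, ∫ a, (S x).indicator (fun _ => (1 : ℝ)) a ∂P := by
    rw [mul_comm, ← nsmul_eq_mul]
    refine Finset.card_nsmul_le_sum _ _ _ fun x hx => ?_
    exact (hp x hx).trans (integral_indicator_one (hS x)).ge
  have h2 : ∑ x ∈ F, (S x).indicator (fun _ => (1 : ℝ)) y = (F.filter fun x => y ∈ S x).card := by
    rw [Finset.card_filter]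
    push_cast
    exact Finset.sum_congr rfl fun x _ => by simp [Set.indicator_apply]
  have h3 := Finset.card_filter_add_card_filter_not (s := F) (fun x => y ∈ S x)
  have h4 : ((F.filter fun x => y ∈ S x).card : ℝ) + (F.filter fun x => y ∉ S x).card = F.card := by
    exact_mod_cast h3
  linarith

/-- Greedy covering: if every set `S x`, `x ∈ F`, has probability at least `p`, then few points
suffice to hit all of them. -/
theorem exists_hitting_finset {X : Type*} [MeasurableSpace X] (P : Measure X)
    [IsProbabilityMeasure P] (S : X → Set X) (hS : ∀ x, MeasurableSet (S x)) {p : ℝ} (hp1 : p ≤ 1)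
    (F : Finset X) (hp : ∀ x ∈ F, p ≤ P.real (S x)) (k : ℕ) (hk : F.card * (1 - p) ^ k < 1) :
    ∃ Y : Finset X, Y.card ≤ k ∧ ∀ x ∈ F, ∃ y ∈ Y, y ∈ S x := by
  classical
  have key : ∀ k : ℕ, ∃ Y : Finset X, Y.card ≤ k ∧
      ((F.filter fun x => ∀ y ∈ Y, y ∉ S x).card : ℝ) ≤ F.card * (1 - p) ^ k := by
    intro k
    induction k with
    | zero => exact ⟨∅, by simp, by simp⟩
    | succ k ih =>
      obtain ⟨Y, hY, hc⟩ := ih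
      obtain ⟨y, hy⟩ := exists_hit_fraction P S hS (F.filter fun x => ∀ y ∈ Y, y ∉ S x)
        (fun x hx => hp x (Finset.mem_filter.1 hx).1)
      refine ⟨insert y Y, (Finset.card_insert_le _ _).trans (by omega), ?_⟩
      have : (F.filter fun x => ∀ z ∈ insert y Y, z ∉ S x) =
          ((F.filter fun x => ∀ y ∈ Y, y ∉ S x).filter fun x => y ∉ S x) := by
        ext x
        simp only [Finset.mem_filter, Finset.mem_insert, forall_eq_or_imp]
        tauto
      rw [this]
      refine hy.trans ?_
      rw [pow_succ]
      nlinarith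
  obtain ⟨Y, hY, hc⟩ := key k
  refine ⟨Y, hY, fun x hx => ?_⟩
  by_contra! hne
  have hpos : 1 ≤ (F.filter fun x => ∀ y ∈ Y, y ∉ S x).card :=
    Finset.card_pos.2 ⟨x, Finset.mem_filter.2 ⟨hx, hne⟩⟩
  have : (1 : ℝ) ≤ (F.filter fun x => ∀ y ∈ Y, y ∉ S x).card := by exact_mod_cast hpos
  linarith

section Slab
variable {ι : Type*} [Fintype ι]

theorem integrableOn_inner_sq (x : EuclideanSpace ℝ ι) (s : ℝ) :
    IntegrableOn (fun z => ⟪x, z⟫ ^ 2) (Metric.closedBall (0 : EuclideanSpace ℝ ι) s) :=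
  ContinuousOn.integrableOn_compact (isCompact_closedBall _ _) (by fun_prop)

theorem setIntegral_inner_sq_eq {x y : EuclideanSpace ℝ ι} (h : ‖x‖ = ‖y‖) (s : ℝ) :
    ∫ z in Metric.closedBall (0 : EuclideanSpace ℝ ι) s, ⟪x, z⟫ ^ 2 =
      ∫ z in Metric.closedBall (0 : EuclideanSpace ℝ ι) s, ⟪y, z⟫ ^ 2 := by
  set R := Submodule.reflection (Submodule.span ℝ {x - y})ᗮ with hR
  have hRx : R x = y := Submodule.reflection_sub h
  have hmp : MeasurePreserving R volume volume := R.measurePreserving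
  have hpre : R ⁻¹' Metric.closedBall (0 : EuclideanSpace ℝ ι) s = Metric.closedBall 0 s := by
    ext z; simp
  have := hmp.setIntegral_preimage_emb R.toHomeomorph.measurableEmbedding
    (fun z => ⟪y, z⟫ ^ 2) (Metric.closedBall 0 s)
  rw [hpre] at this
  rw [← this]
  refine integral_congr_ae (ae_of_all _ fun z => ?_)
  simp only
  rw [← hRx, LinearIsometryEquiv.inner_map_map]

theorem card_mul_setIntegral_inner_sq_le {x : EuclideanSpace ℝ ι} (hx : ‖x‖ = 1) (s : ℝ) :
    Fintype.card ι * ∫ z in Metric.closedBall (0 : EuclideanSpace ℝ ι) s, ⟪x, z⟫ ^ 2 ≤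
      s ^ 2 * volume.real (Metric.closedBall (0 : EuclideanSpace ℝ ι) s) := by
  classical
  have h1 : ∀ i : ι, ∫ z in Metric.closedBall (0 : EuclideanSpace ℝ ι) s, ⟪x, z⟫ ^ 2 =
      ∫ z in Metric.closedBall (0 : EuclideanSpace ℝ ι) s,
        ⟪EuclideanSpace.single i (1 : ℝ), z⟫ ^ 2 := fun i =>
    setIntegral_inner_sq_eq (by simp [hx]) s
  have h2 : Fintype.card ι * ∫ z in Metric.closedBall (0 : EuclideanSpace ℝ ι) s, ⟪x, z⟫ ^ 2 =
      ∫ z in Metric.closedBall (0 : EuclideanSpace ℝ ι) s, ‖z‖ ^ 2 := by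
    rw [← nsmul_eq_mul, ← Finset.card_univ, ← Finset.sum_const, Finset.sum_congr rfl fun i _ => h1 i,
      ← integral_finsetSum _ fun i _ => integrableOn_inner_sq _ s]
    refine integral_congr_ae (ae_of_all _ fun z => ?_)
    simp [EuclideanSpace.norm_sq_eq, EuclideanSpace.inner_single_left]
  rw [h2]
  have h3 : ∫ z in Metric.closedBall (0 : EuclideanSpace ℝ ι) s, ‖z‖ ^ 2 ≤
      ∫ _ in Metric.closedBall (0 : EuclideanSpace ℝ ι) s, s ^ 2 := by
    refine setIntegral_mono_on ?_ ?_ Metric.isClosed_closedBall.measurableSet fun z hz => ?_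
    · exact ContinuousOn.integrableOn_compact (isCompact_closedBall _ _) (by fun_prop)
    · exact ContinuousOn.integrableOn_compact (isCompact_closedBall _ _) (by fun_prop)
    · have : ‖z‖ ≤ s := by simpa using hz
      gcongr
  refine h3.trans (le_of_eq ?_)
  simp [mul_comm]

/-- In high dimension half of the volume of a ball lies in a central slab of fixed width. -/
theorem half_volume_le_slab {x : EuclideanSpace ℝ ι} (hx : ‖x‖ = 1) {s h : ℝ} (hs : 0 < s)
    (hh : 0 < h) (hn : 2 * s ^ 2 ≤ Fintype.card ι * h ^ 2) :
    volume.real (Metric.closedBall (0 : EuclideanSpace ℝ ι) s) / 2 ≤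
      volume.real (Metric.closedBall (0 : EuclideanSpace ℝ ι) s ∩ {z | |⟪x, z⟫| < h}) := by
  set B := Metric.closedBall (0 : EuclideanSpace ℝ ι) s
  have hB : MeasurableSet B := Metric.isClosed_closedBall.measurableSet
  have hBt : volume B ≠ ⊤ := measure_closedBall_lt_top.ne
  set T : Set (EuclideanSpace ℝ ι) := {z | |⟪x, z⟫| < h}
  have hT : MeasurableSet T := measurableSet_lt (by fun_prop) (by fun_prop)
  have hcheb := mul_meas_ge_le_integral_of_nonneg (μ := volume.restrict B)
    (f := fun z => ⟪x, z⟫ ^ 2) (ae_of_all _ fun z => sq_nonneg _) (integrableOn_inner_sq x s) (h ^ 2)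
  have hset : {z : EuclideanSpace ℝ ι | h ^ 2 ≤ ⟪x, z⟫ ^ 2} = Tᶜ := by
    ext z
    simp only [Set.mem_ofPred_eq, Set.mem_compl_iff, T, not_lt]
    rw [sq_le_sq, abs_of_pos hh]
  rw [hset, measureReal_restrict_apply hT.compl, Set.inter_comm] at hcheb
  have hI := card_mul_setIntegral_inner_sq_le hx s
  have hadd := measureReal_inter_add_sdiff (μ := volume) (s := B) hT hBt
  rw [Set.sdiff_eq] at hadd
  set I := ∫ z in B, ⟪x, z⟫ ^ 2
  set V := volume.real B
  set W := volume.real (B ∩ Tᶜ)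
  have hV : 0 ≤ V := measureReal_nonneg
  have hW : 0 ≤ W := measureReal_nonneg
  have h5 : Fintype.card ι * h ^ 2 * W ≤ s ^ 2 * V := by nlinarith
  have h6 : 2 * s ^ 2 * W ≤ s ^ 2 * V := by nlinarith
  have h7 : 2 * W ≤ V := by nlinarith [pow_pos hs 2]
  linarith

/-- The lens between the ball of radius `√(1-δ²)` and the ball of radius `δ` around a unit vector
occupies a proportion of almost `δ ^ n` of the former. -/
theorem lens_volume_ge {u : EuclideanSpace ℝ ι} (hu : ‖u‖ = 1) {δ r q : ℝ} (hδ : 0 < δ) (hr : 0 < r)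
    (hδr : δ ^ 2 + r ^ 2 = 1) (hq : 0 < q) (hq1 : q < 1)
    (hn : 2 * (δ * r * q) ^ 2 ≤ Fintype.card ι * (δ ^ 2 * r ^ 2 * (1 - q ^ 2) / 2) ^ 2) :
    (δ * q) ^ Fintype.card ι / 2 * volume.real (Metric.closedBall (0 : EuclideanSpace ℝ ι) r) ≤
      volume.real (Metric.closedBall (0 : EuclideanSpace ℝ ι) r ∩ Metric.closedBall u δ) := by
  set h := δ ^ 2 * r ^ 2 * (1 - q ^ 2) / 2 with hh
  have hh0 : 0 < h := by
    have : 0 < 1 - q ^ 2 := by nlinarith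
    positivity
  have hslab := half_volume_le_slab hu (s := δ * r * q) (by positivity) hh0 hn
  have hball : volume.real (Metric.closedBall (0 : EuclideanSpace ℝ ι) (δ * r * q)) =
      (δ * q) ^ Fintype.card ι * volume.real (Metric.closedBall (0 : EuclideanSpace ℝ ι) r) := by
    rw [Measure.real, Measure.real, show δ * r * q = (δ * q) * r by ring,
      Measure.addHaar_closedBall_mul _ _ (by positivity) hr.le, finrank_euclideanSpace,
      ENNReal.toReal_mul, ENNReal.toReal_ofReal (by positivity)]
  rw [hball] at hslab
  have hsub : (fun z => r ^ 2 • u + z) ''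
      (Metric.closedBall (0 : EuclideanSpace ℝ ι) (δ * r * q) ∩ {z | |⟪u, z⟫| < h}) ⊆
      Metric.closedBall (0 : EuclideanSpace ℝ ι) r ∩ Metric.closedBall u δ := by
    rintro _ ⟨z, ⟨hz, hz2⟩, rfl⟩
    have hz1 : ‖z‖ ^ 2 ≤ (δ * r * q) ^ 2 := by
      have : ‖z‖ ≤ δ * r * q := by simpa using hz
      gcongr
    have hz2 : |⟪u, z⟫| < h := hz2
    rw [abs_lt] at hz2
    have hδ1 : δ ^ 2 ≤ 1 := by nlinarith
    have hr1 : r ^ 2 ≤ 1 := by nlinarith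
    have e1 : 2 * h = δ ^ 2 * r ^ 2 - (δ * r * q) ^ 2 := by rw [hh]; ring
    constructor
    · rw [Metric.mem_closedBall, dist_zero_right]
      refine le_of_sq_le_sq ?_ hr.le
      rw [norm_add_sq_real, norm_smul, hu, real_inner_smul_left, Real.norm_of_nonneg (by positivity)]
      have : r ^ 2 * ⟪u, z⟫ ≤ h := by nlinarith [sq_nonneg r]
      have e2 : δ ^ 2 * r ^ 2 = r ^ 2 - (r ^ 2) ^ 2 := by
        rw [show δ ^ 2 = 1 - r ^ 2 by linarith]; ring
      nlinarith
    · rw [Metric.mem_closedBall, dist_eq_norm]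
      refine le_of_sq_le_sq ?_ hδ.le
      rw [show r ^ 2 • u + z - u = (-δ ^ 2) • u + z by
        rw [show (-δ ^ 2) = r ^ 2 - 1 by linarith, sub_smul, one_smul]; abel]
      rw [norm_add_sq_real, norm_smul, hu, real_inner_smul_left, norm_neg,
        Real.norm_of_nonneg (by positivity)]
      have : -δ ^ 2 * ⟪u, z⟫ ≤ h := by nlinarith [sq_nonneg δ]
      have e2 : δ ^ 2 * r ^ 2 = δ ^ 2 - (δ ^ 2) ^ 2 := by
        rw [show r ^ 2 = 1 - δ ^ 2 by linarith]; ring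
      nlinarith
  have hfin : volume (Metric.closedBall (0 : EuclideanSpace ℝ ι) r ∩ Metric.closedBall u δ) ≠ ⊤ :=
    ((measure_mono Set.inter_subset_left).trans_lt measure_closedBall_lt_top).ne
  have hle := measureReal_mono hsub hfin
  rw [Measure.real, Set.image_add_left, measure_preimage_add] at hle
  refine le_trans ?_ hle
  rw [Measure.real] at hslab ⊢
  rw [Measure.real] at hslab
  linarith

end Slab

/-- Sphere covering with the sharp exponential rate `δ ^ (-n)`. -/
theorem exists_sphere_cover {δ₀ κ : ℝ} (hδ₀ : 0 < δ₀) (hδ₁ : δ₀ < 1) (hκ : 0 < κ) :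
    ∃ n₀ : ℕ, ∀ (ι : Type) [Fintype ι], n₀ ≤ Fintype.card ι →
      ∃ Y : Finset (EuclideanSpace ℝ ι),
        (Y.card : ℝ) ≤ exp (Fintype.card ι * (log (1 / δ₀) + κ)) ∧
        ∀ u : EuclideanSpace ℝ ι, ‖u‖ = 1 → ∃ y ∈ Y, ‖u - y‖ ≤ δ₀ := by
  set q := exp (-κ / 4) with hq
  have hq0 : 0 < q := exp_pos _
  have hq1 : q < 1 := exp_lt_one_iff.2 (by linarith)
  set δ := δ₀ * q with hδ
  have hδ0 : 0 < δ := by positivity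
  have hδlt : δ < δ₀ := by rw [hδ]; nlinarith
  set r := √(1 - δ ^ 2) with hr
  have hr2 : 0 < 1 - δ ^ 2 := by nlinarith
  have hr0 : 0 < r := sqrt_pos.2 hr2
  have hδr : δ ^ 2 + r ^ 2 = 1 := by rw [hr, sq_sqrt hr2.le]; ring
  set τ := δ₀ - δ with hτ
  have hτ0 : 0 < τ := by linarith
  set h := δ ^ 2 * r ^ 2 * (1 - q ^ 2) / 2 with hh
  have hh0 : 0 < h := by
    have : 0 < 1 - q ^ 2 := by nlinarith
    positivity
  set C := log (4 / τ) with hC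
  have hlim1 : ∀ᶠ n : ℕ in atTop, 2 * (δ * r * q) ^ 2 ≤ n * h ^ 2 :=
    (tendsto_natCast_atTop_atTop.atTop_mul_const (by positivity)).eventually_ge_atTop _
  have hlim2 : ∀ᶠ n : ℕ in atTop, 2 * (n * C) + 2 ≤ exp (n * (κ / 2)) := by
    have h1 : Tendsto (fun x : ℝ => x ^ 2 * exp (-x)) atTop (nhds 0) := by
      simpa using tendsto_pow_mul_exp_neg_atTop_nhds_zero 2
    have h2 : Tendsto (fun n : ℕ => (n : ℝ) * (κ / 2)) atTop atTop :=
      tendsto_natCast_atTop_atTop.atTop_mul_const (by positivity)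
    have h3 : ∀ᶠ n : ℕ in atTop, 4 * C / κ + 2 ≤ (n : ℝ) * (κ / 2) :=
      h2.eventually_ge_atTop _
    have h4 : ∀ᶠ n : ℕ in atTop, 1 ≤ (n : ℝ) * (κ / 2) := h2.eventually_ge_atTop _
    filter_upwards [(h1.comp h2).eventually (gt_mem_nhds one_pos), h3, h4] with n hn hn3 hn4
    simp only [Function.comp_apply] at hn
    rw [exp_neg, ← div_eq_mul_inv, div_lt_one (exp_pos _)] at hn
    refine le_trans ?_ hn.le
    have e : 2 * (n * C) = (n * (κ / 2)) * (4 * C / κ) := by field_simp; ring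
    rw [e]
    nlinarith
  obtain ⟨n₀, hn₀⟩ := eventually_atTop.1 (hlim1.and hlim2)
  refine ⟨n₀, fun ι _ hι => ?_⟩
  obtain ⟨hn1, hn2⟩ := hn₀ _ hι
  set n := Fintype.card ι with hn
  obtain ⟨F, hFS, hFc, hF⟩ := exists_net_subset_closedBall (ι := ι) (R := 1) hτ0 (by linarith)
    (Metric.sphere (0 : EuclideanSpace ℝ ι) 1) Metric.sphere_subset_closedBall
  set B := Metric.closedBall (0 : EuclideanSpace ℝ ι) r with hB
  have hBm : MeasurableSet B := Metric.isClosed_closedBall.measurableSet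
  have hB0 : volume B ≠ 0 := (Metric.measure_closedBall_pos _ _ hr0).ne'
  have hBt : volume B ≠ ⊤ := measure_closedBall_lt_top.ne
  have : IsProbabilityMeasure (cond volume B) := cond_isProbabilityMeasure_of_finite hB0 hBt
  set p : ℝ := (δ * q) ^ n / 2 with hp
  have hδq : 0 < δ * q := by positivity
  have hp0 : 0 < p := by positivity
  have hδq1 : δ * q ≤ 1 := by nlinarith
  have hp1 : p ≤ 1 := by
    have : (δ * q) ^ n ≤ 1 := pow_le_one₀ hδq.le hδq1
    rw [hp]; linarith
  set k := ⌊log F.card / p⌋₊ + 1 with hk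
  have hprob : ∀ x ∈ F, p ≤ (cond volume B).real (Metric.closedBall x δ) := by
    intro x hx
    have hx1 : ‖x‖ = 1 := by simpa using hFS hx
    have hl := lens_volume_ge hx1 hδ0 hr0 hδr hq0 hq1 hn1
    rw [Measure.real, cond_apply hBm, ENNReal.toReal_mul, ENNReal.toReal_inv]
    have hBr : 0 < (volume B).toReal := ENNReal.toReal_pos hB0 hBt
    rw [inv_mul_eq_div, le_div_iff₀ hBr]
    exact hl
  have hkk : F.card * (1 - p) ^ k < 1 := by
    rcases Nat.eq_zero_or_pos F.card with h0 | h0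
    · simp [h0]
    have hF0 : (0 : ℝ) < F.card := by exact_mod_cast h0
    have h1 : (1 - p) ^ k ≤ exp (-p * k) := by
      rw [mul_comm, exp_nat_mul]
      exact pow_le_pow_left₀ (by linarith) (by linarith [add_one_le_exp (-p)]) _
    have h2 : log F.card < p * k := by
      have : log F.card / p < k := by
        rw [hk]; push_cast; exact Nat.lt_floor_add_one _
      rw [div_lt_iff₀ hp0] at this
      linarith
    calc (F.card : ℝ) * (1 - p) ^ k ≤ exp (log F.card) * exp (-p * k) := by
          rw [exp_log hF0]; gcongr
      _ = exp (log F.card - p * k) := by rw [← exp_add]; ring_nf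
      _ < 1 := exp_lt_one_iff.2 (by linarith)
  obtain ⟨Y, hYc, hY⟩ := exists_hitting_finset (cond volume B) (fun x => Metric.closedBall x δ)
    (fun x => Metric.isClosed_closedBall.measurableSet) hp1 F hprob k hkk
  refine ⟨Y, ?_, fun u hu => ?_⟩
  · have hlogF : log F.card ≤ n * C := by
      rcases Nat.eq_zero_or_pos F.card with h0 | h0
      · simp only [h0, Nat.cast_zero, log_zero]
        have : 1 ≤ 4 / τ := by rw [le_div_iff₀ hτ0]; linarith
        have := log_nonneg this
        positivity
      · have := log_le_log (by exact_mod_cast h0) hFc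
        rwa [log_pow, mul_one] at this
    have hC0 : 0 ≤ log F.card := log_natCast_nonneg _
    have h1 : (Y.card : ℝ) ≤ n * C / p + 1 := by
      calc (Y.card : ℝ) ≤ k := by exact_mod_cast hYc
        _ ≤ log F.card / p + 1 := by
          rw [hk]; push_cast; gcongr; exact Nat.floor_le (by positivity)
        _ ≤ _ := by gcongr
    have hpe : exp (n * (log (1 / δ₀) + κ / 2)) = 1 / (δ * q) ^ n := by
      rw [exp_nat_mul, exp_add, exp_log (by positivity), one_div, one_div, ← inv_pow]
      congr 1
      rw [hδ, mul_inv, mul_inv, mul_assoc, ← mul_inv, hq, ← exp_add, ← exp_neg]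
      congr 2; ring
    calc (Y.card : ℝ) ≤ n * C / p + 1 := h1
      _ ≤ (2 * (n * C) + 2) * (1 / (δ * q) ^ n) := by
        have h2 : 1 ≤ 1 / (δ * q) ^ n := by
          rw [one_le_div (by positivity)]; exact pow_le_one₀ hδq.le hδq1
        have h3 : n * C / p = 2 * (n * C) * (1 / (δ * q) ^ n) := by
          rw [hp]; field_simp
        rw [h3]; nlinarith
      _ ≤ exp (n * (κ / 2)) * exp (n * (log (1 / δ₀) + κ / 2)) := by
        rw [hpe]; gcongr
      _ = _ := by rw [← exp_add]; ring_nf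
  · obtain ⟨x, hx, hux⟩ := hF u (by simpa using hu)
    obtain ⟨y, hy, hxy⟩ := hY x hx
    refine ⟨y, hy, ?_⟩
    rw [Metric.mem_closedBall, dist_eq_norm, norm_sub_rev] at hxy
    calc ‖u - y‖ = ‖(u - x) + (x - y)‖ := by congr 1; abel
      _ ≤ ‖u - x‖ + ‖x - y‖ := norm_add_le _ _
      _ ≤ δ₀ := by linarith

/-- A code of size at most `N` for the coordinates in `J` of the ellipsoid with semi-axes `a`,
whose squared error is at most `ε²` times the squared norm of the preimage, up to the slack `κ`. -/
def QuadCode (a : ℕ → ℝ) (ε κ : ℝ) (J : Finset ℕ) (N : ℝ) : Prop :=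
  ∃ Z : Finset (ℕ → ℝ), (Z.card : ℝ) ≤ N ∧ ∀ x : ℕ → ℝ, ∑ j ∈ J, x j ^ 2 ≤ 1 →
    ∃ z ∈ Z, ∑ j ∈ J, (a j * x j - z j) ^ 2 ≤ ε ^ 2 * (∑ j ∈ J, x j ^ 2 + κ)

namespace QuadCode

variable {a A : ℕ → ℝ} {ε κ κ₁ κ₂ N N₁ N₂ : ℝ} {J J₁ J₂ : Finset ℕ}

theorem mono_card (h : QuadCode a ε κ J N₁) (hN : N₁ ≤ N₂) : QuadCode a ε κ J N₂ := by
  obtain ⟨Z, hZ, h⟩ := h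
  exact ⟨Z, hZ.trans hN, h⟩

theorem union (h₁ : QuadCode a ε κ₁ J₁ N₁) (h₂ : QuadCode a ε κ₂ J₂ N₂) (hJ : Disjoint J₁ J₂) :
    QuadCode a ε (κ₁ + κ₂) (J₁ ∪ J₂) (N₁ * N₂) := by
  classical
  obtain ⟨Z₁, hZ₁, h₁⟩ := h₁
  obtain ⟨Z₂, hZ₂, h₂⟩ := h₂
  refine ⟨(Z₁ ×ˢ Z₂).image fun z => fun j => if j ∈ J₁ then z.1 j else z.2 j, ?_, fun x hx => ?_⟩
  · refine (Nat.cast_le.2 Finset.card_image_le).trans ?_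
    rw [Finset.card_product]
    push_cast
    exact mul_le_mul hZ₁ hZ₂ (by positivity) ((Nat.cast_nonneg _).trans hZ₁)
  · rw [Finset.sum_union hJ] at hx
    have p1 : 0 ≤ ∑ j ∈ J₁, x j ^ 2 := Finset.sum_nonneg fun _ _ => sq_nonneg _
    have p2 : 0 ≤ ∑ j ∈ J₂, x j ^ 2 := Finset.sum_nonneg fun _ _ => sq_nonneg _
    obtain ⟨z₁, hz₁, e₁⟩ := h₁ x (by linarith)
    obtain ⟨z₂, hz₂, e₂⟩ := h₂ x (by linarith)
    refine ⟨_, Finset.mem_image.2 ⟨(z₁, z₂), Finset.mk_mem_product hz₁ hz₂, rfl⟩, ?_⟩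
    rw [Finset.sum_union hJ, Finset.sum_union hJ]
    have q1 : ∑ j ∈ J₁, (a j * x j - if j ∈ J₁ then z₁ j else z₂ j) ^ 2 =
        ∑ j ∈ J₁, (a j * x j - z₁ j) ^ 2 :=
      Finset.sum_congr rfl fun j hj => by rw [if_pos hj]
    have q2 : ∑ j ∈ J₂, (a j * x j - if j ∈ J₁ then z₁ j else z₂ j) ^ 2 =
        ∑ j ∈ J₂, (a j * x j - z₂ j) ^ 2 :=
      Finset.sum_congr rfl fun j hj => by
        rw [if_neg (Finset.disjoint_right.1 hJ hj)]
    simp only [q1, q2]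
    linarith

theorem of_le (h : QuadCode A ε κ J N) (ha : ∀ j ∈ J, 0 ≤ a j) (haA : ∀ j ∈ J, a j ≤ A j)
    (hA : ∀ j ∈ J, 0 < A j) : QuadCode a ε κ J N := by
  obtain ⟨Z, hZ, h⟩ := h
  refine ⟨Z, hZ, fun x hx => ?_⟩
  have hle : ∑ j ∈ J, (a j * x j / A j) ^ 2 ≤ ∑ j ∈ J, x j ^ 2 := by
    refine Finset.sum_le_sum fun j hj => ?_
    have h1 : a j / A j ≤ 1 := (div_le_one (hA j hj)).2 (haA j hj)
    have h0 : 0 ≤ a j / A j := div_nonneg (ha j hj) (hA j hj).le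
    have h2 : (a j / A j) ^ 2 ≤ 1 := pow_le_one₀ h0 h1
    calc (a j * x j / A j) ^ 2 = (a j / A j) ^ 2 * x j ^ 2 := by ring
      _ ≤ 1 * x j ^ 2 := by gcongr
      _ = _ := one_mul _
  obtain ⟨z, hz, e⟩ := h (fun j => a j * x j / A j) (hle.trans hx)
  refine ⟨z, hz, ?_⟩
  calc ∑ j ∈ J, (a j * x j - z j) ^ 2 = ∑ j ∈ J, (A j * (a j * x j / A j) - z j) ^ 2 :=
        Finset.sum_congr rfl fun j hj => by rw [mul_div_cancel₀ _ (hA j hj).ne']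
    _ ≤ _ := e
    _ ≤ _ := by gcongr

theorem of_ellipsoid_net (hε : 0 < ε) (hκ : 0 < κ) (ha : ∀ j ∈ J, ε * √κ / 2 ≤ a j) :
    QuadCode a ε κ J (∏ j ∈ J, (4 * a j / (ε * √κ))) := by
  classical
  have hτ : 0 < ε * √κ := by positivity
  obtain ⟨s, -, hc, hs⟩ := exists_net_subset_ellipsoid (fun j : J => a j) hτ
    (fun j => ha j j.2) _ subset_rfl
  rw [Finset.prod_coe_sort J fun j => 4 * a j / (ε * √κ)] at hc
  refine ⟨s.image fun y => fun j => if h : j ∈ J then y ⟨j, h⟩ else 0,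
    (Nat.cast_le.2 Finset.card_image_le).trans hc, fun x hx => ?_⟩
  obtain ⟨y, hy, e⟩ := hs (WithLp.toLp 2 fun j : J => a j * x j)
    ⟨WithLp.toLp 2 fun j : J => x j, by
      rw [EuclideanSpace.norm_eq, sqrt_le_one]
      rw [← Finset.sum_coe_sort J] at hx
      simpa only [Real.norm_eq_abs, sq_abs] using hx, fun i => by simp⟩
  refine ⟨_, Finset.mem_image_of_mem _ hy, ?_⟩
  have e2 := pow_le_pow_left₀ (norm_nonneg _) e 2
  rw [EuclideanSpace.norm_sq_eq, mul_pow, sq_sqrt hκ.le] at e2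
  have p1 : 0 ≤ ∑ j ∈ J, x j ^ 2 := Finset.sum_nonneg fun _ _ => sq_nonneg _
  calc ∑ j ∈ J, (a j * x j - if h : j ∈ J then y ⟨j, h⟩ else 0) ^ 2
      = ∑ j : J, (a j * x j - y j) ^ 2 := by
        rw [← Finset.sum_coe_sort J]
        exact Finset.sum_congr rfl fun j _ => by simp
    _ ≤ ε ^ 2 * κ := by simpa using e2
    _ ≤ _ := by gcongr; linarith

/-- Coding of a long block of coordinates with comparable semi-axes: the block is described by its
norm, up to a fixed precision, and its direction, using the sharp sphere covering. -/
theorem exists_block {δ κ η : ℝ} (hδ : 0 < δ) (hδ₁ : δ < 1) (hκ : 0 < κ) (hη : 0 < η) :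
    ∃ n₀ : ℕ, ∀ J : Finset ℕ, n₀ ≤ J.card → ∀ ε > 0,
      QuadCode (fun _ => ε / δ) ε κ J (exp (J.card * (log (1 / δ) + η))) := by
  classical
  obtain ⟨n₁, hn₁⟩ := exists_sphere_cover hδ hδ₁ (half_pos hη)
  set θ := min 1 (κ / 3) with hθ
  have hθ0 : 0 < θ := by positivity
  have hθ1 : θ ≤ 1 := min_le_left _ _
  have hθκ : 3 * θ ≤ κ := by have := min_le_right 1 (κ / 3); linarith
  set M := ⌊1 / (δ * θ)⌋₊ + 1 with hM
  have hlim : ∀ᶠ n : ℕ in atTop, (M : ℝ) + 1 ≤ exp (n * (η / 2)) :=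
    (tendsto_exp_atTop.comp (tendsto_natCast_atTop_atTop.atTop_mul_const
      (half_pos hη))).eventually_ge_atTop _
  obtain ⟨n₂, hn₂⟩ := eventually_atTop.1 hlim
  refine ⟨max n₁ n₂, fun J hJ ε hε => ?_⟩
  obtain ⟨Y, hYc, hY⟩ := hn₁ J (by simpa using (le_max_left _ _).trans hJ)
  have hM2 := hn₂ J.card ((le_max_right _ _).trans hJ)
  rw [Fintype.card_coe] at hYc
  let emb : EuclideanSpace ℝ J → ℕ → ℝ := fun y j => if h : j ∈ J then y ⟨j, h⟩ else 0
  have hlogδ : 0 ≤ log (1 / δ) := log_nonneg (by rw [le_div_iff₀ hδ]; linarith)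
  have hexp1 : 1 ≤ exp (J.card * (log (1 / δ) + η / 2)) := one_le_exp (by positivity)
  refine ⟨insert 0 ((Y ×ˢ Finset.range M).image fun p => emb ((θ * ε * p.2) • p.1)), ?_,
    fun x hx => ?_⟩
  · calc ((insert 0 ((Y ×ˢ Finset.range M).image
          fun p => emb ((θ * ε * p.2) • p.1))).card : ℝ) ≤ Y.card * M + 1 := by
          refine (Nat.cast_le.2 (Finset.card_insert_le _ _)).trans ?_
          push_cast
          gcongr
          refine (Nat.cast_le.2 Finset.card_image_le).trans ?_
          rw [Finset.card_product, Finset.card_range]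
          push_cast; rfl
      _ ≤ exp (J.card * (log (1 / δ) + η / 2)) * (M + 1) := by nlinarith
      _ ≤ exp (J.card * (log (1 / δ) + η / 2)) * exp (J.card * (η / 2)) := by gcongr
      _ = _ := by rw [← exp_add]; ring_nf
  · set w : EuclideanSpace ℝ J := WithLp.toLp 2 fun j : J => ε / δ * x j with hw
    set P := ∑ j ∈ J, x j ^ 2 with hP
    have hP0 : 0 ≤ P := Finset.sum_nonneg fun _ _ => sq_nonneg _
    have hwn : ‖w‖ = ε / δ * √P := by
      have : ‖w‖ ^ 2 = (ε / δ * √P) ^ 2 := by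
        rw [EuclideanSpace.norm_sq_eq, mul_pow, sq_sqrt hP0, hP, ← Finset.sum_coe_sort J,
          Finset.mul_sum]
        exact Finset.sum_congr rfl fun j _ => by
          rw [hw, Real.norm_eq_abs, sq_abs, ← mul_pow]
      exact (pow_left_inj₀ (norm_nonneg _) (by positivity) two_ne_zero).1 this
    have hsum : ∀ y : EuclideanSpace ℝ J,
        ∑ j ∈ J, (ε / δ * x j - emb y j) ^ 2 = ‖w - y‖ ^ 2 := by
      intro y
      rw [EuclideanSpace.norm_sq_eq, ← Finset.sum_coe_sort J]
      exact Finset.sum_congr rfl fun j _ => by simp [emb, hw]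
    rcases eq_or_lt_of_le (norm_nonneg w) with h0 | h0
    · refine ⟨0, Finset.mem_insert_self _ _, ?_⟩
      have := hsum 0
      have he : emb 0 = 0 := by funext j; simp [emb]
      rw [he] at this
      rw [this, sub_zero, ← h0, zero_pow two_ne_zero]
      positivity
    · set r := ‖w‖ with hr
      obtain ⟨y, hy, e⟩ := hY (r⁻¹ • w) (by
        rw [norm_smul, norm_inv, Real.norm_of_nonneg h0.le, inv_mul_cancel₀ h0.ne'])
      have hθε : 0 < θ * ε := by positivity
      set l := ⌊r / (θ * ε)⌋₊ with hl
      have hl1 : θ * ε * l ≤ r := by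
        have := Nat.floor_le (show 0 ≤ r / (θ * ε) by positivity)
        rw [le_div_iff₀ hθε] at this
        linarith
      have hl2 : r ≤ θ * ε * l + θ * ε := by
        have := Nat.lt_floor_add_one (r / (θ * ε))
        rw [div_lt_iff₀ hθε] at this
        nlinarith
      have hsP : √P ≤ 1 := sqrt_le_one.2 hx
      have hlM : l < M := by
        rw [hl, hM, Nat.lt_succ_iff]
        refine Nat.floor_le_floor ?_
        rw [hwn, div_le_div_iff₀ hθε (by positivity)]
        have : ε / δ * √P * (δ * θ) = ε * θ * √P := by field_simp
        rw [this]
        nlinarith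
      refine ⟨emb ((θ * ε * l) • y), Finset.mem_insert_of_mem (Finset.mem_image.2
        ⟨(y, l), Finset.mk_mem_product hy (Finset.mem_range.2 hlM), rfl⟩), ?_⟩
      rw [hsum]
      have herr : ‖w - (θ * ε * l) • y‖ ≤ ε * √P + θ * ε := by
        have d1 : w - (θ * ε * l) • y =
            (θ * ε * l) • (r⁻¹ • w - y) + (r - θ * ε * l) • (r⁻¹ • w) := by
          have : w = r • (r⁻¹ • w) := by rw [smul_smul, mul_inv_cancel₀ h0.ne', one_smul]
          rw [sub_smul, smul_sub, ← this]; abel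
        rw [d1]
        refine (norm_add_le _ _).trans ?_
        rw [norm_smul, norm_smul, norm_smul, norm_inv, Real.norm_of_nonneg h0.le,
          inv_mul_cancel₀ h0.ne', Real.norm_of_nonneg (by positivity),
          Real.norm_of_nonneg (by linarith)]
        have : θ * ε * l * ‖r⁻¹ • w - y‖ ≤ r * δ := by gcongr
        have : r * δ = ε * √P := by rw [hwn]; field_simp
        linarith
      calc ‖w - (θ * ε * l) • y‖ ^ 2 ≤ (ε * √P + θ * ε) ^ 2 := by gcongr
        _ = ε ^ 2 * (√P ^ 2 + 2 * θ * √P + θ * θ) := by ring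
        _ ≤ ε ^ 2 * (P + κ) := by
          rw [sq_sqrt hP0]
          refine mul_le_mul_of_nonneg_left ?_ (sq_nonneg _)
          have h1 : θ * √P ≤ θ * 1 := by gcongr
          have h2 : θ * θ ≤ θ * 1 := by gcongr
          linarith

end QuadCode

theorem HilbertBasis.hasSum_inner_sq {H : Type*} [NormedAddCommGroup H] [InnerProductSpace ℝ H]
    (b : HilbertBasis ℕ ℝ H) (x : H) : HasSum (fun j => ⟪b j, x⟫ ^ 2) (‖x‖ ^ 2) := by
  have := b.hasSum_inner_mul_inner x x
  rw [real_inner_self_eq_norm_sq] at this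
  refine this.congr_fun fun j => ?_
  rw [real_inner_comm, sq]

/-- A code for the leading coordinates of a diagonal image of the unit ball gives a covering. -/
theorem Coverable.of_quadCode {H : Type*} [NormedAddCommGroup H] [InnerProductSpace ℝ H]
    (e f : HilbertBasis ℕ ℝ H) {a : ℕ → ℝ} {ε κ N : ℝ} {n : ℕ} (hκ : 0 ≤ κ) (hε : 0 ≤ ε)
    (h : QuadCode a ε κ (Finset.range n) N) (ha : ∀ j, 0 ≤ a j) (han : ∀ j, n ≤ j → a j ≤ ε)
    (K : Set H) (hK : ∀ y ∈ K, ∃ x : H, ‖x‖ ≤ 1 ∧ ∀ j, ⟪f j, y⟫ = a j * ⟪e j, x⟫) :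
    Coverable K (ε * √(1 + κ)) N := by
  classical
  obtain ⟨Z, hZ, h⟩ := h
  refine ⟨Z.image fun z => ∑ j ∈ Finset.range n, z j • f j,
    (Nat.cast_le.2 Finset.card_image_le).trans hZ, fun y hy => ?_⟩
  obtain ⟨x, hx, hxy⟩ := hK y hy
  have hx2 : ‖x‖ ^ 2 ≤ 1 := pow_le_one₀ (norm_nonneg _) hx
  have hs := e.hasSum_inner_sq x
  obtain ⟨z, hz, er⟩ := h (fun j => ⟪e j, x⟫)
    ((sum_le_hasSum _ (fun _ _ => sq_nonneg _) hs).trans hx2)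
  refine ⟨_, Finset.mem_image_of_mem _ hz, ?_⟩
  set c := ∑ j ∈ Finset.range n, z j • f j with hc
  have hcj : ∀ j, ⟪f j, c⟫ = if j ∈ Finset.range n then z j else 0 := by
    intro j
    rw [hc, inner_sum]
    simp only [real_inner_smul_right, orthonormal_iff_ite.1 f.orthonormal]
    simp
  set g : ℕ → ℝ := fun j => if j ∈ Finset.range n then
    (a j * ⟪e j, x⟫ - z j) ^ 2 - ε ^ 2 * ⟪e j, x⟫ ^ 2 else 0 with hg
  have hgs : HasSum g (∑ j ∈ Finset.range n, g j) :=
    hasSum_sum_of_ne_finset_zero fun j hj => if_neg hj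
  have hle := hasSum_le (fun j => ?_) (f.hasSum_inner_sq (y - c)) ((hs.mul_left (ε ^ 2)).add hgs)
  · have hgsum : ∑ j ∈ Finset.range n, g j = ∑ j ∈ Finset.range n, (a j * ⟪e j, x⟫ - z j) ^ 2 -
        ε ^ 2 * ∑ j ∈ Finset.range n, ⟪e j, x⟫ ^ 2 := by
      rw [Finset.mul_sum, ← Finset.sum_sub_distrib]
      exact Finset.sum_congr rfl fun j hj => if_pos hj
    refine le_of_sq_le_sq ?_ (by positivity)
    rw [mul_pow, sq_sqrt (by positivity)]
    nlinarith [sq_nonneg ε]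
  · rw [inner_sub_right, hcj, hxy]
    by_cases hj : j ∈ Finset.range n
    · simp only [hg, hj, if_true]
      linarith
    · simp only [hg, hj, if_false, sub_zero, add_zero, mul_pow]
      have : a j ≤ ε := han j (by simpa using hj)
      have := ha j
      gcongr

theorem sum_log_div_le (n : ℕ) : ∑ j ∈ Finset.range n, log (n / (j + 1)) ≤ n := by
  rcases Nat.eq_zero_or_pos n with rfl | hn
  · simp
  have hn' : (0 : ℝ) < n := by exact_mod_cast hn
  rw [← log_prod (fun j _ => by positivity), Finset.prod_div_distrib, Finset.prod_const,
    Finset.card_range]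
  have hf : ∏ j ∈ Finset.range n, ((j : ℝ) + 1) = n.factorial := by
    rw [← Finset.prod_range_add_one_eq_factorial]; push_cast; rfl
  rw [hf, log_le_iff_le_exp (by positivity)]
  exact Real.pow_div_factorial_le_exp _ hn'.le _

/-- Entropy upper bound at the exact exponential rate: for every `L' > L`, the set `K` is covered by
`exp (L' ε^{-1/β})` balls of radius `ε`, once `ε` is small. -/
def EntropyUpper {H : Type*} [NormedAddCommGroup H] (β : ℝ) (K : Set H) (L : ℝ) : Prop :=
  ∀ L' > L, ∀ᶠ ε in nhdsWithin (0 : ℝ) (Set.Ioi 0), Coverable K ε (exp (L' * ε ^ (-(1 / β))))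

theorem Coverable.mono {H : Type*} [NormedAddCommGroup H] {K K' : Set H} {ε ε' N N' : ℝ}
    (h : Coverable K ε N) (hK : K' ⊆ K) (hε : ε ≤ ε') (hN : N ≤ N') : Coverable K' ε' N' := by
  obtain ⟨α, hα, h⟩ := h
  refine ⟨α, hα.trans hN, fun x hx => ?_⟩
  obtain ⟨a, ha, e⟩ := h x (hK hx)
  exact ⟨a, ha, e.trans hε⟩

theorem tendsto_rpow_neg_inv {β : ℝ} (hβ : 0 < β) :
    Tendsto (fun ε : ℝ => ε ^ (-(1 / β))) (nhdsWithin (0 : ℝ) (Set.Ioi 0)) atTop :=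
  tendsto_rpow_neg_nhdsGT_zero (by simpa using hβ)

theorem eventually_coverable_of_seq {H : Type*} [NormedAddCommGroup H] {K : Set H} {β s T L' : ℝ}
    (hβ : 0 < β) (hs : 0 < s) (hT : 0 ≤ T)
    (h : ∀ᶠ n : ℕ in atTop, Coverable K (s * (n : ℝ) ^ (-β)) (exp (n * T)))
    (hL : T * s ^ (1 / β) < L') :
    ∀ᶠ ε in nhdsWithin (0 : ℝ) (Set.Ioi 0), Coverable K ε (exp (L' * ε ^ (-(1 / β)))) := by
  have hx := tendsto_rpow_neg_inv hβ
  have hsβ : 0 < s ^ (1 / β) := by positivity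
  have hceil : Tendsto (fun ε : ℝ => ⌈s ^ (1 / β) * ε ^ (-(1 / β))⌉₊)
      (nhdsWithin (0 : ℝ) (Set.Ioi 0)) atTop :=
    tendsto_nat_ceil_atTop.comp (hx.const_mul_atTop hsβ)
  filter_upwards [hceil.eventually h, hx.eventually_ge_atTop (T / (L' - T * s ^ (1 / β))),
    self_mem_nhdsWithin, hx.eventually_gt_atTop 0] with ε hcov hbig hε hpos
  have hε : 0 < ε := hε
  set y := s ^ (1 / β) * ε ^ (-(1 / β)) with hy
  have hy0 : 0 < y := by positivity
  refine hcov.mono subset_rfl ?_ (exp_le_exp.2 ?_)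
  · have h1 : (⌈y⌉₊ : ℝ) ^ (-β) ≤ y ^ (-β) :=
      rpow_le_rpow_of_nonpos hy0 (Nat.le_ceil _) (by linarith)
    have h2 : y ^ (-β) = s⁻¹ * ε := by
      rw [hy, mul_rpow hsβ.le hpos.le, ← rpow_mul hs.le, ← rpow_mul hε.le]
      have e1 : 1 / β * -β = -1 := by field_simp
      have e2 : -(1 / β) * -β = 1 := by field_simp
      rw [e1, e2, rpow_one, rpow_neg_one]
    calc s * (⌈y⌉₊ : ℝ) ^ (-β) ≤ s * (s⁻¹ * ε) := by rw [← h2]; gcongr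
      _ = ε := by field_simp
  · have h1 : (⌈y⌉₊ : ℝ) ≤ y + 1 := (Nat.ceil_lt_add_one hy0.le).le
    rw [div_le_iff₀ (by linarith)] at hbig
    calc (⌈y⌉₊ : ℝ) * T ≤ (y + 1) * T := by gcongr
      _ ≤ _ := by rw [hy]; nlinarith

/-- Coding of an ellipsoid with regularly decaying semi-axes by a head and `m - 1` long blocks. -/
theorem QuadCode.exists_blocks {a : ℕ → ℝ} {β c C κ η : ℝ} (hβ : 0 < β) (hc : 0 < c)
    (hcC : c ≤ C) (ha : ∀ j, 0 ≤ a j) (haC : ∀ j, a j ≤ C * ((j : ℝ) + 1) ^ (-β))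
    (hac : ∀ᶠ j : ℕ in atTop, a j ≤ c * (j : ℝ) ^ (-β)) (hκ : 0 < κ) (hκ₁ : κ ≤ 1) (hη : 0 < η)
    (m : ℕ) (hm : 1 ≤ m) :
    ∀ᶠ n : ℕ in atTop, QuadCode a (c * ((m * n : ℕ) : ℝ) ^ (-β)) (2 * κ) (Finset.range (m * n))
      (exp (n * (m * (β + η) + (log (4 * C / (c * √κ)) + β * log m + β)))) := by
  have hm0 : (0 : ℝ) < m := by exact_mod_cast hm
  have hδ : ∀ i ∈ Finset.Ico 1 m, 0 < ((i : ℝ) / m) ^ β ∧ ((i : ℝ) / m) ^ β < 1 := by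
    intro i hi
    rw [Finset.mem_Ico] at hi
    have hi0 : (0 : ℝ) < i := by exact_mod_cast hi.1
    have him : (i : ℝ) < m := by exact_mod_cast hi.2
    exact ⟨by positivity, rpow_lt_one (by positivity) ((div_lt_one hm0).2 him) hβ⟩
  have hblk : ∀ᶠ n : ℕ in atTop, ∀ i ∈ Finset.Ico 1 m, ∀ J : Finset ℕ, J.card = n → ∀ ε > 0,
      QuadCode (fun _ => ε / ((i : ℝ) / m) ^ β) ε (κ / m) J
        (exp (J.card * (log (1 / ((i : ℝ) / m) ^ β) + η))) := by
    rw [Filter.eventually_all_finset]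
    intro i hi
    obtain ⟨n₀, h⟩ := QuadCode.exists_block (hδ i hi).1 (hδ i hi).2 (div_pos hκ hm0) hη
    filter_upwards [eventually_ge_atTop n₀] with n hn J hJ
    exact h J (hJ ▸ hn)
  obtain ⟨j₀, hj₀⟩ := eventually_atTop.1 hac
  filter_upwards [hblk, eventually_ge_atTop j₀, eventually_ge_atTop 1] with n hblk hn hn1
  have hn0 : (0 : ℝ) < n := by exact_mod_cast hn1
  set ε := c * ((m * n : ℕ) : ℝ) ^ (-β) with hε
  have hε0 : 0 < ε := by rw [hε]; push_cast; positivity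
  set T₀ := log (4 * C / (c * √κ)) + β * log m + β with hT₀
  have hC : 0 < C := hc.trans_le hcC
  have hsκ : √κ ≤ 1 := sqrt_le_one.2 hκ₁
  have hsκ0 : 0 < √κ := by positivity
  have head : QuadCode a ε κ (Finset.range n) (exp (n * T₀)) := by
    refine QuadCode.of_le (A := fun j => C * ((j : ℝ) + 1) ^ (-β)) ?_ (fun j _ => ha j)
      (fun j _ => haC j) (fun j _ => by positivity)
    refine (QuadCode.of_ellipsoid_net hε0 hκ fun j hj => ?_).mono_card ?_
    · have h1 : ((m * n : ℕ) : ℝ) ^ (-β) ≤ ((j : ℝ) + 1) ^ (-β) := by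
        refine rpow_le_rpow_of_nonpos (by positivity) ?_ (by linarith)
        have : j + 1 ≤ m * n := (Finset.mem_range.1 hj).trans_le (Nat.le_mul_of_pos_left _ hm)
        exact_mod_cast this
      calc ε * √κ / 2 ≤ ε := by nlinarith
        _ ≤ _ := by rw [hε]; gcongr
    · have hterm : ∀ j : ℕ, 4 * (C * ((j : ℝ) + 1) ^ (-β)) / (ε * √κ) =
          exp (log (4 * C / (c * √κ)) + β * log m + β * log (n / (j + 1))) := by
        intro j
        rw [exp_add, exp_add, exp_log (by positivity), mul_comm β, mul_comm β,
          ← rpow_def_of_pos hm0, ← rpow_def_of_pos (by positivity), hε]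
        push_cast
        rw [div_rpow hn0.le (by positivity), mul_rpow hm0.le hn0.le, rpow_neg (by positivity),
          rpow_neg hm0.le, rpow_neg hn0.le]
        field_simp
      simp only [hterm]
      rw [← exp_sum, exp_le_exp, Finset.sum_add_distrib, Finset.sum_const, Finset.card_range,
        ← Finset.mul_sum, nsmul_eq_mul, hT₀]
      have := sum_log_div_le n
      nlinarith
  have key : ∀ k, 1 ≤ k → k ≤ m → QuadCode a ε (κ + (k - 1 : ℕ) * (κ / m)) (Finset.range (k * n))
      (exp (n * (T₀ + ∑ i ∈ Finset.Ico 1 k, (log (1 / ((i : ℝ) / m) ^ β) + η)))) := by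
    intro k hk
    induction k, hk using Nat.le_induction with
    | base => intro _; simpa using head
    | succ k hk ih =>
      intro hkm
      have hkI : k ∈ Finset.Ico 1 m := Finset.mem_Ico.2 ⟨hk, hkm⟩
      have hk0 : (0 : ℝ) < k := by exact_mod_cast hk
      have hcard : (Finset.Ico (k * n) ((k + 1) * n)).card = n := by
        rw [Nat.card_Ico, add_mul, one_mul]; omega
      have hb := hblk k hkI (Finset.Ico (k * n) ((k + 1) * n)) hcard ε hε0
      have hb' := QuadCode.of_le hb (fun j _ => ha j) (fun j hj => ?_)
        (fun j _ => div_pos hε0 (hδ k hkI).1)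
      · have := (ih (by omega)).union hb' ?_
        · rw [hcard, ← exp_add] at this
          convert this using 1
          · rw [show k + 1 - 1 = (k - 1) + 1 by omega]; push_cast; ring
          · ext j
            have : k * n ≤ (k + 1) * n := Nat.mul_le_mul_right _ (Nat.le_succ k)
            simp only [Finset.mem_union, Finset.mem_range, Finset.mem_Ico]
            omega
          · rw [Finset.sum_Ico_succ_top hk]; congr 1; ring
        · rw [Finset.disjoint_left]
          intro j h1 h2
          simp only [Finset.mem_range, Finset.mem_Ico] at h1 h2
          omega
      · rw [Finset.mem_Ico] at hj
        have hjn : n ≤ j := (Nat.le_mul_of_pos_left _ hk).trans hj.1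
        have hkj : ((k : ℝ) * n) ≤ j := by exact_mod_cast hj.1
        calc a j ≤ c * (j : ℝ) ^ (-β) := hj₀ j (hn.trans hjn)
          _ ≤ c * ((k : ℝ) * n) ^ (-β) := by
            gcongr 1
            exact rpow_le_rpow_of_nonpos (by positivity) hkj (by linarith)
          _ = ε / ((k : ℝ) / m) ^ β := by
            rw [hε]; push_cast
            rw [div_rpow hk0.le hm0.le, mul_rpow hm0.le hn0.le, mul_rpow hk0.le hn0.le,
              rpow_neg hm0.le, rpow_neg hn0.le, rpow_neg hk0.le]
            field_simp
  have hfin := key m hm le_rfl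
  have hlogs : ∑ i ∈ Finset.Ico 1 m, (log (1 / ((i : ℝ) / m) ^ β) + η) ≤ m * (β + η) := by
    have h1 : ∀ i ∈ Finset.Ico 1 m, log (1 / ((i : ℝ) / m) ^ β) = β * log (m / i) := by
      intro i hi
      have hi0 : (0 : ℝ) < i := by exact_mod_cast (Finset.mem_Ico.1 hi).1
      rw [one_div, ← inv_rpow (by positivity), inv_div, log_rpow (by positivity)]
    rw [Finset.sum_add_distrib, Finset.sum_congr rfl h1, ← Finset.mul_sum, Finset.sum_const,
      Nat.card_Ico, nsmul_eq_mul]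
    have h2 : ∑ i ∈ Finset.Ico 1 m, log ((m : ℝ) / i) ≤ m := by
      refine le_trans ?_ (sum_log_div_le m)
      rw [Finset.sum_Ico_eq_sum_range]
      obtain ⟨l, rfl⟩ : ∃ l, m = l + 1 := ⟨m - 1, by omega⟩
      rw [Finset.sum_range_succ]
      simp only [add_tsub_cancel_right]
      have h3 : log (((l + 1 : ℕ) : ℝ) / (l + 1)) = 0 := by
        push_cast; rw [div_self (by positivity), log_one]
      rw [h3, add_zero]
      refine le_of_eq (Finset.sum_congr rfl fun i _ => ?_)
      push_cast; rw [add_comm (1 : ℝ)]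
    have h3 : ((m - 1 : ℕ) : ℝ) ≤ m := by exact_mod_cast Nat.sub_le m 1
    nlinarith
  have hκm : κ + ((m - 1 : ℕ) : ℝ) * (κ / m) ≤ 2 * κ := by
    have h3 : ((m - 1 : ℕ) : ℝ) ≤ m := by exact_mod_cast Nat.sub_le m 1
    have : ((m - 1 : ℕ) : ℝ) * (κ / m) ≤ m * (κ / m) := by gcongr
    rw [mul_div_cancel₀ _ hm0.ne'] at this
    linarith
  obtain ⟨Z, hZ, h⟩ := hfin
  refine ⟨Z, hZ.trans (exp_le_exp.2 ?_), fun x hx => ?_⟩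
  · have := mul_le_mul_of_nonneg_left hlogs hn0.le
    nlinarith
  · obtain ⟨z, hz, e⟩ := h x hx
    refine ⟨z, hz, e.trans ?_⟩
    gcongr

theorem entropyUpper_of_diagonal {H : Type*} [NormedAddCommGroup H] [InnerProductSpace ℝ H]
    (e f : HilbertBasis ℕ ℝ H) {a : ℕ → ℝ} {β c : ℝ} (hβ : 0 < β) (hc : 0 < c)
    (ha : ∀ j, 0 ≤ a j) (hlim : Tendsto (fun j : ℕ => a j * (j : ℝ) ^ β) atTop (nhds c))
    (K : Set H) (hK : ∀ y ∈ K, ∃ x : H, ‖x‖ ≤ 1 ∧ ∀ j, ⟪f j, y⟫ = a j * ⟪e j, x⟫) :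
    EntropyUpper β K (β * c ^ (1 / β)) := by
  intro L' hL'
  have hη : ∀ᶠ η in nhdsWithin (0 : ℝ) (Set.Ioi 0),
      (β + 2 * η) * (√(1 + 2 * η) * (c * (1 + η))) ^ (1 / β) < L' := by
    have hcont : ContinuousAt
        (fun η : ℝ => (β + 2 * η) * (√(1 + 2 * η) * (c * (1 + η))) ^ (1 / β)) 0 := by
      refine ContinuousAt.mul (by fun_prop) (ContinuousAt.rpow_const (by fun_prop) ?_)
      left; simpa using hc.ne'
    refine (hcont.tendsto.mono_left nhdsWithin_le_nhds).eventually_lt_const ?_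
    simpa using hL'
  obtain ⟨η, ⟨hηL, hη1⟩, hη0⟩ := ((hη.and (Ioo_mem_nhdsGT (one_pos))).and self_mem_nhdsWithin).exists
  have hη0 : 0 < η := hη0
  have hη1 : η < 1 := hη1.2
  set c' := c * (1 + η) with hc'
  have hcc' : c < c' := by rw [hc']; nlinarith
  have hc'0 : 0 < c' := hc.trans hcc'
  have hac : ∀ᶠ j : ℕ in atTop, a j ≤ c' * (j : ℝ) ^ (-β) := by
    filter_upwards [hlim.eventually_lt_const hcc', eventually_ge_atTop 1] with j hj hj1
    have hj0 : (0 : ℝ) < j := by exact_mod_cast hj1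
    rw [rpow_neg hj0.le, ← div_eq_mul_inv, le_div_iff₀ (by positivity)]
    exact hj.le
  obtain ⟨C, hC, haC⟩ : ∃ C, c' ≤ C ∧ ∀ j : ℕ, a j ≤ C * ((j : ℝ) + 1) ^ (-β) := by
    obtain ⟨j₀, hj₀⟩ := eventually_atTop.1 hac
    have hb : ∃ C, ∀ j : ℕ, a j * ((j : ℝ) + 1) ^ β ≤ C := by
      have h2 : ∀ j : ℕ, max j₀ 1 ≤ j → a j * ((j : ℝ) + 1) ^ β ≤ c' * 2 ^ β := by
        intro j hj
        have hj1 : (1 : ℝ) ≤ j := by exact_mod_cast (le_max_right _ _).trans hj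
        calc a j * ((j : ℝ) + 1) ^ β ≤ (c' * (j : ℝ) ^ (-β)) * (2 * j) ^ β := by
              gcongr
              · exact hj₀ j ((le_max_left _ _).trans hj)
              · linarith
          _ = _ := by
            rw [mul_rpow (by norm_num) (by linarith), rpow_neg (by linarith)]
            have : (j : ℝ) ^ β ≠ 0 := by positivity
            field_simp
      refine ⟨c' * 2 ^ β + ∑ j ∈ Finset.range (max j₀ 1), a j * ((j : ℝ) + 1) ^ β, fun j => ?_⟩
      have hnn : ∀ j : ℕ, 0 ≤ a j * ((j : ℝ) + 1) ^ β := fun j => mul_nonneg (ha j) (by positivity)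
      rcases lt_or_ge j (max j₀ 1) with h | h
      · have := Finset.single_le_sum (f := fun j : ℕ => a j * ((j : ℝ) + 1) ^ β)
          (fun i _ => hnn i) (Finset.mem_range.2 h)
        have : 0 ≤ c' * 2 ^ β := by positivity
        linarith
      · have := h2 j h
        have := Finset.sum_nonneg (s := Finset.range (max j₀ 1)) fun i _ => hnn i
        linarith
    obtain ⟨C, hC⟩ := hb
    refine ⟨max c' C, le_max_left _ _, fun j => ?_⟩
    rw [rpow_neg (by positivity), ← div_eq_mul_inv, le_div_iff₀ (by positivity)]
    exact (hC j).trans (le_max_right _ _)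
  set B := log (4 * C / (c' * √η)) with hB
  obtain ⟨m, hm1, hm⟩ : ∃ m : ℕ, 1 ≤ m ∧ B + β * log m + β ≤ m * η := by
    have h1 : Tendsto (fun x : ℝ => log x / x) atTop (nhds 0) := by
      simpa using (isLittleO_log_id_atTop.tendsto_div_nhds_zero)
    have h2 : Tendsto (fun x : ℝ => (B + β) / x + β * (log x / x)) atTop (nhds 0) := by
      simpa using (tendsto_const_nhds.div_atTop tendsto_id).add (h1.const_mul β)
    obtain ⟨m, hm, hm1⟩ := ((tendsto_natCast_atTop_atTop.eventually
      (h2.eventually_lt_const hη0)).and (eventually_ge_atTop 1)).exists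
    have hm0 : (0 : ℝ) < m := by exact_mod_cast hm1
    refine ⟨m, hm1, ?_⟩
    have : (B + β) / m + β * (log m / m) = (B + β * log m + β) / m := by field_simp; ring
    rw [this, div_lt_iff₀ hm0] at hm
    linarith
  have hm0 : (0 : ℝ) < m := by exact_mod_cast hm1
  set s := √(1 + 2 * η) * c' * (m : ℝ) ^ (-β) with hs
  have hs0 : 0 < s := by positivity
  refine eventually_coverable_of_seq (T := m * (β + 2 * η)) hβ hs0 (by positivity) ?_ ?_
  · have hac' := eventually_atTop.1 hac
    obtain ⟨j₀, hj₀⟩ := hac'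
    filter_upwards [QuadCode.exists_blocks hβ hc'0 hC ha haC hac hη0 hη1.le hη0 m hm1,
      eventually_ge_atTop j₀, eventually_ge_atTop 1] with n hn hnj hn1
    have hn0 : (0 : ℝ) < n := by exact_mod_cast hn1
    refine (Coverable.of_quadCode e f (by positivity) (by positivity) hn ha (fun j hj => ?_)
      K hK).mono subset_rfl ?_ (exp_le_exp.2 ?_)
    · refine (hj₀ j (hnj.trans ((Nat.le_mul_of_pos_left _ hm1).trans hj))).trans ?_
      gcongr 1
      refine rpow_le_rpow_of_nonpos (by push_cast; positivity) (by exact_mod_cast hj) (by linarith)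
    · rw [hs]; push_cast
      rw [mul_rpow hm0.le hn0.le]
      exact le_of_eq (by ring)
    · gcongr
      nlinarith
  · refine lt_of_le_of_lt (le_of_eq ?_) hηL
    rw [hs, mul_rpow (by positivity) (by positivity), ← rpow_mul hm0.le]
    have : -β * (1 / β) = -1 := by field_simp
    rw [this, rpow_neg_one]
    field_simp

/-- Entropy lower bound at the exact exponential rate: for every `L' < L`, any covering of `K` by
balls of radius `ε` has at least `exp (L' ε^{-1/β})` members, once `ε` is small. -/
def EntropyLower {H : Type*} [NormedAddCommGroup H] (β : ℝ) (K : Set H) (L : ℝ) : Prop :=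
  ∀ L' < L, ∀ᶠ ε in nhdsWithin (0 : ℝ) (Set.Ioi 0), ∀ N, Coverable K ε N →
    exp (L' * ε ^ (-(1 / β))) ≤ N

theorem prod_le_of_coverable_diagonal {H : Type*} [NormedAddCommGroup H] [InnerProductSpace ℝ H]
    (e f : HilbertBasis ℕ ℝ H) {a : ℕ → ℝ} (ha : ∀ j, 0 ≤ a j) {ε N : ℝ} (hε : 0 < ε) (n : ℕ)
    (K : Set H) (hK : ∀ x y : H, ‖x‖ ≤ 1 → (∀ j, ⟪f j, y⟫ = a j * ⟪e j, x⟫) → y ∈ K)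
    (h : Coverable K ε N) : ∏ j ∈ Finset.range n, a j ≤ N * ε ^ n := by
  classical
  obtain ⟨α, hα, h⟩ := h
  let P : H → EuclideanSpace ℝ (Fin n) := fun y => WithLp.toLp 2 fun j => ⟪f j, y⟫
  have hP : ∀ x y, ‖P x - P y‖ ≤ ‖x - y‖ := by
    intro x y
    refine le_of_sq_le_sq ?_ (norm_nonneg _)
    rw [EuclideanSpace.norm_sq_eq]
    have h1 := sum_le_hasSum (Finset.range n) (fun _ _ => sq_nonneg _) (f.hasSum_inner_sq (x - y))
    rw [← Fin.sum_univ_eq_sum_range (fun j => ⟪f j, x - y⟫ ^ 2)] at h1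
    refine le_trans (le_of_eq (Finset.sum_congr rfl fun j _ => ?_)) h1
    simp [P, inner_sub_right]
  have hsum : ∀ (b : HilbertBasis ℕ ℝ H) (z : ℕ → ℝ) (j : ℕ),
      ⟪b j, ∑ i ∈ Finset.range n, z i • b i⟫ = if j ∈ Finset.range n then z j else 0 := by
    intro b z j
    rw [inner_sum]
    simp only [real_inner_smul_right, orthonormal_iff_ite.1 b.orthonormal]
    simp
  have hsub : ellipsoid (fun j : Fin n => a j) ⊆ ⋃ c ∈ α, Metric.closedBall (P c) ε := by
    rintro y ⟨x, hx, hy⟩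
    let x' : ℕ → ℝ := fun j => if h : j < n then x ⟨j, h⟩ else 0
    have hX : ‖∑ i ∈ Finset.range n, x' i • e i‖ ≤ 1 := by
      refine le_of_sq_le_sq ?_ zero_le_one
      rw [← real_inner_self_eq_norm_sq, e.orthonormal.inner_sum]
      have hx2 : ‖x‖ ^ 2 ≤ 1 := pow_le_one₀ (norm_nonneg _) hx
      rw [EuclideanSpace.norm_sq_eq] at hx2
      rw [← Fin.sum_univ_eq_sum_range (fun i => (starRingEnd ℝ) (x' i) * x' i), one_pow]
      refine le_trans (le_of_eq (Finset.sum_congr rfl fun j _ => ?_)) hx2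
      simp [x', sq]
    have hY := hK (∑ i ∈ Finset.range n, x' i • e i) (∑ i ∈ Finset.range n, (a i * x' i) • f i) hX
      (fun j => by rw [hsum f (fun i => a i * x' i), hsum e x']; split_ifs <;> simp)
    obtain ⟨c, hc, hcY⟩ := h _ hY
    rw [Set.mem_iUnion₂]
    refine ⟨c, hc, ?_⟩
    rw [mem_closedBall_iff_norm]
    have : y = P (∑ i ∈ Finset.range n, (a i * x' i) • f i) := by
      ext j
      rw [hy]
      simp only [P]
      rw [hsum f (fun i => a i * x' i), if_pos (Finset.mem_range.2 j.2)]
      simp [x']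
    rw [this]
    exact (hP _ _).trans hcY
  set V := volume (Metric.closedBall (0 : EuclideanSpace ℝ (Fin n)) 1) with hV
  have hV0 : V ≠ 0 := (Metric.measure_closedBall_pos _ _ one_pos).ne'
  have hVt : V ≠ ⊤ := measure_closedBall_lt_top.ne
  have hvol : ENNReal.ofReal (∏ j : Fin n, a j) * V ≤ ENNReal.ofReal (α.card * ε ^ n) * V := by
    rw [hV, ← volume_ellipsoid (fun j : Fin n => a j) fun j => ha j]
    refine (measure_mono hsub).trans ((measure_biUnion_finset_le _ _).trans ?_)
    simp only [Measure.addHaar_closedBall' volume _ hε.le, finrank_euclideanSpace, Fintype.card_fin]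
    rw [Finset.sum_const, nsmul_eq_mul, ← mul_assoc, ENNReal.ofReal_mul (Nat.cast_nonneg _),
      ENNReal.ofReal_natCast]
  rw [ENNReal.mul_le_mul_iff_left hV0 hVt, ENNReal.ofReal_le_ofReal_iff (by positivity),
    Fin.prod_univ_eq_prod_range a] at hvol
  exact hvol.trans (by gcongr)

theorem log_factorial_le (n : ℕ) (hn : 1 ≤ n) :
    log n.factorial ≤ n * log n - n + log n + 1 := by
  induction n, hn using Nat.le_induction with
  | base => simp
  | succ n hn ih =>
    have hn0 : (0 : ℝ) < n := by exact_mod_cast hn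
    rw [Nat.factorial_succ]
    push_cast
    rw [log_mul (by positivity) (by positivity)]
    have h1 := one_sub_inv_le_log_of_pos (show 0 < ((n : ℝ) + 1) / n by positivity)
    rw [log_div (by positivity) hn0.ne', inv_div] at h1
    have h2 : 1 ≤ ((n : ℝ) + 1) * (log (n + 1) - log n) := by
      calc (1 : ℝ) = (n + 1) * (1 - n / (n + 1)) := by field_simp; ring
        _ ≤ _ := by gcongr
    linarith

theorem entropyLower_of_diagonal {H : Type*} [NormedAddCommGroup H] [InnerProductSpace ℝ H]
    (e f : HilbertBasis ℕ ℝ H) {a : ℕ → ℝ} {β c : ℝ} (hβ : 0 < β) (hc : 0 < c)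
    (ha : ∀ j, 0 < a j) (hlim : Tendsto (fun j : ℕ => a j * (j : ℝ) ^ β) atTop (nhds c))
    (K : Set H) (hK : ∀ x y : H, ‖x‖ ≤ 1 → (∀ j, ⟪f j, y⟫ = a j * ⟪e j, x⟫) → y ∈ K) :
    EntropyLower β K (β * c ^ (1 / β)) := by
  intro L' hL'
  have hc' : ∀ᶠ c' in nhdsWithin c (Set.Iio c), L' < β * c' ^ (1 / β) := by
    have hcont : ContinuousAt (fun x : ℝ => β * x ^ (1 / β)) c :=
      ContinuousAt.mul (by fun_prop) (continuousAt_id.rpow_const (Or.inl hc.ne'))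
    exact (hcont.tendsto.mono_left nhdsWithin_le_nhds).eventually_const_lt hL'
  obtain ⟨c', ⟨hL, hc'0⟩, hcc'⟩ := ((hc'.and (Ioo_mem_nhdsLT hc)).and self_mem_nhdsWithin).exists
  have hcc' : c' < c := hcc'
  have hc'0 : 0 < c' := hc'0.1
  set q := c' ^ (1 / β) with hq
  have hq0 : 0 < q := by positivity
  obtain ⟨j₀, hj₀⟩ := eventually_atTop.1 (hlim.eventually_const_lt hcc')
  let r : ℕ → ℝ := fun n => ∏ j ∈ Finset.range n, (a j * ((j : ℝ) + 1) ^ β / c')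
  have hr0 : ∀ n, 0 < r n := fun n => Finset.prod_pos fun j _ => by have := ha j; positivity
  have hr : ∀ n, j₀ ≤ n → r j₀ ≤ r n := by
    intro n hn
    induction n, hn using Nat.le_induction with
    | base => rfl
    | succ n hn ih =>
      have : r (n + 1) = r n * (a n * ((n : ℝ) + 1) ^ β / c') := Finset.prod_range_succ _ _
      rw [this]
      refine ih.trans (le_mul_of_one_le_right (hr0 n).le ?_)
      rw [one_le_div hc'0]
      refine (hj₀ n hn).le.trans ?_
      have := (ha n).le
      gcongr
      linarith
  have hprod : ∀ n, ∏ j ∈ Finset.range n, a j = r n * c' ^ n * ((n.factorial : ℝ) ^ β)⁻¹ := by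
    intro n
    have hf : (n.factorial : ℝ) = ∏ j ∈ Finset.range n, ((j : ℝ) + 1) := by
      rw [← Finset.prod_range_add_one_eq_factorial]; push_cast; rfl
    simp only [r]
    rw [hf, ← Real.finsetProd_rpow _ _ (fun i _ => by positivity), Finset.prod_div_distrib,
      Finset.prod_mul_distrib, Finset.prod_const, Finset.card_range]
    have : ∏ j ∈ Finset.range n, ((j : ℝ) + 1) ^ β ≠ 0 :=
      Finset.prod_ne_zero_iff.2 fun j _ => by positivity
    field_simp
  have hx := tendsto_rpow_neg_inv hβ
  have hy : Tendsto (fun ε : ℝ => q * ε ^ (-(1 / β))) (nhdsWithin (0 : ℝ) (Set.Ioi 0)) atTop :=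
    hx.const_mul_atTop hq0
  have hev : ∀ᶠ y : ℝ in atTop, L' / q * y ≤ log (r j₀) + β * (y - 1) - β * log y - β := by
    have h1 : Tendsto (fun x : ℝ => log x / x) atTop (nhds 0) := by
      simpa using (isLittleO_log_id_atTop.tendsto_div_nhds_zero)
    have h2 : Tendsto (fun x : ℝ => (log (r j₀) - 2 * β) / x - β * (log x / x) + β) atTop
        (nhds β) := by
      simpa using ((tendsto_const_nhds.div_atTop tendsto_id).sub (h1.const_mul β)).add_const β
    have h3 : L' / q < β := by rwa [div_lt_iff₀ hq0]
    filter_upwards [h2.eventually_const_lt h3, eventually_gt_atTop 0] with y hy hy0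
    have : (log (r j₀) - 2 * β) / y - β * (log y / y) + β =
        (log (r j₀) + β * (y - 1) - β * log y - β) / y := by field_simp; ring
    rw [this, lt_div_iff₀ hy0] at hy
    exact hy.le
  filter_upwards [hy.eventually hev, hy.eventually_ge_atTop 1, self_mem_nhdsWithin,
    (tendsto_nat_floor_atTop.comp hy).eventually_ge_atTop j₀] with ε hev hy1 hε hfl N hN
  have hε : 0 < ε := hε
  simp only [Function.comp_apply] at hfl
  set y := q * ε ^ (-(1 / β)) with hyd
  set n := ⌊y⌋₊ with hn
  have hn1 : 1 ≤ n := Nat.le_floor (by simpa using hy1)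
  have hn0 : (0 : ℝ) < n := by exact_mod_cast hn1
  have hny : (n : ℝ) ≤ y := Nat.floor_le (by linarith)
  have hyn : y - 1 ≤ n := by have := Nat.lt_floor_add_one y; linarith
  have hmain := prod_le_of_coverable_diagonal e f (fun j => (ha j).le) hε n K hK hN
  rw [hprod] at hmain
  have hN0 : 0 < N := by
    have h1 : 0 < r n * c' ^ n * ((n.factorial : ℝ) ^ β)⁻¹ := by have := hr0 n; positivity
    exact pos_of_mul_pos_left (h1.trans_le hmain) (by positivity)
  rw [← log_le_log_iff (by have := hr0 n; positivity) (by positivity),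
    log_mul (by have := hr0 n; positivity) (by positivity), log_mul (hr0 n).ne' (by positivity),
    log_inv, log_rpow (by positivity), log_pow, log_mul hN0.ne' (by positivity), log_pow] at hmain
  have hlr : log (r j₀) ≤ log (r n) := log_le_log (hr0 _) (hr n hfl)
  have hlf := mul_le_mul_of_nonneg_left (log_factorial_le n hn1) hβ.le
  have hly : log n ≤ log y := log_le_log hn0 hny
  have hlogy : β * log y = log c' - log ε := by
    rw [hyd, hq, log_mul (by positivity) (by positivity), log_rpow hc'0, log_rpow hε]
    field_simp; ring
  rw [← le_log_iff_exp_le hN0]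
  calc L' * ε ^ (-(1 / β)) = L' / q * y := by rw [hyd]; field_simp
    _ ≤ _ := hev
    _ ≤ log N := by
      have p1 : 0 ≤ n * (β * (log y - log n)) := by
        have : 0 ≤ log y - log n := by linarith
        positivity
      have p2 : β * (y - 1) ≤ β * n := by gcongr
      have p3 : β * log n ≤ β * log y := by gcongr
      have p4 : n * (β * log y) = n * (log c' - log ε) := by rw [hlogy]
      linarith

section EntropyCalculus

variable {H : Type*} [NormedAddCommGroup H] {K K₁ K₂ K' : Set H} {β L ε ε₁ ε₂ N N₁ N₂ C : ℝ}

theorem Coverable.add (h₁ : Coverable K₁ ε₁ N₁) (h₂ : Coverable K₂ ε₂ N₂)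
    (hK : ∀ x ∈ K, ∃ y ∈ K₁, ∃ z ∈ K₂, x = y + z) : Coverable K (ε₁ + ε₂) (N₁ * N₂) := by
  classical
  obtain ⟨α₁, c₁, h₁⟩ := h₁
  obtain ⟨α₂, c₂, h₂⟩ := h₂
  refine ⟨(α₁ ×ˢ α₂).image fun p => p.1 + p.2, ?_, fun x hx => ?_⟩
  · refine (Nat.cast_le.2 Finset.card_image_le).trans ?_
    rw [Finset.card_product]
    push_cast
    exact mul_le_mul c₁ c₂ (by positivity) ((Nat.cast_nonneg _).trans c₁)
  · obtain ⟨y, hy, z, hz, rfl⟩ := hK x hx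
    obtain ⟨a, ha, ea⟩ := h₁ y hy
    obtain ⟨b, hb, eb⟩ := h₂ z hz
    refine ⟨a + b, Finset.mem_image.2 ⟨(a, b), Finset.mk_mem_product ha hb, rfl⟩, ?_⟩
    rw [add_sub_add_comm]
    exact (norm_add_le _ _).trans (add_le_add ea eb)

theorem Coverable.image (T : H → H) (hC : 0 ≤ C) (hT : ∀ x y, ‖T x - T y‖ ≤ C * ‖x - y‖)
    (h : Coverable K ε N) (hK : K' ⊆ T '' K) : Coverable K' (C * ε) N := by
  classical
  obtain ⟨α, c, h⟩ := h
  refine ⟨α.image T, (Nat.cast_le.2 Finset.card_image_le).trans c, fun x hx => ?_⟩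
  obtain ⟨y, hy, rfl⟩ := hK hx
  obtain ⟨a, ha, ea⟩ := h y hy
  exact ⟨T a, Finset.mem_image_of_mem _ ha, (hT _ _).trans (by gcongr)⟩

theorem tendsto_const_mul_nhdsGT_zero {s : ℝ} (hs : 0 < s) :
    Tendsto (fun ε : ℝ => s * ε) (nhdsWithin 0 (Set.Ioi 0)) (nhdsWithin 0 (Set.Ioi 0)) := by
  refine tendsto_nhdsWithin_iff.2 ⟨?_, ?_⟩
  · have : Tendsto (fun ε : ℝ => s * ε) (nhds 0) (nhds (s * 0)) := by
      exact (continuous_const.mul continuous_id).tendsto 0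
    rw [mul_zero] at this
    exact this.mono_left nhdsWithin_le_nhds
  · filter_upwards [self_mem_nhdsWithin] with ε hε
    exact mul_pos hs hε

theorem EntropyUpper.add (h₁ : EntropyUpper β K₁ L) (h₂ : EntropyUpper β K₂ 0)
    (hK : ∀ x ∈ K, ∃ y ∈ K₁, ∃ z ∈ K₂, x = y + z) : EntropyUpper β K L := by
  intro L' hL'
  obtain ⟨L'', hL, hL''⟩ := exists_between hL'
  have hs : ∀ᶠ s in nhdsWithin (0 : ℝ) (Set.Ioi 0), L'' * (1 - s) ^ (-(1 / β)) < L' := by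
    have hcont : ContinuousAt (fun s : ℝ => L'' * (1 - s) ^ (-(1 / β))) 0 :=
      ContinuousAt.mul (by fun_prop) (ContinuousAt.rpow_const (by fun_prop) (Or.inl (by simp)))
    refine (hcont.tendsto.mono_left nhdsWithin_le_nhds).eventually_lt_const ?_
    simpa using hL''
  obtain ⟨s, hs, hs0, hs1⟩ := (hs.and (Ioo_mem_nhdsGT one_pos)).exists
  set τ := (L' - L'' * (1 - s) ^ (-(1 / β))) / s ^ (-(1 / β)) with hτ
  have hτ0 : 0 < τ := div_pos (by linarith) (by positivity)
  have hs1' : 0 < 1 - s := by linarith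
  filter_upwards [(tendsto_const_mul_nhdsGT_zero hs1').eventually (h₁ L'' hL),
    (tendsto_const_mul_nhdsGT_zero hs0).eventually (h₂ τ hτ0), self_mem_nhdsWithin]
    with ε e₁ e₂ hε
  have hε : 0 < ε := hε
  refine (e₁.add e₂ hK).mono subset_rfl (le_of_eq (by ring)) ?_
  rw [← exp_add, exp_le_exp, mul_rpow hs1'.le hε.le, mul_rpow hs0.le hε.le]
  have : τ * s ^ (-(1 / β)) = L' - L'' * (1 - s) ^ (-(1 / β)) := by
    rw [hτ, div_mul_cancel₀ _ (by positivity)]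
  refine le_of_eq ?_
  rw [← mul_assoc τ, this]
  ring

theorem EntropyLower.add (h₁ : EntropyLower β K₁ L) (h₂ : EntropyUpper β K₂ 0)
    (hK : ∀ x ∈ K₁, ∃ y ∈ K, ∃ z ∈ K₂, x = y + z) : EntropyLower β K L := by
  intro L' hL'
  obtain ⟨L'', hL'', hL⟩ := exists_between hL'
  have hs : ∀ᶠ s in nhdsWithin (0 : ℝ) (Set.Ioi 0), L' < L'' * (1 + s) ^ (-(1 / β)) := by
    have hcont : ContinuousAt (fun s : ℝ => L'' * (1 + s) ^ (-(1 / β))) 0 :=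
      ContinuousAt.mul (by fun_prop) (ContinuousAt.rpow_const (by fun_prop) (Or.inl (by simp)))
    refine (hcont.tendsto.mono_left nhdsWithin_le_nhds).eventually_const_lt ?_
    simpa using hL''
  obtain ⟨s, hs, hs0⟩ := (hs.and self_mem_nhdsWithin).exists
  have hs0 : 0 < s := hs0
  set τ := (L'' * (1 + s) ^ (-(1 / β)) - L') / s ^ (-(1 / β)) with hτ
  have hτ0 : 0 < τ := div_pos (by linarith) (by positivity)
  have hs1' : 0 < 1 + s := by linarith
  filter_upwards [(tendsto_const_mul_nhdsGT_zero hs1').eventually (h₁ L'' hL),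
    (tendsto_const_mul_nhdsGT_zero hs0).eventually (h₂ τ hτ0), self_mem_nhdsWithin]
    with ε e₁ e₂ hε N hN
  have hε : 0 < ε := hε
  have := e₁ _ ((hN.add e₂ hK).mono subset_rfl (le_of_eq (by ring)) le_rfl)
  rw [← div_le_iff₀ (exp_pos _), ← exp_sub] at this
  refine le_trans (le_of_eq ?_) this
  rw [mul_rpow hs1'.le hε.le, mul_rpow hs0.le hε.le]
  have : τ * s ^ (-(1 / β)) = L'' * (1 + s) ^ (-(1 / β)) - L' := by
    rw [hτ, div_mul_cancel₀ _ (by positivity)]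
  rw [← mul_assoc τ, this]
  ring_nf

theorem EntropyUpper.image (hC : 0 < C) (h : EntropyUpper β K L)
    (T : H → H) (hT : ∀ x y, ‖T x - T y‖ ≤ C * ‖x - y‖) (hK : K' ⊆ T '' K) :
    EntropyUpper β K' (L * C ^ (1 / β)) := by
  intro L' hL'
  have hL : L < L' / C ^ (1 / β) := by rwa [lt_div_iff₀ (by positivity)]
  filter_upwards [(tendsto_const_mul_nhdsGT_zero (inv_pos.2 hC)).eventually (h _ hL),
    self_mem_nhdsWithin] with ε e hε
  have hε : 0 < ε := hε
  refine (e.image T hC.le hT hK).mono subset_rfl (le_of_eq (by field_simp)) ?_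
  rw [exp_le_exp, mul_rpow (by positivity) hε.le, inv_rpow hC.le, rpow_neg hC.le, inv_inv]
  refine le_of_eq ?_
  have : C ^ (1 / β) ≠ 0 := by positivity
  rw [← mul_assoc, div_mul_cancel₀ _ this]

theorem EntropyLower.image (hC : 0 < C) (h : EntropyLower β K L)
    (T : H → H) (hT : ∀ x y, ‖T x - T y‖ ≤ C * ‖x - y‖) (hK : K ⊆ T '' K') :
    EntropyLower β K' (L / C ^ (1 / β)) := by
  intro L' hL'
  rw [lt_div_iff₀ (by positivity)] at hL'
  filter_upwards [(tendsto_const_mul_nhdsGT_zero hC).eventually (h _ hL'),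
    self_mem_nhdsWithin] with ε e hε N hN
  have hε : 0 < ε := hε
  refine le_trans (le_of_eq ?_) (e N (hN.image T hC.le hT hK))
  rw [mul_rpow hC.le hε.le, rpow_neg hC.le]
  have : C ^ (1 / β) ≠ 0 := by positivity
  congr 1
  field_simp

theorem EntropyUpper.of_tendsto {u : ℕ → ℝ} (hu : Tendsto u atTop (nhds L))
    (h : ∀ n, EntropyUpper β K (u n)) : EntropyUpper β K L := by
  intro L' hL'
  obtain ⟨n, hn⟩ := (hu.eventually_lt_const hL').exists
  exact h n L' hn

theorem EntropyLower.of_tendsto {u : ℕ → ℝ} (hu : Tendsto u atTop (nhds L))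
    (h : ∀ n, EntropyLower β K (u n)) : EntropyLower β K L := by
  intro L' hL'
  obtain ⟨n, hn⟩ := (hu.eventually_const_lt hL').exists
  exact h n L' hn

theorem entropyNum_le_of_coverable {n : ℕ} (hK : K.Nonempty) (h : Coverable K ε n) :
    entropyNum K n ≤ ε := by
  obtain ⟨α, hα, h⟩ := h
  have hαne : α.Nonempty := by
    obtain ⟨x, hx⟩ := hK
    obtain ⟨a, ha, -⟩ := h x hx
    exact ⟨a, ha⟩
  have hnn : ∀ (α : Finset H) (x : H), 0 ≤ sInf ((fun a => ‖x - a‖) '' (α : Set H)) := by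
    intro α x
    refine Real.sInf_nonneg ?_
    rintro _ ⟨a, -, rfl⟩
    exact norm_nonneg _
  rw [entropyNum]
  refine csInf_le_of_le ⟨0, ?_⟩ ⟨α, hαne, by exact_mod_cast hα, rfl⟩ ?_
  · rintro r ⟨α, -, -, rfl⟩
    refine Real.sSup_nonneg ?_
    rintro _ ⟨x, -, rfl⟩
    exact hnn α x
  · refine csSup_le (hK.image _) ?_
    rintro _ ⟨x, hx, rfl⟩
    obtain ⟨a, ha, ea⟩ := h x hx
    refine csInf_le_of_le ⟨0, ?_⟩ (Set.mem_image_of_mem _ ha) ea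
    rintro _ ⟨b, -, rfl⟩
    exact norm_nonneg _

theorem coverable_of_entropyNum_lt {n : ℕ} (hn : 1 ≤ n) (hb : Bornology.IsBounded K)
    (h : entropyNum K n < ε) : Coverable K ε n := by
  rw [entropyNum] at h
  obtain ⟨_, ⟨α, hα, hc, rfl⟩, hlt⟩ := exists_lt_of_csInf_lt
    (by exact ⟨_, {0}, Finset.singleton_nonempty _, by simpa using hn, rfl⟩) h
  refine ⟨α, by exact_mod_cast hc, fun x hx => ?_⟩
  obtain ⟨M, hM⟩ := hb.exists_norm_le
  obtain ⟨a₀, ha₀⟩ := hα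
  have hbdd : BddAbove ((fun x => sInf ((fun a => ‖x - a‖) '' (α : Set H))) '' K) := by
    refine ⟨M + ‖a₀‖, ?_⟩
    rintro _ ⟨y, hy, rfl⟩
    refine csInf_le_of_le ⟨0, ?_⟩ (Set.mem_image_of_mem _ ha₀)
      ((norm_sub_le _ _).trans (by have := hM y hy; gcongr))
    rintro _ ⟨b, -, rfl⟩
    exact norm_nonneg _
  have hne : ((fun a => ‖x - a‖) '' (α : Set H)).Nonempty := ⟨_, Set.mem_image_of_mem _ ha₀⟩
  obtain ⟨_, ⟨a, ha, rfl⟩, hal⟩ := exists_lt_of_csInf_lt hne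
    ((le_csSup hbdd (Set.mem_image_of_mem _ hx)).trans_lt hlt)
  exact ⟨a, ha, hal.le⟩

theorem tendsto_entropyNum (hβ : 0 < β) (hL : 0 < L) (hne : K.Nonempty)
    (hb : Bornology.IsBounded K) (hU : EntropyUpper β K L) (hD : EntropyLower β K L) :
    Tendsto (fun n : ℕ => entropyNum K n * log n ^ β) atTop (nhds (L ^ β)) := by
  have hlog : Tendsto (fun n : ℕ => log n) atTop atTop :=
    tendsto_log_atTop.comp tendsto_natCast_atTop_atTop
  have hε : ∀ L' : ℝ, 0 < L' → Tendsto (fun n : ℕ => (L' / log n) ^ β) atTop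
      (nhdsWithin 0 (Set.Ioi 0)) := by
    intro L' hL'
    refine tendsto_nhdsWithin_iff.2 ⟨?_, ?_⟩
    · have := (tendsto_const_nhds.div_atTop hlog : Tendsto (fun n : ℕ => L' / log n) atTop
        (nhds 0)).rpow_const (p := β) (Or.inr hβ.le)
      rwa [zero_rpow hβ.ne'] at this
    · filter_upwards [hlog.eventually_gt_atTop 0] with n hn
      exact rpow_pos_of_pos (div_pos hL' hn) _
  have hinv : ∀ L' x : ℝ, 0 < L' → 0 < x → ((L' / x) ^ β) ^ (-(1 / β)) = x / L' := by
    intro L' x h1 h2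
    rw [← rpow_mul (by positivity)]
    have : β * -(1 / β) = -1 := by field_simp
    rw [this, rpow_neg_one, inv_div]
  have hcont : Tendsto (fun x : ℝ => x ^ β) (nhds L) (nhds (L ^ β)) :=
    (continuousAt_rpow_const L β (Or.inl hL.ne')).tendsto
  refine tendsto_order.2 ⟨fun b hb' => ?_, fun b hb' => ?_⟩
  · obtain ⟨L', ⟨hbL, hL'0⟩, hLL⟩ := (((hcont.mono_left nhdsWithin_le_nhds).eventually_const_lt
      hb').and (Ioo_mem_nhdsLT hL)).and self_mem_nhdsWithin |>.exists
    have hL'0 : 0 < L' := hL'0.1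
    obtain ⟨L'', h1, h2⟩ := exists_between (show L' < L from hLL)
    filter_upwards [(hε L' hL'0).eventually (hD L'' h2), hlog.eventually_gt_atTop 0,
      eventually_ge_atTop 1] with n hn hln hn1
    by_contra! hcon
    have hn0 : (0 : ℝ) < n := by exact_mod_cast hn1
    have hlt : entropyNum K n < (L' / log n) ^ β := by
      rw [div_rpow hL'0.le hln.le, lt_div_iff₀ (by positivity)]
      exact hcon.trans_lt hbL
    have := hn n (coverable_of_entropyNum_lt hn1 hb hlt)
    rw [hinv L' _ hL'0 hln, ← le_log_iff_exp_le hn0] at this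
    have h3 : L'' * (log n / L') = log n * (L'' / L') := by ring
    rw [h3] at this
    have h4 : 1 < L'' / L' := (one_lt_div hL'0).2 h1
    nlinarith
  · obtain ⟨L', hbL, hLL⟩ := ((hcont.mono_left nhdsWithin_le_nhds).eventually_lt_const hb').and
      (self_mem_nhdsWithin (s := Set.Ioi L)) |>.exists
    have hLL : L < L' := hLL
    have hL'0 : 0 < L' := hL.trans hLL
    filter_upwards [(hε L' hL'0).eventually (hU L' hLL), hlog.eventually_gt_atTop 0,
      eventually_ge_atTop 1] with n hn hln hn1
    have hn0 : (0 : ℝ) < n := by exact_mod_cast hn1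
    rw [hinv L' _ hL'0 hln, mul_div_cancel₀ _ hL'0.ne', exp_log hn0] at hn
    have := entropyNum_le_of_coverable hne hn
    rw [div_rpow hL'0.le hln.le, le_div_iff₀ (by positivity)] at this
    exact this.trans_lt hbL

end EntropyCalculus

instance : IsProbabilityMeasure μ01 := ⟨by simp [μ01]⟩

theorem ae_mem_μ01 : ∀ᵐ t ∂μ01, t ∈ Set.Icc (0 : ℝ) 1 := ae_restrict_mem measurableSet_Icc

theorem integral_μ01 (f : ℝ → ℝ) : ∫ t, f t ∂μ01 = ∫ t in (0 : ℝ)..1, f t := by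
  rw [μ01, integral_Icc_eq_integral_Ioc, intervalIntegral.integral_of_le zero_le_one]

theorem MeasureTheory.MemLp.norm_toLp_sq {f : ℝ → ℝ} (hf : MemLp f 2 μ01) :
    ‖hf.toLp f‖ ^ 2 = ∫ t, f t ^ 2 ∂μ01 := by
  rw [← real_inner_self_eq_norm_sq, L2.inner_def]
  refine integral_congr_ae ?_
  filter_upwards [hf.coeFn_toLp] with t ht
  simp [ht, sq]

theorem Lp.norm_sq_eq_integral (g : Lp ℝ 2 μ01) : ‖g‖ ^ 2 = ∫ t, g t ^ 2 ∂μ01 := by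
  rw [← (Lp.memLp g).norm_toLp_sq, Lp.toLp_coeFn]

theorem inner_toLp_left {f : ℝ → ℝ} (hf : MemLp f 2 μ01) (g : Lp ℝ 2 μ01) :
    ⟪hf.toLp f, g⟫ = ∫ t, f t * g t ∂μ01 := by
  rw [L2.inner_def]
  refine integral_congr_ae ?_
  filter_upwards [hf.coeFn_toLp] with t ht
  simp [ht, mul_comm]

theorem norm_le_of_ae_abs_le {h : Lp ℝ 2 μ01} {C : ℝ} (hC : 0 ≤ C) (hh : ∀ᵐ t ∂μ01, |h t| ≤ C) :
    ‖h‖ ≤ C := by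
  refine le_of_sq_le_sq ?_ hC
  rw [Lp.norm_sq_eq_integral]
  calc ∫ t, h t ^ 2 ∂μ01 ≤ ∫ _, C ^ 2 ∂μ01 := by
        refine integral_mono_ae (Lp.memLp h).integrable_sq (integrable_const _) ?_
        filter_upwards [hh] with t ht
        exact sq_le_sq' (by linarith [(abs_le.1 ht).1]) (abs_le.1 ht).2
    _ = C ^ 2 := by simp

/-- A measurable kernel on the unit square whose sections are bounded by `C` in `L²`. -/
structure L2Kernel (k : ℝ → ℝ → ℝ) (C : ℝ) : Prop where
  meas : Measurable (Function.uncurry k)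
  nonneg : 0 ≤ C
  memLp : ∀ t ∈ Set.Icc (0 : ℝ) 1, MemLp (k t) 2 μ01
  bound : ∀ t ∈ Set.Icc (0 : ℝ) 1, ∫ s, k t s ^ 2 ∂μ01 ≤ C ^ 2

/-- The integral operator with kernel `k`, as a function. -/
noncomputable def kernelFun (k : ℝ → ℝ → ℝ) (g : ℝ → ℝ) (t : ℝ) : ℝ := ∫ s, k t s * g s ∂μ01

/-- The image of the unit ball under the integral operator with kernel `k`. -/
def kernelBall (k : ℝ → ℝ → ℝ) : Set (Lp ℝ 2 μ01) :=
  {h | ∃ g : Lp ℝ 2 μ01, ‖g‖ ≤ 1 ∧ h =ᵐ[μ01] kernelFun k g}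

namespace L2Kernel

variable {k k₁ k₂ : ℝ → ℝ → ℝ} {C C₁ C₂ : ℝ} {t : ℝ}

theorem integrable (h : L2Kernel k C) (ht : t ∈ Set.Icc (0 : ℝ) 1) (g : Lp ℝ 2 μ01) :
    Integrable (fun s => k t s * g s) μ01 :=
  (h.memLp t ht).integrable_mul (Lp.memLp g)

theorem integral_abs_le (h : L2Kernel k C) (ht : t ∈ Set.Icc (0 : ℝ) 1) (g : Lp ℝ 2 μ01) :
    ∫ s, |k t s * g s| ∂μ01 ≤ C * ‖g‖ := by
  have h1 : MemLp (fun s => |k t s|) 2 μ01 := (h.memLp t ht).abs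
  have h2 : MemLp (fun s => |g s|) 2 μ01 := (Lp.memLp g).abs
  have h3 := real_inner_le_norm (h1.toLp _) (h2.toLp _)
  have e1 : ‖h1.toLp _‖ ≤ C := by
    refine le_of_sq_le_sq ?_ h.nonneg
    rw [h1.norm_toLp_sq]
    simpa using h.bound t ht
  have e2 : ‖h2.toLp _‖ = ‖g‖ := by
    rw [← pow_left_inj₀ (norm_nonneg _) (norm_nonneg _) two_ne_zero, h2.norm_toLp_sq,
      Lp.norm_sq_eq_integral]
    simp
  rw [inner_toLp_left, e2] at h3
  calc ∫ s, |k t s * g s| ∂μ01 = ∫ s, |k t s| * h2.toLp _ s ∂μ01 := by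
        refine integral_congr_ae ?_
        filter_upwards [h2.coeFn_toLp] with s hs
        rw [hs, abs_mul]
    _ ≤ _ := h3
    _ ≤ _ := by gcongr

theorem abs_kernelFun_le (h : L2Kernel k C) (ht : t ∈ Set.Icc (0 : ℝ) 1) (g : Lp ℝ 2 μ01) :
    |kernelFun k g t| ≤ C * ‖g‖ :=
  (abs_integral_le_integral_abs).trans (h.integral_abs_le ht g)

theorem stronglyMeasurable_mul (h : L2Kernel k C) (g : Lp ℝ 2 μ01) :
    StronglyMeasurable (Function.uncurry fun t s => k t s * g s) :=
  h.meas.stronglyMeasurable.mul ((Lp.stronglyMeasurable g).comp_measurable measurable_snd)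

theorem memLp_kernelFun (h : L2Kernel k C) (g : Lp ℝ 2 μ01) : MemLp (kernelFun k g) 2 μ01 := by
  refine MemLp.of_bound (h.stronglyMeasurable_mul g).integral_prod_right.aestronglyMeasurable
    (C * ‖g‖) ?_
  filter_upwards [ae_mem_μ01] with t ht
  exact h.abs_kernelFun_le ht g

theorem add (h₁ : L2Kernel k₁ C₁) (h₂ : L2Kernel k₂ C₂) :
    L2Kernel (fun t s => k₁ t s + k₂ t s) (C₁ + C₂) where
  meas := h₁.meas.add h₂.meas
  nonneg := add_nonneg h₁.nonneg h₂.nonneg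
  memLp t ht := (h₁.memLp t ht).add (h₂.memLp t ht)
  bound t ht := by
    have m1 := h₁.memLp t ht
    have m2 := h₂.memLp t ht
    have e1 : ‖m1.toLp _‖ ≤ C₁ := le_of_sq_le_sq (m1.norm_toLp_sq ▸ h₁.bound t ht) h₁.nonneg
    have e2 : ‖m2.toLp _‖ ≤ C₂ := le_of_sq_le_sq (m2.norm_toLp_sq ▸ h₂.bound t ht) h₂.nonneg
    have e3 := (m1.add m2).norm_toLp_sq
    simp only [Pi.add_apply] at e3
    rw [← e3, MemLp.toLp_add]
    exact pow_le_pow_left₀ (norm_nonneg _) ((norm_add_le _ _).trans (add_le_add e1 e2)) 2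

theorem kernelFun_add (h₁ : L2Kernel k₁ C₁) (h₂ : L2Kernel k₂ C₂) (ht : t ∈ Set.Icc (0 : ℝ) 1)
    (g : Lp ℝ 2 μ01) :
    kernelFun (fun t s => k₁ t s + k₂ t s) g t = kernelFun k₁ g t + kernelFun k₂ g t := by
  simp only [kernelFun, add_mul]
  exact integral_add (h₁.integrable ht g) (h₂.integrable ht g)

theorem mem_kernelBall (h : L2Kernel k C) {g : Lp ℝ 2 μ01} (hg : ‖g‖ ≤ 1) :
    (h.memLp_kernelFun g).toLp _ ∈ kernelBall k := ⟨g, hg, MemLp.coeFn_toLp _⟩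

theorem norm_le_of_mem_kernelBall (h : L2Kernel k C) {x : Lp ℝ 2 μ01} (hx : x ∈ kernelBall k) :
    ‖x‖ ≤ C := by
  obtain ⟨g, hg, hx⟩ := hx
  refine norm_le_of_ae_abs_le h.nonneg ?_
  filter_upwards [hx, ae_mem_μ01] with t ht ht'
  rw [ht]
  exact (h.abs_kernelFun_le ht' g).trans (mul_le_of_le_one_right h.nonneg hg)

theorem kernelBall_add_subset (h₁ : L2Kernel k₁ C₁) (h₂ : L2Kernel k₂ C₂) :
    ∀ x ∈ kernelBall (fun t s => k₁ t s + k₂ t s), ∃ y ∈ kernelBall k₁, ∃ z ∈ kernelBall k₂,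
      x = y + z := by
  rintro x ⟨g, hg, hx⟩
  refine ⟨_, h₁.mem_kernelBall hg, _, h₂.mem_kernelBall hg, Lp.ext ?_⟩
  filter_upwards [hx, ae_mem_μ01, Lp.coeFn_add ((h₁.memLp_kernelFun g).toLp _)
    ((h₂.memLp_kernelFun g).toLp _), (h₁.memLp_kernelFun g).coeFn_toLp,
    (h₂.memLp_kernelFun g).coeFn_toLp] with t e1 e2 e3 e4 e5
  rw [e1, e3, Pi.add_apply, e4, e5, kernelFun_add h₁ h₂ e2]

theorem kernelBall_subset_add (h₁ : L2Kernel k₁ C₁) (h₂ : L2Kernel k₂ C₂) :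
    ∀ x ∈ kernelBall k₁, ∃ y ∈ kernelBall (fun t s => k₁ t s + k₂ t s), ∃ z ∈ kernelBall k₂,
      x = y + z := by
  rintro x ⟨g, hg, hx⟩
  refine ⟨_, (h₁.add h₂).mem_kernelBall hg, _, h₂.mem_kernelBall (g := -g) (by rwa [norm_neg]),
    Lp.ext ?_⟩
  filter_upwards [hx, ae_mem_μ01, Lp.coeFn_add (((h₁.add h₂).memLp_kernelFun g).toLp _)
    ((h₂.memLp_kernelFun (-g)).toLp _), ((h₁.add h₂).memLp_kernelFun g).coeFn_toLp,
    (h₂.memLp_kernelFun (-g)).coeFn_toLp] with t e1 e2 e3 e4 e5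
  have e6 : kernelFun k₂ (-g : Lp ℝ 2 μ01) t = - kernelFun k₂ g t := by
    simp only [kernelFun]
    rw [← integral_neg]
    refine integral_congr_ae ?_
    filter_upwards [Lp.coeFn_neg g] with s hs
    rw [hs, Pi.neg_apply, mul_neg]
  rw [e1, e3, Pi.add_apply, e4, e5, kernelFun_add h₁ h₂ e2, e6]
  ring

theorem integral_mul_kernelFun (h : L2Kernel k C) {F : ℝ → ℝ} (hF : Measurable F) {M : ℝ}
    (hM : ∀ t, |F t| ≤ M) (g : Lp ℝ 2 μ01) :
    ∫ t, F t * kernelFun k g t ∂μ01 = ∫ s, (∫ t, F t * k t s ∂μ01) * g s ∂μ01 := by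
  have hM0 : 0 ≤ M := (abs_nonneg _).trans (hM 0)
  have hintegr : Integrable (Function.uncurry fun t s => F t * (k t s * g s)) (μ01.prod μ01) := by
    have hmeas : StronglyMeasurable (Function.uncurry fun t s => F t * (k t s * g s)) :=
      (hF.comp measurable_fst).stronglyMeasurable.mul (h.stronglyMeasurable_mul g)
    refine (integrable_prod_iff hmeas.aestronglyMeasurable).2 ⟨?_, ?_⟩
    · filter_upwards [ae_mem_μ01] with t ht
      exact (show Integrable (fun s => F t * (k t s * g s)) μ01 from
        (h.integrable ht g).const_mul (F t))
    · refine Integrable.of_bound (C := M * (C * ‖g‖))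
        (StronglyMeasurable.integral_prod_right (f := fun t s => ‖F t * (k t s * g s)‖)
          hmeas.norm).aestronglyMeasurable ?_
      filter_upwards [ae_mem_μ01] with t ht
      rw [Real.norm_of_nonneg (integral_nonneg fun _ => norm_nonneg _)]
      simp only [Function.uncurry_apply_pair, norm_mul (F t), integral_const_mul]
      exact mul_le_mul (hM t) (h.integral_abs_le ht g)
        (integral_nonneg fun _ => norm_nonneg _) hM0
  calc ∫ t, F t * kernelFun k g t ∂μ01 = ∫ t, ∫ s, F t * (k t s * g s) ∂μ01 ∂μ01 := by
        simp only [kernelFun, integral_const_mul]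
    _ = ∫ s, ∫ t, F t * (k t s * g s) ∂μ01 ∂μ01 := integral_integral_swap hintegr
    _ = _ := by simp only [← mul_assoc, integral_mul_const]

end L2Kernel

theorem integral_cos_two_pi_int (n : ℤ) (x : ℝ) :
    ∫ t, cos (2 * π * n * t + x) ∂μ01 = if n = 0 then cos x else 0 := by
  rw [integral_μ01]
  split_ifs with h
  · simp [h]
  · have hn : (2 * π * n : ℝ) ≠ 0 := by
      have : (n : ℝ) ≠ 0 := by exact_mod_cast h
      positivity
    rw [intervalIntegral.integral_comp_mul_add (fun u => cos u) hn, integral_cos]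
    have : sin (2 * π * n * 1 + x) = sin (2 * π * n * 0 + x) := by
      have := sin_add_int_mul_two_pi x n
      rw [← mul_comm (2 * π), add_comm] at this
      simpa using this
    rw [this]; simp

theorem integral_cos_mul_cos (a b : ℕ) (x y : ℝ) :
    ∫ t, cos (2 * π * a * t + x) * cos (2 * π * b * t + y) ∂μ01
      = ((if a + b = 0 then cos (x + y) else 0) + if a = b then cos (x - y) else 0) / 2 := by
  have hc : ∀ n : ℤ, ∀ z, Integrable (fun t => cos (2 * π * n * t + z)) μ01 := fun n z =>
    Integrable.of_bound (C := 1) (by fun_prop) (ae_of_all _ fun t => abs_cos_le_one _)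
  have h1 := integral_cos_two_pi_int (a + b) (x + y)
  have h2 := integral_cos_two_pi_int (a - b) (x - y)
  have e1 : ((a : ℤ) + b = 0) ↔ a + b = 0 := by norm_cast
  have e2 : ((a : ℤ) - b = 0) ↔ a = b := by rw [sub_eq_zero]; norm_cast
  simp only [e1, e2] at h1 h2
  rw [← h1, ← h2, ← integral_add (hc _ _) (hc _ _), ← integral_div]
  congr 1 with t
  have := cos_add (2 * π * a * t + x) (2 * π * b * t + y)
  have := cos_sub (2 * π * a * t + x) (2 * π * b * t + y)
  have r1 : 2 * π * ((a + b : ℤ) : ℝ) * t + (x + y) = (2 * π * a * t + x) + (2 * π * b * t + y) := by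
    push_cast; ring
  have r2 : 2 * π * ((a - b : ℤ) : ℝ) * t + (x - y) = (2 * π * a * t + x) - (2 * π * b * t + y) := by
    push_cast; ring
  rw [r1, r2]; linarith

/-- The frequency of the `j`-th trigonometric function: `0, 1, 1, 2, 2, …`. -/
def trigFreq (j : ℕ) : ℕ := (j + 1) / 2

/-- The `L²`-normalised trigonometric functions on `[0,1]`, where the pair of frequency `k` is
shifted by the phase `θ k`. -/
noncomputable def trigFun (θ : ℕ → ℝ) (j : ℕ) (t : ℝ) : ℝ :=
  (if j = 0 then 1 else √2) *
    cos (2 * π * trigFreq j * t + (((j % 2 : ℕ) : ℝ) * (π / 2) + θ (trigFreq j)))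

theorem measurable_trigFun (θ : ℕ → ℝ) (j : ℕ) : Measurable (trigFun θ j) := by
  unfold trigFun; fun_prop

theorem abs_trigFun_le (θ : ℕ → ℝ) (j : ℕ) (t : ℝ) : |trigFun θ j t| ≤ √2 := by
  rw [trigFun, abs_mul]
  refine (mul_le_of_le_one_right (abs_nonneg _) (abs_cos_le_one _)).trans ?_
  split_ifs
  · simp
  · rw [abs_of_nonneg (by positivity)]

theorem memLp_trigFun (θ : ℕ → ℝ) (j : ℕ) : MemLp (trigFun θ j) 2 μ01 :=
  MemLp.of_bound (measurable_trigFun θ j).aestronglyMeasurable (√2)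
    (ae_of_all _ fun t => abs_trigFun_le θ j t)

theorem integral_trigFun_mul (θ : ℕ → ℝ) (hθ : θ 0 = 0) (i j : ℕ) :
    ∫ t, trigFun θ i t * trigFun θ j t ∂μ01 = if i = j then 1 else 0 := by
  have : ∀ t, trigFun θ i t * trigFun θ j t =
      ((if i = 0 then 1 else √2) * (if j = 0 then 1 else √2)) *
      (cos (2 * π * trigFreq i * t + (((i % 2 : ℕ) : ℝ) * (π / 2) + θ (trigFreq i))) *
      cos (2 * π * trigFreq j * t + (((j % 2 : ℕ) : ℝ) * (π / 2) + θ (trigFreq j)))) :=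
    fun t => by simp only [trigFun]; ring
  simp only [this]
  rw [integral_const_mul, integral_cos_mul_cos]
  by_cases hij : i = j
  · subst hij
    by_cases hi : i = 0
    · subst hi; simp [trigFreq, hθ]
    · have : trigFreq i + trigFreq i ≠ 0 := by unfold trigFreq; omega
      rw [if_neg this]; simp [hi]
  · by_cases hf : trigFreq i = trigFreq j
    · have h0 : trigFreq i + trigFreq j ≠ 0 := by unfold trigFreq at *; omega
      have h1 : (i % 2 = 0 ∧ j % 2 = 1) ∨ (i % 2 = 1 ∧ j % 2 = 0) := by
        unfold trigFreq at *; omega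
      rw [if_neg h0, if_pos hf, if_neg hij, hf]
      rcases h1 with ⟨a, b⟩ | ⟨a, b⟩ <;> simp [a, b]
    · have h0 : trigFreq i + trigFreq j ≠ 0 := by unfold trigFreq at *; omega
      rw [if_neg h0, if_neg hf, if_neg hij]; simp

theorem orthonormal_trigFun (θ : ℕ → ℝ) (hθ : θ 0 = 0) :
    Orthonormal ℝ fun j => (memLp_trigFun θ j).toLp (trigFun θ j) := by
  rw [orthonormal_iff_ite]
  intro i j
  rw [inner_toLp_left, ← integral_trigFun_mul θ hθ]
  refine integral_congr_ae ?_
  filter_upwards [(memLp_trigFun θ j).coeFn_toLp] with t ht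
  rw [ht]

theorem integral_cos_mul_eq_zero {θ : ℕ → ℝ} (hθ : θ 0 = 0) {g : Lp ℝ 2 μ01}
    (hg : ∀ j, ∫ t, trigFun θ j t * g t ∂μ01 = 0) (k : ℕ) (x : ℝ) :
    ∫ t, cos (2 * π * k * t + x) * g t ∂μ01 = 0 := by
  have hintegr : ∀ j, Integrable (fun t => trigFun θ j t * g t) μ01 := fun j =>
    (memLp_trigFun θ j).integrable_mul (Lp.memLp g)
  rcases Nat.eq_zero_or_pos k with rfl | hk
  · have := hg 0
    simp only [trigFun, trigFreq, hθ] at this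
    simp only [CharP.cast_eq_zero, mul_zero, zero_mul, zero_add, integral_const_mul]
    simp at this
    simp [this]
  · have h1 : trigFreq (2 * k) = k := by unfold trigFreq; omega
    have h2 : trigFreq (2 * k - 1) = k := by unfold trigFreq; omega
    have h3 : (2 * k - 1) % 2 = 1 := by omega
    have h4 : 2 * k - 1 ≠ 0 := by omega
    have h5 : 2 * k ≠ 0 := by omega
    have e : ∀ t, cos (2 * π * k * t + x) * g t =
        cos (x - θ k) / √2 * (trigFun θ (2 * k) t * g t)
        + sin (x - θ k) / √2 * (trigFun θ (2 * k - 1) t * g t) := by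
      intro t
      have s2 : √2 ≠ 0 := by positivity
      simp only [trigFun, h1, h2, h3, if_neg h4, if_neg h5, Nat.mul_mod_right]
      have := cos_add (2 * π * k * t + θ k) (x - θ k)
      have r : 2 * π * k * t + θ k + (x - θ k) = 2 * π * k * t + x := by ring
      rw [r] at this
      have r2 : 2 * π * k * t + (((1 : ℕ) : ℝ) * (π / 2) + θ k) = 2 * π * k * t + θ k + π / 2 := by
        push_cast; ring
      rw [this, r2, cos_add_pi_div_two]
      simp only [CharP.cast_eq_zero, zero_mul, zero_add]
      field_simp
      ring
    simp only [e]
    rw [integral_add ((hintegr _).const_mul _) ((hintegr _).const_mul _), integral_const_mul,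
      integral_const_mul, hg, hg]
    simp

theorem eq_zero_of_integral_cos_mul_eq_zero {g : Lp ℝ 2 μ01}
    (hg : ∀ (k : ℕ) (x : ℝ), ∫ t, cos (2 * π * k * t + x) * g t ∂μ01 = 0) : g = 0 := by
  have hmem : MemLp (fun t => (g t : ℂ)) 2 (volume.restrict (Set.Ioc (0 : ℝ) 1)) :=
    ((Lp.memLp g).mono_measure (Measure.restrict_mono Set.Ioc_subset_Icc_self le_rfl)).ofReal
  have hsum := hasSum_sq_fourierCoeffOn (zero_lt_one (α := ℝ)) hmem
  have hintegr : ∀ n : ℤ, ∀ x, ∫ t in (0 : ℝ)..1, cos (2 * π * n * t + x) * g t = 0 := by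
    intro n x
    rw [← integral_μ01]
    obtain ⟨k, rfl | rfl⟩ := n.eq_nat_or_neg
    · exact_mod_cast hg k x
    · rw [← hg k (-x)]
      congr 1 with t
      rw [← cos_neg]
      congr 2
      push_cast; ring
  have hI : ∀ (n : ℤ) (x : ℝ),
      IntervalIntegrable (fun t => ((cos (2 * π * n * t + x) * g t : ℝ) : ℂ)) volume 0 1 := by
    intro n x
    rw [intervalIntegrable_iff_integrableOn_Ioc_of_le zero_le_one]
    have : Integrable (fun t => cos (2 * π * n * t + x) * g t) μ01 :=
      (MemLp.of_bound (p := 2) (f := fun t => cos (2 * π * n * t + x)) (by fun_prop) 1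
        (ae_of_all _ fun t => abs_cos_le_one _)).integrable_mul (Lp.memLp g)
    exact (IntegrableOn.mono_set this Set.Ioc_subset_Icc_self).ofReal
  have h0 : ∀ n, fourierCoeffOn (zero_lt_one (α := ℝ)) (fun t => (g t : ℂ)) n = 0 := by
    intro n
    rw [fourierCoeffOn_eq_integral]
    have e : ∀ t : ℝ, fourier (-n) (t : AddCircle ((1 : ℝ) - 0)) • (g t : ℂ) =
        ((cos (2 * π * n * t + 0) * g t : ℝ) : ℂ)
        + Complex.I * ((cos (2 * π * n * t + π / 2) * g t : ℝ) : ℂ) := by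
      intro t
      rw [fourier_coe_apply, cos_add_pi_div_two, smul_eq_mul]
      have : 2 * (π : ℂ) * Complex.I * ((-n : ℤ) : ℂ) * (t : ℂ) / (((1 : ℝ) - 0 : ℝ) : ℂ)
          = ((-(2 * π * n * t) : ℝ) : ℂ) * Complex.I := by push_cast; ring
      rw [this, Complex.exp_mul_I]
      push_cast
      rw [Complex.cos_neg, Complex.sin_neg, add_zero]
      ring
    simp only [e]
    rw [intervalIntegral.integral_add (hI _ _) ((hI _ _).const_mul _),
      intervalIntegral.integral_const_mul, intervalIntegral.integral_ofReal,
      intervalIntegral.integral_ofReal, hintegr, hintegr]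
    simp
  simp only [h0, norm_zero, ne_eq, OfNat.ofNat_ne_zero, not_false_eq_true, zero_pow] at hsum
  have h2 := hsum.unique hasSum_zero
  have h3 : ‖g‖ ^ 2 = 0 := by
    rw [Lp.norm_sq_eq_integral, integral_μ01]
    simpa using h2
  simpa using h3

theorem orthogonal_span_trigFun (θ : ℕ → ℝ) (hθ : θ 0 = 0) :
    (Submodule.span ℝ (Set.range fun j => (memLp_trigFun θ j).toLp (trigFun θ j)))ᗮ = ⊥ := by
  rw [Submodule.eq_bot_iff]
  intro g hg
  refine eq_zero_of_integral_cos_mul_eq_zero (integral_cos_mul_eq_zero hθ fun j => ?_)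
  rw [← inner_toLp_left (memLp_trigFun θ j)]
  exact (Submodule.mem_orthogonal _ _).1 hg _ (Submodule.subset_span ⟨j, rfl⟩)

/-- The trigonometric Hilbert basis of `L²([0,1])` with phases `θ`. -/
noncomputable def trigBasis (θ : ℕ → ℝ) (hθ : θ 0 = 0) : HilbertBasis ℕ ℝ (Lp ℝ 2 μ01) :=
  HilbertBasis.mkOfOrthogonalEqBot (orthonormal_trigFun θ hθ) (orthogonal_span_trigFun θ hθ)

theorem inner_trigBasis (θ : ℕ → ℝ) (hθ : θ 0 = 0) (j : ℕ) (g : Lp ℝ 2 μ01) :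
    ⟪trigBasis θ hθ j, g⟫ = ∫ t, trigFun θ j t * g t ∂μ01 := by
  rw [trigBasis, HilbertBasis.coe_mkOfOrthogonalEqBot, inner_toLp_left]

theorem integrableOn_rpow_mul_exp_neg_mul {s b : ℝ} (hs : -1 < s) (hb : 0 < b) :
    IntegrableOn (fun u : ℝ => u ^ s * exp (-(b * u))) (Set.Ioi 0) := by
  simpa [neg_mul] using integrableOn_rpow_mul_exp_neg_mul_rpow hs one_pos hb

theorem norm_ofReal_mul_cexp (x u : ℝ) (r : ℂ) :
    ‖(x : ℂ) * Complex.exp (-(r * u))‖ = |x| * exp (-(r.re * u)) := by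
  rw [norm_mul, Complex.norm_exp, Complex.norm_real, Real.norm_eq_abs]
  simp

/-- The Laplace transform of `u ^ (β - 1)` on the right half-plane. -/
theorem integral_rpow_mul_cexp_neg_mul {β : ℝ} (hβ : 0 < β) {r : ℂ} (hr : 0 < r.re) :
    ∫ u in Set.Ioi (0 : ℝ), ((u ^ (β - 1) : ℝ) : ℂ) * Complex.exp (-(r * u)) =
      r ^ ((-β : ℝ) : ℂ) * Gamma β := by
  have hU : IsOpen {z : ℂ | 0 < z.re} := isOpen_lt continuous_const Complex.continuous_re
  have hmeas : ∀ (a : ℝ) (z : ℂ), AEStronglyMeasurable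
      (fun u : ℝ => ((u ^ a : ℝ) : ℂ) * Complex.exp (-(z * u)))
      (volume.restrict (Set.Ioi 0)) := fun a z => by
    refine Measurable.aestronglyMeasurable ?_
    fun_prop
  have hintegr : ∀ (a : ℝ), -1 < a → ∀ z : ℂ, 0 < z.re → Integrable
      (fun u : ℝ => ((u ^ a : ℝ) : ℂ) * Complex.exp (-(z * u)))
      (volume.restrict (Set.Ioi 0)) := fun a ha z hz => by
    refine (integrableOn_rpow_mul_exp_neg_mul ha hz).mono' (hmeas a z) ?_
    filter_upwards [ae_restrict_mem measurableSet_Ioi] with u hu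
    rw [norm_ofReal_mul_cexp, abs_of_nonneg (rpow_nonneg (le_of_lt hu) _)]
  have h1 : DifferentiableOn ℂ (fun z : ℂ => ∫ u in Set.Ioi (0 : ℝ),
      ((u ^ (β - 1) : ℝ) : ℂ) * Complex.exp (-(z * u))) {z : ℂ | 0 < z.re} := by
    intro z hz
    have hz : 0 < z.re := hz
    refine DifferentiableAt.differentiableWithinAt ?_
    have := hasDerivAt_integral_of_dominated_loc_of_deriv_le (μ := volume.restrict (Set.Ioi (0 : ℝ)))
      (F := fun (w : ℂ) (u : ℝ) => ((u ^ (β - 1) : ℝ) : ℂ) * Complex.exp (-(w * u)))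
      (F' := fun (w : ℂ) (u : ℝ) => ((u ^ (β - 1) : ℝ) : ℂ) * (Complex.exp (-(w * u)) * -(1 * u)))
      (x₀ := z) (s := {w : ℂ | z.re / 2 < w.re})
      (bound := fun u : ℝ => u ^ β * exp (-(z.re / 2 * u)))
      ((isOpen_lt continuous_const Complex.continuous_re).mem_nhds
        (show z.re / 2 < z.re by linarith))
      (Eventually.of_forall fun w => hmeas _ w) (hintegr _ (by linarith) z hz)
      (Measurable.aestronglyMeasurable (by fun_prop)) ?_
      (integrableOn_rpow_mul_exp_neg_mul (by linarith) (by linarith)) ?_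
    · exact this.2.differentiableAt
    · filter_upwards [ae_restrict_mem measurableSet_Ioi] with u hu w hw
      have hu : 0 < u := hu
      have hw : z.re / 2 < w.re := hw
      rw [← mul_assoc, norm_mul, norm_ofReal_mul_cexp, abs_of_nonneg (rpow_nonneg hu.le _)]
      rw [one_mul, norm_neg, Complex.norm_real, Real.norm_of_nonneg hu.le]
      calc u ^ (β - 1) * exp (-(w.re * u)) * u = u ^ β * exp (-(w.re * u)) := by
            rw [rpow_sub_one hu.ne']; field_simp
        _ ≤ _ := by gcongr
    · refine ae_of_all _ fun u w _ => ?_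
      exact ((((hasDerivAt_id w).mul_const (u : ℂ)).neg).cexp).const_mul _
  have h2 : DifferentiableOn ℂ (fun z : ℂ => z ^ ((-β : ℝ) : ℂ) * Gamma β) {z : ℂ | 0 < z.re} := by
    intro z hz
    refine DifferentiableAt.differentiableWithinAt ?_
    exact (differentiableAt_id.cpow_const (Or.inl hz)).mul_const _
  have h3 : IsPreconnected {z : ℂ | 0 < z.re} :=
    (convex_halfSpace_re_gt 0).isPreconnected
  refine (h1.analyticOnNhd hU).eqOn_of_preconnected_of_frequently_eq (h2.analyticOnNhd hU) h3
    (z₀ := 1) (by simp) ?_ hr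
  have h4 : Tendsto (fun x : ℝ => (x : ℂ)) (nhdsWithin 1 (Set.Ioi 1)) (nhdsWithin 1 {1}ᶜ) := by
    refine tendsto_nhdsWithin_iff.2 ⟨?_, ?_⟩
    · have : Tendsto (fun x : ℝ => (x : ℂ)) (nhds 1) (nhds ((1 : ℝ) : ℂ)) :=
        Complex.continuous_ofReal.tendsto 1
      simpa using this.mono_left nhdsWithin_le_nhds
    · filter_upwards [self_mem_nhdsWithin] with x hx
      have hx : 1 < x := hx
      simpa using hx.ne'
  refine h4.frequently (Eventually.frequently ?_)
  filter_upwards [self_mem_nhdsWithin] with x hx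
  have hx : 1 < x := hx
  have h5 := Real.integral_rpow_mul_exp_neg_mul_Ioi hβ (zero_lt_one.trans hx)
  have h6 : (x : ℂ) ^ ((-β : ℝ) : ℂ) = (((1 / x) ^ β : ℝ) : ℂ) := by
    rw [← Complex.ofReal_cpow (by linarith), one_div, inv_rpow (by linarith),
      rpow_neg (by linarith)]
  rw [h6, ← Complex.ofReal_mul, ← h5, ← integral_complex_ofReal]
  congr 1 with u
  push_cast
  rfl

/-- The one-sided kernel `u ^ (β - 1) e ^ (-l u) / Γ(β)`. -/
noncomputable def expKer (β l u : ℝ) : ℝ :=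
  if 0 < u then u ^ (β - 1) * exp (-(l * u)) / Gamma β else 0

theorem expKer_of_nonpos {β l u : ℝ} (hu : u ≤ 0) : expKer β l u = 0 := if_neg hu.not_gt

theorem expKer_of_pos {β l u : ℝ} (hu : 0 < u) :
    expKer β l u = u ^ (β - 1) * exp (-(l * u)) / Gamma β := if_pos hu

theorem expKer_nonneg {β : ℝ} (hβ : 0 < β) (l u : ℝ) : 0 ≤ expKer β l u := by
  have := Gamma_pos_of_pos hβ
  unfold expKer
  split_ifs with h <;> positivity

theorem measurable_expKer (β l : ℝ) : Measurable (expKer β l) := by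
  unfold expKer
  exact Measurable.ite measurableSet_Ioi (by fun_prop) measurable_const

theorem expKer_eq_indicator (β l : ℝ) :
    expKer β l = (Set.Ioi 0).indicator fun u => u ^ (β - 1) * exp (-(l * u)) / Gamma β := by
  ext u; simp [expKer, Set.indicator]

theorem integrable_expKer {β l : ℝ} (hβ : 0 < β) (hl : 0 < l) : Integrable (expKer β l) := by
  rw [expKer_eq_indicator, integrable_indicator_iff measurableSet_Ioi]
  exact (integrableOn_rpow_mul_exp_neg_mul (by linarith) hl).div_const _

theorem integrable_expKer_sq {β l : ℝ} (hβ : 1 / 2 < β) (hl : 0 < l) :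
    Integrable fun u => expKer β l u ^ 2 := by
  have : (fun u => expKer β l u ^ 2) = (Set.Ioi 0).indicator
      fun u => u ^ (2 * β - 2) * exp (-(2 * l * u)) / Gamma β ^ 2 := by
    ext u
    by_cases hu : 0 < u
    · rw [expKer_of_pos hu, Set.indicator_of_mem (show u ∈ Set.Ioi 0 from hu), div_pow, mul_pow,
        ← rpow_mul_natCast hu.le, ← exp_nat_mul]
      congr 3 <;> · push_cast; ring
    · rw [expKer_of_nonpos (not_lt.1 hu), Set.indicator_of_notMem (show u ∉ Set.Ioi 0 from hu)]
      simp
  rw [this, integrable_indicator_iff measurableSet_Ioi]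
  exact (integrableOn_rpow_mul_exp_neg_mul (by linarith) (by linarith)).div_const _

/-- The argument of the Fourier transform of `expKer β l` at `w`. -/
noncomputable def expKerPhase (β l w : ℝ) : ℝ :=
  Complex.arg (((l : ℂ) - w * Complex.I) ^ ((-β : ℝ) : ℂ))

theorem expKerPhase_zero {β l : ℝ} (hl : 0 < l) : expKerPhase β l 0 = 0 := by
  rw [expKerPhase]
  simp only [Complex.ofReal_zero, zero_mul, sub_zero]
  rw [← Complex.ofReal_cpow hl.le, Complex.arg_ofReal_of_nonneg (by positivity)]

theorem integral_expKer_mul_cos {β l : ℝ} (hβ : 0 < β) (hl : 0 < l) (w x : ℝ) :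
    ∫ u, expKer β l u * cos (w * u + x) =
      (l ^ 2 + w ^ 2) ^ (-(β / 2)) * cos (expKerPhase β l w + x) := by
  set r : ℂ := (l : ℂ) - w * Complex.I with hr
  have hre : r.re = l := by simp [hr]
  have hG := Gamma_pos_of_pos hβ
  have h1 := integral_rpow_mul_cexp_neg_mul hβ (r := r) (by rw [hre]; exact hl)
  have hintegr : IntegrableOn (fun u : ℝ => ((u ^ (β - 1) : ℝ) : ℂ) * Complex.exp (-(r * u)))
      (Set.Ioi 0) := by
    refine (integrableOn_rpow_mul_exp_neg_mul (s := β - 1) (by linarith) hl).mono'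
      (Measurable.aestronglyMeasurable (by fun_prop)) ?_
    filter_upwards [ae_restrict_mem measurableSet_Ioi] with u hu
    rw [norm_ofReal_mul_cexp, abs_of_nonneg (rpow_nonneg (le_of_lt hu) _), hre]
  have h2 : ∫ u, expKer β l u * cos (w * u + x) = ∫ u in Set.Ioi (0 : ℝ),
      (((u ^ (β - 1) : ℝ) : ℂ) * Complex.exp (-(r * u)) *
        (Complex.exp (x * Complex.I) / Gamma β)).re := by
    rw [← integral_indicator measurableSet_Ioi]
    congr 1 with u
    by_cases hu : 0 < u
    · rw [expKer_of_pos hu, Set.indicator_of_mem (show u ∈ Set.Ioi 0 from hu)]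
      have : ((u ^ (β - 1) : ℝ) : ℂ) * Complex.exp (-(r * u)) *
        (Complex.exp (x * Complex.I) / Gamma β) = ((u ^ (β - 1) * exp (-(l * u)) / Gamma β : ℝ) : ℂ)
          * Complex.exp ((w * u + x : ℝ) * Complex.I) := by
        have e : -(r * u) = ((-(l * u) : ℝ) : ℂ) + w * u * Complex.I := by
          rw [hr]; push_cast; ring
        rw [e, Complex.exp_add]
        push_cast
        rw [add_mul, Complex.exp_add]
        ring
      rw [this, Complex.re_ofReal_mul, Complex.exp_ofReal_mul_I_re]
    · rw [expKer_of_nonpos (not_lt.1 hu), Set.indicator_of_notMem (show u ∉ Set.Ioi 0 from hu)]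
      simp
  have h3 := integral_re (hintegr.mul_const (Complex.exp (x * Complex.I) / Gamma β))
  simp only [RCLike.re_eq_complex_re] at h3
  rw [h2, h3, integral_mul_const, h1]
  have h4 : ‖r ^ ((-β : ℝ) : ℂ)‖ = (l ^ 2 + w ^ 2) ^ (-(β / 2)) := by
    rw [Complex.norm_cpow_real]
    have : ‖r‖ = (l ^ 2 + w ^ 2) ^ ((1 : ℝ) / 2) := by
      rw [← sqrt_eq_rpow, Complex.norm_def, Complex.normSq_apply, hre]
      simp [hr, sq]
    rw [this, ← rpow_mul (by positivity)]
    congr 1; ring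
  have h5 := Complex.norm_mul_exp_arg_mul_I (r ^ ((-β : ℝ) : ℂ))
  have h6 : r ^ ((-β : ℝ) : ℂ) * Gamma β * (Complex.exp (x * Complex.I) / Gamma β) =
      (((l ^ 2 + w ^ 2) ^ (-(β / 2)) : ℝ) : ℂ) *
        Complex.exp ((expKerPhase β l w + x : ℝ) * Complex.I) := by
    have : (Gamma β : ℂ) ≠ 0 := by exact_mod_cast hG.ne'
    rw [← h4, Complex.ofReal_add, add_mul, Complex.exp_add, ← mul_assoc, expKerPhase, h5]
    field_simp
  rw [h6, Complex.re_ofReal_mul, Complex.exp_ofReal_mul_I_re]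

/-- The convolution kernel of `expKer`. -/
noncomputable def causalKer (β l t s : ℝ) : ℝ := expKer β l (t - s)

/-- The difference between the periodised convolution kernel and `causalKer`. -/
noncomputable def tailKer (β l t s : ℝ) : ℝ := ∑' n : ℕ, expKer β l (t - s + (n + 1))

theorem exists_expKer_le {β l : ℝ} (hβ : 0 < β) (hl : 0 < l) :
    ∃ C, 0 ≤ C ∧ ∀ x, 1 ≤ x → expKer β l x ≤ C * exp (-(l / 2 * x)) := by
  have hG := Gamma_pos_of_pos hβ
  obtain ⟨m, hm⟩ := exists_nat_ge (β - 1)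
  refine ⟨m.factorial * (2 / l) ^ m / Gamma β, by positivity, fun x hx => ?_⟩
  have hx0 : 0 < x := by linarith
  rw [expKer_of_pos hx0]
  have h1 : x ^ (β - 1) ≤ x ^ m := by
    rw [← rpow_natCast]
    exact rpow_le_rpow_of_exponent_le hx hm
  have h2 := pow_div_factorial_le_exp (l / 2 * x) (by positivity) m
  have h3 : x ^ m ≤ m.factorial * (2 / l) ^ m * exp (l / 2 * x) := by
    have hf : (0 : ℝ) < m.factorial := by positivity
    rw [div_le_iff₀ hf] at h2
    calc x ^ m = (2 / l) ^ m * (l / 2 * x) ^ m := by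
          rw [← mul_pow]; congr 1; field_simp
      _ ≤ (2 / l) ^ m * (exp (l / 2 * x) * m.factorial) := by gcongr
      _ = _ := by ring
  calc x ^ (β - 1) * exp (-(l * x)) / Gamma β
      ≤ (m.factorial * (2 / l) ^ m * exp (l / 2 * x)) * exp (-(l * x)) / Gamma β := by
        gcongr; exact h1.trans h3
    _ = m.factorial * (2 / l) ^ m / Gamma β * (exp (l / 2 * x) * exp (-(l * x))) := by ring
    _ = _ := by rw [← exp_add]; congr 2; ring

theorem summable_exp_neg_mul_nat {b : ℝ} (hb : 0 < b) : Summable fun n : ℕ => exp (-(b * n)) := by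
  have := summable_geometric_of_lt_one (exp_pos (-b)).le (by rw [exp_lt_one_iff]; linarith)
  refine this.congr fun n => ?_
  rw [← exp_nat_mul]; congr 1; ring

theorem exists_expKer_add_nat_le {β l : ℝ} (hβ : 0 < β) (hl : 0 < l) :
    ∃ C, 0 ≤ C ∧ ∀ x, 0 ≤ x → ∀ n : ℕ, expKer β l (x + (n + 1)) ≤ C * exp (-(l / 2 * n)) := by
  obtain ⟨C, hC, h⟩ := exists_expKer_le hβ hl
  refine ⟨C, hC, fun x hx n => (h _ (by linarith [n.cast_nonneg (α := ℝ)])).trans ?_⟩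
  gcongr
  linarith

theorem summable_expKer {β l : ℝ} (hβ : 0 < β) (hl : 0 < l) {x : ℝ} (hx : -1 ≤ x) :
    Summable fun n : ℕ => expKer β l (x + (n + 1)) := by
  obtain ⟨C, hC, h⟩ := exists_expKer_add_nat_le hβ hl
  rw [← summable_nat_add_iff 1]
  refine Summable.of_nonneg_of_le (fun n => expKer_nonneg hβ _ _) (fun n => ?_)
    ((summable_exp_neg_mul_nat (half_pos hl)).mul_left C)
  have := h (x + 1) (by linarith) n
  rwa [show x + 1 + ((n : ℝ) + 1) = x + (((n + 1 : ℕ) : ℝ) + 1) by push_cast; ring] at this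

theorem l2Kernel_expKer {β l : ℝ} (hβ : 1 / 2 < β) (hl : 0 < l) (a : ℝ) :
    L2Kernel (fun t s => expKer β l (t - s + a)) (√(∫ u, expKer β l u ^ 2)) where
  meas := (measurable_expKer β l).comp (by fun_prop)
  nonneg := sqrt_nonneg _
  memLp t _ := by
    refine (memLp_two_iff_integrable_sq ?_).2 ?_
    · exact ((measurable_expKer β l).comp (by fun_prop)).aestronglyMeasurable
    · have := (integrable_expKer_sq hβ hl).comp_sub_left (t + a)
      refine (this.mono_measure Measure.restrict_le_self).congr (ae_of_all _ fun s => ?_)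
      dsimp only; congr 2; ring
  bound t _ := by
    rw [sq_sqrt (integral_nonneg fun _ => sq_nonneg _)]
    have := (integrable_expKer_sq hβ hl).comp_sub_left (t + a)
    rw [← integral_sub_left_eq_self (fun u => expKer β l u ^ 2) volume (t + a)]
    simp only [show ∀ s, t - s + a = t + a - s from fun s => by ring]
    exact setIntegral_le_integral this (ae_of_all _ fun _ => sq_nonneg _)

theorem l2Kernel_causalKer {β l : ℝ} (hβ : 1 / 2 < β) (hl : 0 < l) :
    L2Kernel (causalKer β l) (√(∫ u, expKer β l u ^ 2)) := by
  have := l2Kernel_expKer hβ hl 0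
  simp only [add_zero] at this
  exact this

theorem exists_l2Kernel_tailKer {β l : ℝ} (hβ : 1 / 2 < β) (hl : 0 < l) :
    ∃ C, L2Kernel (tailKer β l) C := by
  have hβ0 : 0 < β := by linarith
  obtain ⟨C, hC, h⟩ := exists_expKer_add_nat_le hβ0 hl
  set D : ℝ := ∑' n : ℕ, C * exp (-(l / 2 * n))
  have hs := (summable_exp_neg_mul_nat (half_pos hl)).mul_left C
  have h1 := l2Kernel_expKer hβ hl 1
  have hmeas : Measurable (Function.uncurry (tailKer β l)) :=
    Measurable.tsum (f := fun (n : ℕ) (p : ℝ × ℝ) => expKer β l (p.1 - p.2 + (n + 1)))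
      fun n => (measurable_expKer β l).comp (by fun_prop)
  have hD : 0 ≤ D := tsum_nonneg fun n => by positivity
  have key : ∀ t ∈ Set.Icc (0 : ℝ) 1, ∀ᵐ s ∂μ01,
      |tailKer β l t s - expKer β l (t - s + 1)| ≤ D := by
    intro t ht
    filter_upwards [ae_mem_μ01] with s hs'
    have hts : -1 ≤ t - s := by linarith [ht.1, hs'.2]
    have e : tailKer β l t s - expKer β l (t - s + 1) =
        ∑' n : ℕ, expKer β l (t - s + 1 + (n + 1)) := by
      rw [tailKer, (summable_expKer hβ0 hl hts).tsum_eq_zero_add]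
      simp only [CharP.cast_eq_zero, zero_add, add_sub_cancel_left]
      refine tsum_congr fun n => ?_
      congr 1; push_cast; ring
    rw [e, abs_of_nonneg (tsum_nonneg fun n => expKer_nonneg hβ0 _ _)]
    exact (summable_expKer hβ0 hl (by linarith)).tsum_le_tsum
      (fun n => h _ (by linarith) n) hs
  have h2 : L2Kernel (fun t s => tailKer β l t s - expKer β l (t - s + 1)) D := by
    have hm : Measurable (Function.uncurry fun t s => tailKer β l t s - expKer β l (t - s + 1)) :=
      hmeas.sub h1.meas
    have hmem : ∀ t ∈ Set.Icc (0 : ℝ) 1,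
        MemLp (fun s => tailKer β l t s - expKer β l (t - s + 1)) 2 μ01 := fun t ht =>
      MemLp.of_bound (hm.comp (measurable_prodMk_left (x := t))).aestronglyMeasurable D (key t ht)
    refine ⟨hm, hD, hmem, fun t ht => ?_⟩
    rw [← (hmem t ht).norm_toLp_sq]
    refine pow_le_pow_left₀ (norm_nonneg _) (norm_le_of_ae_abs_le hD ?_) 2
    filter_upwards [key t ht, (hmem t ht).coeFn_toLp] with s h3 h4
    rwa [h4]
  have := h2.add h1
  simp only [sub_add_cancel] at this
  exact ⟨_, this⟩

/-- The periodised convolution kernel of `expKer`. -/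
noncomputable def periodicKer (β l t s : ℝ) : ℝ := causalKer β l t s + tailKer β l t s

theorem hasSum_integral_mul_expKer {β l : ℝ} (hβ : 0 < β) (hl : 0 < l) {s : ℝ}
    (hs : s ∈ Set.Icc (0 : ℝ) 1) {F : ℝ → ℝ} (hF : Measurable F) {M : ℝ} (hM : ∀ t, |F t| ≤ M)
    (hper : ∀ (t : ℝ) (n : ℕ), F (t + n) = F t) :
    HasSum (fun n : ℕ => ∫ t, F t * expKer β l (t - s + n) ∂μ01)
      (∫ u, expKer β l u * F (u + s)) := by
  have hintegr : Integrable fun t => expKer β l (t - s) * F t :=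
    ((integrable_expKer hβ hl).comp_sub_right s).mul_bdd (c := M) hF.aestronglyMeasurable
      (ae_of_all _ hM)
  have h := hintegr.hasSum_intervalIntegral_comp_add_int
  rw [← integral_add_right_eq_self _ s] at h
  simp only [add_sub_cancel_right] at h
  rw [← Function.Injective.hasSum_iff (Nat.cast_injective (R := ℤ))] at h
  · refine h.congr_fun fun n => ?_
    simp only [Function.comp_apply, integral_μ01, Int.cast_natCast, hper]
    congr 1 with t
    rw [mul_comm, show t + n - s = t - s + n by ring]
  · intro n hn
    have hn' : n ≤ -1 := by
      by_contra hcon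
      exact hn ⟨n.toNat, by simp; omega⟩
    have hn'' : (n : ℝ) ≤ -1 := by exact_mod_cast hn'
    rw [intervalIntegral.integral_congr (g := fun _ => 0)]
    · simp
    · intro t ht
      rw [Set.uIcc_of_le zero_le_one] at ht
      dsimp only
      rw [expKer_of_nonpos (by linarith [ht.2, hs.1]), zero_mul]

theorem integral_mul_periodicKer {β l : ℝ} (hβ : 0 < β) (hl : 0 < l) {s : ℝ}
    (hs : s ∈ Set.Icc (0 : ℝ) 1) {F : ℝ → ℝ} (hF : Measurable F) {M : ℝ} (hM : ∀ t, |F t| ≤ M)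
    (hper : ∀ (t : ℝ) (n : ℕ), F (t + n) = F t) :
    ∫ t, F t * periodicKer β l t s ∂μ01 = ∫ u, expKer β l u * F (u + s) := by
  have hK : ∀ a : ℝ, Integrable (fun t => expKer β l (t - s + a)) μ01 := fun a => by
    have := (integrable_expKer hβ hl).comp_add_right (a - s)
    refine (this.mono_measure Measure.restrict_le_self).congr (ae_of_all _ fun t => ?_)
    dsimp only; congr 1; ring
  have hI : ∀ a : ℝ, Integrable (fun t => F t * expKer β l (t - s + a)) μ01 := fun a =>
    (hK a).bdd_mul hF.aestronglyMeasurable (ae_of_all _ hM)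
  have h1 := hasSum_integral_mul_expKer hβ hl hs hF hM hper
  have h2 := (hasSum_integral_mul_expKer hβ hl hs (F := fun _ => 1) measurable_const (M := 1)
    (by simp) (by simp)).summable
  have h3 := hasSum_integral_of_summable_integral_norm (μ := μ01)
    (F := fun (n : ℕ) t => F t * expKer β l (t - s + n)) (fun n => hI _) (by
      refine Summable.of_nonneg_of_le (fun n => integral_nonneg fun _ => norm_nonneg _)
        (fun n => ?_) (h2.mul_left M)
      rw [← integral_const_mul]
      refine integral_mono (hI _).norm (((hK _).const_mul _).const_mul _) fun t => ?_
      simp only [one_mul, norm_mul, Real.norm_eq_abs]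
      rw [abs_of_nonneg (expKer_nonneg hβ _ _)]
      exact mul_le_mul_of_nonneg_right (hM t) (expKer_nonneg hβ _ _))
  rw [← h3.unique h1]
  refine integral_congr_ae ?_
  filter_upwards [ae_mem_μ01] with t ht
  have hts : -1 ≤ t - s := by linarith [ht.1, hs.2]
  have h4 : Summable fun n : ℕ => expKer β l (t - s + n) := by
    rw [← summable_nat_add_iff 1]
    simpa only [Nat.cast_add, Nat.cast_one] using summable_expKer hβ hl hts
  rw [tsum_mul_left, h4.tsum_eq_zero_add]
  simp [periodicKer, causalKer, tailKer]

theorem cos_add_nat_period (k : ℕ) (x t : ℝ) (n : ℕ) :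
    cos (2 * π * k * (t + n) + x) = cos (2 * π * k * t + x) := by
  have := cos_add_nat_mul_two_pi (2 * π * k * t + x) (k * n)
  rw [← this]; congr 1; push_cast; ring

/-- The singular values of the periodised convolution operator. -/
noncomputable def periodicSV (β l : ℝ) (j : ℕ) : ℝ :=
  (l ^ 2 + (2 * π * trigFreq j) ^ 2) ^ (-(β / 2))

theorem integral_trigFun_mul_periodicKer {β l : ℝ} (hβ : 0 < β) (hl : 0 < l) {s : ℝ}
    (hs : s ∈ Set.Icc (0 : ℝ) 1) (j : ℕ) :
    ∫ t, trigFun 0 j t * periodicKer β l t s ∂μ01 =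
      periodicSV β l j * trigFun (fun k => expKerPhase β l (2 * π * k)) j s := by
  rw [integral_mul_periodicKer hβ hl hs (measurable_trigFun 0 j) (abs_trigFun_le 0 j)]
  · have h := integral_expKer_mul_cos hβ hl (2 * π * trigFreq j)
      (2 * π * trigFreq j * s + ((j % 2 : ℕ) : ℝ) * (π / 2))
    rw [← mul_right_inj' (show (if j = 0 then (1 : ℝ) else √2) ≠ 0 by split_ifs <;> positivity),
      ← integral_const_mul] at h
    rw [periodicSV, trigFun]
    calc _ = _ := ?_
      _ = _ := h
      _ = _ := ?_
    · congr 1 with u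
      simp only [trigFun, Pi.zero_apply]
      rw [mul_left_comm]
      congr 3
      ring
    · rw [mul_left_comm]
      congr 3
      ring
  · intro t n
    simp only [trigFun, cos_add_nat_period]

theorem periodicSV_pos {β l : ℝ} (hl : 0 < l) (j : ℕ) : 0 < periodicSV β l j := by
  unfold periodicSV; positivity

theorem tendsto_periodicSV {β l : ℝ} :
    Tendsto (fun j : ℕ => periodicSV β l j * (j : ℝ) ^ β) atTop (nhds (π ^ (-β))) := by
  have h0 : Tendsto (fun j : ℕ => ((j : ℝ))⁻¹) atTop (nhds 0) := tendsto_inv_atTop_nhds_zero_nat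
  have h1 : Tendsto (fun j : ℕ => 2 * (trigFreq j : ℝ) * ((j : ℝ))⁻¹) atTop (nhds 1) := by
    have h2 : Tendsto (fun j : ℕ => 1 + ((j : ℝ))⁻¹) atTop (nhds 1) := by
      simpa using tendsto_const_nhds.add h0
    refine tendsto_of_tendsto_of_tendsto_of_le_of_le' tendsto_const_nhds h2 ?_ ?_
    · filter_upwards [eventually_gt_atTop 0] with j hj
      have hj' : (0 : ℝ) < j := by exact_mod_cast hj
      have : (j : ℝ) ≤ 2 * trigFreq j := by
        have : j ≤ 2 * trigFreq j := by unfold trigFreq; omega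
        exact_mod_cast this
      rw [← div_eq_mul_inv, le_div_iff₀ hj']; linarith
    · filter_upwards [eventually_gt_atTop 0] with j hj
      have hj' : (0 : ℝ) < j := by exact_mod_cast hj
      have : 2 * (trigFreq j : ℝ) ≤ j + 1 := by
        have : 2 * trigFreq j ≤ j + 1 := by unfold trigFreq; omega
        exact_mod_cast this
      rw [← div_eq_mul_inv, div_le_iff₀ hj', add_mul, inv_mul_cancel₀ hj'.ne']; linarith
  have h2 : Tendsto (fun j : ℕ => (l * ((j : ℝ))⁻¹) ^ 2 +
      (π * (2 * (trigFreq j : ℝ) * ((j : ℝ))⁻¹)) ^ 2) atTop (nhds (π ^ 2)) := by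
    simpa using ((h0.const_mul l).pow 2).add ((h1.const_mul π).pow 2)
  have h3 := h2.rpow_const (p := -(β / 2)) (Or.inl (by positivity))
  have e : (π ^ 2) ^ (-(β / 2)) = π ^ (-β) := by
    rw [← rpow_natCast, ← rpow_mul pi_pos.le]; congr 1; push_cast; ring
  rw [e] at h3
  refine h3.congr' ?_
  filter_upwards [eventually_gt_atTop 0] with j hj
  have hj' : (0 : ℝ) < j := by exact_mod_cast hj
  have e2 : (l * ((j : ℝ))⁻¹) ^ 2 + (π * (2 * (trigFreq j : ℝ) * ((j : ℝ))⁻¹)) ^ 2 =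
      (l ^ 2 + (2 * π * trigFreq j) ^ 2) * ((j : ℝ) ^ (-2 : ℝ)) := by
    rw [rpow_neg hj'.le, rpow_two]; field_simp
  rw [e2, mul_rpow (by positivity) (by positivity), ← rpow_mul hj'.le, periodicSV]
  congr 2; ring

theorem inner_trigBasis_kernelFun {β l : ℝ} (hβ : 1 / 2 < β) (hl : 0 < l) {C : ℝ}
    (hk : L2Kernel (periodicKer β l) C) (j : ℕ) {x y : Lp ℝ 2 μ01}
    (hy : y =ᵐ[μ01] kernelFun (periodicKer β l) x) :
    ⟪trigBasis 0 rfl j, y⟫ = periodicSV β l j *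
      ⟪trigBasis (fun k => expKerPhase β l (2 * π * k)) (by simp [expKerPhase_zero hl]) j, x⟫ := by
  rw [inner_trigBasis, inner_trigBasis, ← integral_const_mul]
  calc _ = ∫ t, trigFun 0 j t * kernelFun (periodicKer β l) x t ∂μ01 := by
        refine integral_congr_ae ?_
        filter_upwards [hy] with t ht
        rw [ht]
    _ = _ := hk.integral_mul_kernelFun (measurable_trigFun 0 j) (abs_trigFun_le 0 j) x
    _ = _ := by
        refine integral_congr_ae ?_
        filter_upwards [ae_mem_μ01] with s hs
        rw [integral_trigFun_mul_periodicKer (by linarith) hl hs, mul_assoc]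

theorem exists_l2Kernel_periodicKer {β l : ℝ} (hβ : 1 / 2 < β) (hl : 0 < l) :
    ∃ C, L2Kernel (periodicKer β l) C := by
  obtain ⟨C, hC⟩ := exists_l2Kernel_tailKer hβ hl
  exact ⟨_, (l2Kernel_causalKer hβ hl).add hC⟩

theorem periodic_limit_constant {β : ℝ} (hβ : 0 < β) : β * (π ^ (-β)) ^ (1 / β) = β / π := by
  rw [← rpow_mul pi_pos.le, show -β * (1 / β) = -1 by field_simp, rpow_neg_one]; rfl

theorem entropyUpper_periodicKer {β l : ℝ} (hβ : 1 / 2 < β) (hl : 0 < l) :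
    EntropyUpper β (kernelBall (periodicKer β l)) (β / π) := by
  obtain ⟨C, hC⟩ := exists_l2Kernel_periodicKer hβ hl
  have hβ0 : 0 < β := by linarith
  rw [← periodic_limit_constant hβ0]
  refine entropyUpper_of_diagonal
    (trigBasis (fun k => expKerPhase β l (2 * π * k)) (by simp [expKerPhase_zero hl]))
    (trigBasis 0 rfl) hβ0 (by positivity) (fun j => (periodicSV_pos hl j).le)
    tendsto_periodicSV _ ?_
  rintro y ⟨x, hx, hy⟩
  exact ⟨x, hx, fun j => inner_trigBasis_kernelFun hβ hl hC j hy⟩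

theorem entropyLower_periodicKer {β l : ℝ} (hβ : 1 / 2 < β) (hl : 0 < l) :
    EntropyLower β (kernelBall (periodicKer β l)) (β / π) := by
  obtain ⟨C, hC⟩ := exists_l2Kernel_periodicKer hβ hl
  have hβ0 : 0 < β := by linarith
  rw [← periodic_limit_constant hβ0]
  refine entropyLower_of_diagonal
    (trigBasis (fun k => expKerPhase β l (2 * π * k)) (by simp [expKerPhase_zero hl]))
    (trigBasis 0 rfl) hβ0 (by positivity) (fun j => periodicSV_pos hl j)
    tendsto_periodicSV _ ?_
  intro x y hx hy
  have h1 := hC.mem_kernelBall hx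
  convert h1
  refine (trigBasis 0 rfl).repr.injective (lp.ext (funext fun j => ?_))
  rw [HilbertBasis.repr_apply_apply, HilbertBasis.repr_apply_apply, hy j]
  exact (inner_trigBasis_kernelFun hβ hl hC j (MemLp.coeFn_toLp _)).symm

theorem exists_taylor_one_add_rpow (γ : ℝ) (m : ℕ) : ∃ (c : ℕ → ℝ) (M : ℝ), 0 ≤ M ∧
    ∀ z ∈ Set.Icc (0 : ℝ) 1,
      |(1 + z) ^ γ - ∑ i ∈ Finset.range (m + 1), c i * z ^ i| ≤ M * z ^ (m + 1) := by
  have hf : ContDiffOn ℝ (m + 1) (fun z : ℝ => (1 + z) ^ γ) (Set.Icc 0 1) := by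
    intro z hz
    refine ContDiffAt.contDiffWithinAt ?_
    exact (contDiffAt_const.add contDiffAt_id).rpow_const_of_ne (by simp; linarith [hz.1])
  obtain ⟨M, hM⟩ := exists_taylor_mean_remainder_bound zero_le_one hf
  refine ⟨fun i => ((i.factorial : ℝ))⁻¹ *
    iteratedDerivWithin i (fun z : ℝ => (1 + z) ^ γ) (Set.Icc 0 1) 0, |M|, abs_nonneg _,
    fun z hz => ?_⟩
  have h := hM z hz
  rw [taylor_within_apply, sub_zero, Real.norm_eq_abs] at h
  have e : ∀ i, ((i.factorial : ℝ)⁻¹ * z ^ i) •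
      iteratedDerivWithin i (fun z : ℝ => (1 + z) ^ γ) (Set.Icc 0 1) 0 =
      (i.factorial : ℝ)⁻¹ * iteratedDerivWithin i (fun z : ℝ => (1 + z) ^ γ) (Set.Icc 0 1) 0
        * z ^ i := fun i => by rw [smul_eq_mul]; ring
  simp only [e] at h
  exact h.trans (mul_le_mul_of_nonneg_right (le_abs_self M) (pow_nonneg hz.1 _))

theorem expKer_add {β l w τ : ℝ} (hw : 0 < w) (hτ : 0 ≤ τ) :
    expKer β l (w + τ) = expKer β l w * exp (-(l * τ)) * (1 + τ / w) ^ (β - 1) := by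
  rw [expKer_of_pos (by linarith), expKer_of_pos hw,
    show w + τ = w * (1 + τ / w) by field_simp, mul_rpow hw.le (by positivity),
    show -(l * (w * (1 + τ / w))) = -(l * w) + -(l * τ) by field_simp; ring, exp_add]
  ring

/-- On a cell `[a, a (1 + h)]` the tail operator has small-rank approximations. -/
theorem exists_kernelFun_tailKer_approx {β l : ℝ} (hβ : 1 / 2 < β) (hl : 0 < l) {C : ℝ}
    (hC : L2Kernel (tailKer β l) C) {m : ℕ} {c : ℕ → ℝ} {M : ℝ} (hM0 : 0 ≤ M)
    (hM : ∀ z ∈ Set.Icc (0 : ℝ) 1, |(1 + z) ^ (β - 1) - ∑ i ∈ Finset.range (m + 1), c i * z ^ i|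
      ≤ M * z ^ (m + 1)) {a h : ℝ} (ha : 0 < a) (ha1 : a ≤ 1) (h0 : 0 ≤ h) (h1 : h ≤ 1)
    {g : Lp ℝ 2 μ01} (hg : ‖g‖ ≤ 1) :
    ∃ G : ℕ → ℝ, ∀ t ∈ Set.Icc (0 : ℝ) 1, a ≤ t → t ≤ a * (1 + h) →
      |kernelFun (tailKer β l) g t
        - ∑ i ∈ Finset.range (m + 1), G i * (exp (-(l * (t - a))) * (t - a) ^ i)|
        ≤ M * h ^ (m + 1) * C := by
  have hβ0 : 0 < β := by linarith
  set T : ℕ → ℝ → ℝ := fun i s =>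
    ∑' n : ℕ, expKer β l (a - s + (n + 1)) * ((a - s + (n + 1))⁻¹) ^ i with hT
  have hw : ∀ s ∈ Set.Icc (0 : ℝ) 1, ∀ n : ℕ, a ≤ a - s + (n + 1) := fun s hs n => by
    linarith [hs.2, n.cast_nonneg (α := ℝ)]
  have hsum0 : ∀ s ∈ Set.Icc (0 : ℝ) 1, Summable fun n : ℕ => expKer β l (a - s + (n + 1)) :=
    fun s hs => summable_expKer hβ0 hl (by linarith [hs.2])
  have hterm : ∀ s ∈ Set.Icc (0 : ℝ) 1, ∀ i n : ℕ,
      expKer β l (a - s + (n + 1)) * ((a - s + (n + 1))⁻¹) ^ i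
        ≤ a⁻¹ ^ i * expKer β l (a - s + (n + 1)) := fun s hs i n => by
    have := hw s hs n
    rw [mul_comm]
    have h2 := expKer_nonneg hβ0 l (a - s + (n + 1))
    have h3 : 0 < a - s + (n + 1) := by linarith
    gcongr
  have hnn : ∀ s ∈ Set.Icc (0 : ℝ) 1, ∀ i n : ℕ,
      0 ≤ expKer β l (a - s + (n + 1)) * ((a - s + (n + 1))⁻¹) ^ i := fun s hs i n => by
    have := hw s hs n
    have h2 := expKer_nonneg hβ0 l (a - s + (n + 1))
    have h3 : 0 < a - s + (n + 1) := by linarith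
    positivity
  have hsumT : ∀ s ∈ Set.Icc (0 : ℝ) 1, ∀ i, Summable fun n : ℕ =>
      expKer β l (a - s + (n + 1)) * ((a - s + (n + 1))⁻¹) ^ i := fun s hs i =>
    Summable.of_nonneg_of_le (hnn s hs i) (hterm s hs i) ((hsum0 s hs).mul_left _)
  have haI : a ∈ Set.Icc (0 : ℝ) 1 := ⟨ha.le, ha1⟩
  have hTmem : ∀ i, MemLp (T i) 2 μ01 := by
    intro i
    refine ((hC.memLp a haI).const_mul (a⁻¹ ^ i)).mono (Measurable.aestronglyMeasurable ?_) ?_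
    · exact Measurable.tsum fun n => ((measurable_expKer β l).comp (by fun_prop)).mul (by fun_prop)
    · filter_upwards [ae_mem_μ01] with s hs
      rw [Real.norm_of_nonneg (tsum_nonneg (hnn s hs i))]
      refine le_trans ?_ (le_abs_self _)
      rw [tailKer, ← tsum_mul_left]
      exact (hsumT s hs i).tsum_le_tsum (hterm s hs i) ((hsum0 s hs).mul_left _)
  have hTint : ∀ i, Integrable (fun s => T i s * g s) μ01 := fun i =>
    (hTmem i).integrable_mul (Lp.memLp g)
  refine ⟨fun i => c i * ∫ s, T i s * g s ∂μ01, fun t ht hat hta => ?_⟩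
  set τ := t - a with hτ
  have hτ0 : 0 ≤ τ := by linarith
  have hτh : τ ≤ a * h := by linarith
  have key : ∀ s ∈ Set.Icc (0 : ℝ) 1,
      |tailKer β l t s - ∑ i ∈ Finset.range (m + 1), c i * (exp (-(l * τ)) * τ ^ i) * T i s|
        ≤ M * h ^ (m + 1) * tailKer β l a s := by
    intro s hs
    have e1 : HasSum (fun n : ℕ => expKer β l (t - s + (n + 1))
        - ∑ i ∈ Finset.range (m + 1), c i * (exp (-(l * τ)) * τ ^ i) *
          (expKer β l (a - s + (n + 1)) * ((a - s + (n + 1))⁻¹) ^ i))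
        (tailKer β l t s - ∑ i ∈ Finset.range (m + 1), c i * (exp (-(l * τ)) * τ ^ i) * T i s) :=
      (summable_expKer hβ0 hl (by linarith [hs.2, ht.1])).hasSum.sub
        (hasSum_sum fun i _ => (hsumT s hs i).hasSum.mul_left _)
    rw [← e1.tsum_eq, ← Real.norm_eq_abs]
    refine tsum_of_norm_bounded ((hsum0 s hs).hasSum.mul_left (M * h ^ (m + 1))) fun n => ?_
    set w := a - s + ((n : ℝ) + 1) with hw'
    have haw : a ≤ w := hw s hs n
    have hw0 : 0 < w := by linarith
    have hz : τ / w ≤ h := by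
      rw [div_le_iff₀ hw0]
      exact hτh.trans (by rw [mul_comm]; gcongr)
    have hz0 : 0 ≤ τ / w := by positivity
    have e2 : expKer β l (t - s + (n + 1)) = expKer β l w * exp (-(l * τ)) * (1 + τ / w) ^ (β - 1) := by
      rw [← expKer_add hw0 hτ0]; congr 1; rw [hw', hτ]; ring
    have e3 : ∑ i ∈ Finset.range (m + 1), c i * (exp (-(l * τ)) * τ ^ i) *
          (expKer β l w * w⁻¹ ^ i) = expKer β l w * exp (-(l * τ)) *
          ∑ i ∈ Finset.range (m + 1), c i * (τ / w) ^ i := by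
      rw [Finset.mul_sum]
      refine Finset.sum_congr rfl fun i _ => ?_
      rw [div_eq_mul_inv, mul_pow]; ring
    rw [e2, e3, ← mul_sub, Real.norm_eq_abs, abs_mul,
      abs_of_nonneg (mul_nonneg (expKer_nonneg hβ0 l w) (exp_pos _).le)]
    have e4 := hM (τ / w) ⟨hz0, hz.trans h1⟩
    have e5 : exp (-(l * τ)) ≤ 1 := by
      rw [exp_le_one_iff]
      have := mul_nonneg hl.le hτ0
      linarith
    have e6 := expKer_nonneg hβ0 l w
    calc expKer β l w * exp (-(l * τ)) * _ ≤ expKer β l w * 1 * (M * h ^ (m + 1)) := by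
          gcongr
          exact e4.trans (by gcongr)
      _ = _ := by ring
  have hL : Integrable (fun s => ∑ i ∈ Finset.range (m + 1),
      c i * (exp (-(l * τ)) * τ ^ i) * (T i s * g s)) μ01 :=
    integrable_finsetSum _ fun i _ => (hTint i).const_mul _
  have e7 : kernelFun (tailKer β l) g t
        - ∑ i ∈ Finset.range (m + 1), (c i * ∫ s, T i s * g s ∂μ01) * (exp (-(l * τ)) * τ ^ i) =
      ∫ s, (tailKer β l t s * g s - ∑ i ∈ Finset.range (m + 1),
        c i * (exp (-(l * τ)) * τ ^ i) * (T i s * g s)) ∂μ01 := by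
    rw [integral_sub (hC.integrable ht g) hL, integral_finsetSum _ fun i _ => (hTint i).const_mul _]
    rw [kernelFun]
    congr 1
    refine Finset.sum_congr rfl fun i _ => ?_
    rw [integral_const_mul]; ring
  rw [e7]
  calc _ ≤ ∫ s, |tailKer β l t s * g s - ∑ i ∈ Finset.range (m + 1),
        c i * (exp (-(l * τ)) * τ ^ i) * (T i s * g s)| ∂μ01 := abs_integral_le_integral_abs
    _ ≤ ∫ s, M * h ^ (m + 1) * |tailKer β l a s * g s| ∂μ01 := by
        refine integral_mono_ae ((hC.integrable ht g).sub hL).abs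
          ((hC.integrable haI g).abs.const_mul _) ?_
        filter_upwards [ae_mem_μ01] with s hs
        have := mul_le_mul_of_nonneg_right (key s hs) (abs_nonneg (g s))
        rw [← abs_mul, sub_mul, Finset.sum_mul] at this
        simp only [mul_assoc] at this ⊢
        refine this.trans (le_of_eq ?_)
        have hnn' : 0 ≤ tailKer β l a s := tsum_nonneg fun n => expKer_nonneg hβ0 _ _
        rw [abs_mul, abs_of_nonneg hnn']
    _ = M * h ^ (m + 1) * ∫ s, |tailKer β l a s * g s| ∂μ01 := integral_const_mul _ _
    _ ≤ M * h ^ (m + 1) * C := by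
        gcongr
        exact (hC.integral_abs_le haI g).trans (mul_le_of_le_one_right hC.nonneg hg)

theorem Coverable.of_span_approx {H : Type*} [NormedAddCommGroup H] [InnerProductSpace ℝ H]
    {ι : Type*} [Fintype ι] (v : ι → H) {K : Set H} {R δ : ℝ} (hR : 0 ≤ R) (hδ : 0 < δ)
    (hK : ∀ x ∈ K, ‖x‖ ≤ R)
    (hv : ∀ x ∈ K, ∃ y ∈ Submodule.span ℝ (Set.range v), ‖x - y‖ ≤ δ) :
    Coverable K (2 * δ) ((4 * (R + δ) / δ) ^ Fintype.card ι) := by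
  classical
  set W := Submodule.span ℝ (Set.range v)
  have : FiniteDimensional ℝ W := FiniteDimensional.span_of_finite ℝ (Set.finite_range v)
  let b := stdOrthonormalBasis ℝ W
  obtain ⟨s, -, hs, hcov⟩ := exists_net_subset_closedBall (ι := Fin (Module.finrank ℝ W)) hδ
    (R := R + δ) (by linarith) (Metric.closedBall 0 (R + δ)) subset_rfl
  refine ⟨s.image fun z => ((b.repr.symm z : W) : H), ?_, fun x hx => ?_⟩
  · refine (Nat.cast_le.2 Finset.card_image_le).trans (hs.trans ?_)
    rw [Fintype.card_fin]
    refine pow_le_pow_right₀ ?_ (finrank_range_le_card v)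
    rw [le_div_iff₀ hδ]; linarith
  · obtain ⟨y, hy, hxy⟩ := hv x hx
    have hny : ‖y‖ ≤ R + δ := by
      have := norm_sub_norm_le y x
      rw [norm_sub_rev] at this
      linarith [hK x hx]
    obtain ⟨z, hz, hyz⟩ := hcov (b.repr ⟨y, hy⟩) (by
      rw [mem_closedBall_zero_iff, LinearIsometryEquiv.norm_map]; exact hny)
    refine ⟨_, Finset.mem_image_of_mem _ hz, ?_⟩
    have h1 : ‖y - ((b.repr.symm z : W) : H)‖ ≤ δ := by
      have h2 : ‖b.repr (⟨y, hy⟩ - b.repr.symm z)‖ ≤ δ := by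
        rwa [map_sub, LinearIsometryEquiv.apply_symm_apply]
      rwa [LinearIsometryEquiv.norm_map] at h2
    calc ‖x - ((b.repr.symm z : W) : H)‖ = ‖(x - y) + (y - ((b.repr.symm z : W) : H))‖ := by
          congr 1; abel
      _ ≤ ‖x - y‖ + ‖y - ((b.repr.symm z : W) : H)‖ := norm_add_le _ _
      _ ≤ 2 * δ := by linarith

theorem norm_le_of_ae_abs_le_split {h : Lp ℝ 2 μ01} {C η δ : ℝ} (hη : 0 ≤ η) (hδ : 0 ≤ δ)
    (hC : C ^ 2 * η ≤ δ ^ 2 / 4) (h₁ : ∀ᵐ t ∂μ01, t < η → |h t| ≤ C)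
    (h₂ : ∀ᵐ t ∂μ01, η ≤ t → |h t| ≤ δ / 2) : ‖h‖ ≤ δ := by
  refine le_of_sq_le_sq ?_ hδ
  have hm : μ01.real (Set.Iio η) ≤ η := by
    rw [μ01, measureReal_restrict_apply measurableSet_Iio]
    calc volume.real (Set.Iio η ∩ Set.Icc 0 1) ≤ volume.real (Set.Icc 0 η) :=
          measureReal_mono (fun t ht => ⟨ht.2.1, le_of_lt ht.1⟩) (by simp)
      _ = η := by simp [hη]
  have hi : Integrable ((Set.Iio η).indicator fun _ => C ^ 2) μ01 :=
    (integrable_const _).indicator measurableSet_Iio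
  calc ‖h‖ ^ 2 = ∫ t, h t ^ 2 ∂μ01 := Lp.norm_sq_eq_integral h
    _ ≤ ∫ t, ((Set.Iio η).indicator (fun _ => C ^ 2) t + (δ / 2) ^ 2) ∂μ01 := by
        refine integral_mono_ae (Lp.memLp h).integrable_sq (hi.add (integrable_const _)) ?_
        filter_upwards [h₁, h₂] with t e1 e2
        by_cases ht : t < η
        · rw [Set.indicator_of_mem (show t ∈ Set.Iio η from ht), ← sq_abs]
          have := pow_le_pow_left₀ (abs_nonneg _) (e1 ht) 2
          linarith [sq_nonneg (δ / 2)]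
        · rw [Set.indicator_of_notMem (show t ∉ Set.Iio η from ht), ← sq_abs, zero_add]
          exact pow_le_pow_left₀ (abs_nonneg _) (e2 (not_lt.1 ht)) 2
    _ = μ01.real (Set.Iio η) * C ^ 2 + (δ / 2) ^ 2 := by
        rw [integral_add hi (integrable_const _), integral_indicator_const _ measurableSet_Iio]
        simp
    _ ≤ η * C ^ 2 + (δ / 2) ^ 2 := by gcongr
    _ ≤ δ ^ 2 := by nlinarith [sq_nonneg δ]

/-- A weighted monomial supported on the cell `[a, b)`. -/
noncomputable def cellFun (l a b : ℝ) (i : ℕ) : ℝ → ℝ :=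
  (Set.Ico a b).indicator fun t => exp (-(l * (t - a))) * (t - a) ^ i

theorem memLp_cellFun {l : ℝ} (hl : 0 < l) (a b : ℝ) (i : ℕ) : MemLp (cellFun l a b i) 2 μ01 := by
  refine MemLp.of_bound
    (Measurable.indicator (by fun_prop) measurableSet_Ico).aestronglyMeasurable (|b - a| ^ i)
    (ae_of_all _ fun t => ?_)
  by_cases ht : t ∈ Set.Ico a b
  · rw [cellFun, Set.indicator_of_mem ht, norm_mul, Real.norm_of_nonneg (exp_pos _).le, norm_pow,
      Real.norm_eq_abs]
    have h1 : 0 ≤ l * (t - a) := mul_nonneg hl.le (by linarith [ht.1])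
    have h2 : |t - a| ≤ |b - a| := by
      rw [abs_of_nonneg (by linarith [ht.1])]
      exact le_trans (by linarith [ht.2]) (le_abs_self _)
    calc exp (-(l * (t - a))) * |t - a| ^ i ≤ 1 * |b - a| ^ i := by
          gcongr
          rw [exp_le_one_iff]; linarith
      _ = _ := one_mul _
  · rw [cellFun, Set.indicator_of_notMem ht, norm_zero]; positivity

/-- The geometric cells cover `[η, 1]` without overlap. -/
theorem exists_geometric_cell {η h : ℝ} (hη : 0 < η) (hh : 0 < h) {I : ℕ}
    (hI : 1 < η * (1 + h) ^ I) {t : ℝ} (ht : η ≤ t) (ht1 : t ≤ 1) :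
    ∃ p : Fin I, t ∈ Set.Ico (η * (1 + h) ^ (p : ℕ)) (η * (1 + h) ^ ((p : ℕ) + 1)) ∧
      ∀ q : Fin I, q ≠ p →
        t ∉ Set.Ico (η * (1 + h) ^ (q : ℕ)) (η * (1 + h) ^ ((q : ℕ) + 1)) := by
  obtain ⟨n, h1, h2⟩ := exists_nat_pow_near (x := t / η) (y := 1 + h)
    (by rwa [le_div_iff₀ hη, one_mul]) (by linarith)
  rw [le_div_iff₀ hη] at h1
  rw [div_lt_iff₀ hη] at h2
  have key : ∀ {i j : ℕ}, η * (1 + h) ^ i < η * (1 + h) ^ j → i < j := fun hij =>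
    (pow_lt_pow_iff_right₀ (by linarith)).1 (lt_of_mul_lt_mul_left hij hη.le)
  have hn : n < I := key (by linarith)
  refine ⟨⟨n, hn⟩, ⟨by simpa [mul_comm] using h1, by simpa [mul_comm] using h2⟩, fun q hq hmem => ?_⟩
  refine hq (Fin.ext ?_)
  have e1 : (q : ℕ) < n + 1 := key (by linarith [hmem.1])
  have e2 : n < (q : ℕ) + 1 := key (by linarith [hmem.2])
  simp only
  omega

theorem Lp.coeFn_sum_smul {ι : Type*} (s : Finset ι) (G : ι → ℝ) {f : ι → ℝ → ℝ}
    (hf : ∀ i, MemLp (f i) 2 μ01) :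
    ⇑(∑ i ∈ s, G i • (hf i).toLp (f i)) =ᵐ[μ01] fun t => ∑ i ∈ s, G i * f i t := by
  classical
  induction s using Finset.induction_on with
  | empty =>
    simp only [Finset.sum_empty]
    exact Lp.coeFn_zero ℝ 2 μ01
  | insert a s ha ih =>
    rw [Finset.sum_insert ha]
    filter_upwards [ih, Lp.coeFn_add (G a • (hf a).toLp (f a)) (∑ i ∈ s, G i • (hf i).toLp (f i)),
      Lp.coeFn_smul (G a) ((hf a).toLp (f a)), (hf a).coeFn_toLp] with t h1 h2 h3 h4
    rw [h2, Pi.add_apply, h1, h3, Pi.smul_apply, h4, Finset.sum_insert ha, smul_eq_mul]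

theorem coverable_kernelBall_tailKer {β l : ℝ} (hβ : 1 / 2 < β) (hl : 0 < l) {C : ℝ}
    (hC : L2Kernel (tailKer β l) C) {m : ℕ} {c : ℕ → ℝ} {M : ℝ} (hM0 : 0 ≤ M)
    (hM : ∀ z ∈ Set.Icc (0 : ℝ) 1, |(1 + z) ^ (β - 1) - ∑ i ∈ Finset.range (m + 1), c i * z ^ i|
      ≤ M * z ^ (m + 1)) {D d h : ℝ} (hD : 1 ≤ D) (hDC : 2 * C ≤ D) (hDM : 2 * M * C ≤ D)
    (hd : 0 < d) (hd1 : d ≤ 1) (hh : 0 < h) (hh1 : h ≤ 1) (hhd : h ^ (m + 1) = d) {I : ℕ}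
    (hI : 1 < d ^ 2 * (1 + h) ^ I) :
    Coverable (kernelBall (tailKer β l)) (2 * (D * d)) ((6 / d) ^ (I * (m + 1))) := by
  have hC0 := hC.nonneg
  set q : ℕ → ℝ := fun p => d ^ 2 * (1 + h) ^ p with hq
  have hq0 : ∀ p, d ^ 2 ≤ q p := fun p =>
    le_mul_of_one_le_right (by positivity) (one_le_pow₀ (by linarith))
  have hqpos : ∀ p, 0 < q p := fun p => by positivity
  have hmem : ∀ P : Fin I × Fin (m + 1), MemLp (cellFun l (q P.1) (q (P.1 + 1)) P.2) 2 μ01 :=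
    fun P => memLp_cellFun hl _ _ _
  have hδ : 0 < D * d := by positivity
  have hcov := Coverable.of_span_approx (fun P => (hmem P).toLp _) (K := kernelBall (tailKer β l))
    hC0 hδ (fun x hx => hC.norm_le_of_mem_kernelBall hx) ?_
  · refine hcov.mono subset_rfl le_rfl ?_
    rw [Fintype.card_prod, Fintype.card_fin, Fintype.card_fin]
    refine pow_le_pow_left₀ (by positivity) ?_ _
    rw [div_le_div_iff₀ hδ hd]
    nlinarith
  · rintro x ⟨g, hg, hx⟩
    have hG : ∀ p : Fin I, ∃ G : ℕ → ℝ, ∀ t ∈ Set.Icc (0 : ℝ) 1, q p ≤ t → t ≤ q (p + 1) →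
        |kernelFun (tailKer β l) g t - ∑ i ∈ Finset.range (m + 1),
          G i * (exp (-(l * (t - q p))) * (t - q p) ^ i)| ≤ M * h ^ (m + 1) * C := by
      intro p
      have e : q (p + 1) = q p * (1 + h) := by simp only [hq, pow_succ]; ring
      by_cases hp : q p ≤ 1
      · rw [e]
        exact exists_kernelFun_tailKer_approx hβ hl hC hM0 hM (hqpos p) hp hh.le hh1 hg
      · exact ⟨0, fun t ht h1 _ => absurd (h1.trans ht.2) hp⟩
    choose G hG using hG
    refine ⟨∑ P : Fin I × Fin (m + 1), G P.1 P.2 • (hmem P).toLp _,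
      Submodule.sum_mem _ fun P _ => Submodule.smul_mem _ _ (Submodule.subset_span ⟨P, rfl⟩), ?_⟩
    have hco := Lp.coeFn_sum_smul Finset.univ (fun P : Fin I × Fin (m + 1) => G P.1 P.2) hmem
    have hsub := Lp.coeFn_sub x (∑ P : Fin I × Fin (m + 1), G P.1 P.2 • (hmem P).toLp _)
    refine norm_le_of_ae_abs_le_split (C := C) (η := d ^ 2) (by positivity) hδ.le ?_ ?_ ?_
    · have : C ^ 2 ≤ (D / 2) ^ 2 := pow_le_pow_left₀ hC0 (by linarith) 2
      calc C ^ 2 * d ^ 2 ≤ (D / 2) ^ 2 * d ^ 2 := by gcongr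
        _ = _ := by ring
    · filter_upwards [hco, hsub, hx, ae_mem_μ01] with t e1 e2 e3 e4 ht
      rw [e2, Pi.sub_apply, e1, Finset.sum_eq_zero, sub_zero, e3]
      · exact (hC.abs_kernelFun_le e4 g).trans (mul_le_of_le_one_right hC0 hg)
      · intro P _
        rw [cellFun, Set.indicator_of_notMem, mul_zero]
        intro hP
        linarith [hP.1, hq0 P.1]
    · filter_upwards [hco, hsub, hx, ae_mem_μ01] with t e1 e2 e3 e4 ht
      obtain ⟨p, hp, hp'⟩ := exists_geometric_cell (by positivity) hh hI ht e4.2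
      rw [e2, Pi.sub_apply, e1, e3, Fintype.sum_prod_type, Finset.sum_eq_single p]
      · have e5 := hG p t e4 hp.1 hp.2.le
        rw [← Fin.sum_univ_eq_sum_range
          (fun i => G p i * (exp (-(l * (t - q p))) * (t - q p) ^ i))] at e5
        simp only [cellFun]
        simp only [Set.indicator_of_mem (show t ∈ Set.Ico (q p) (q (p + 1)) from hp)]
        refine e5.trans ?_
        rw [hhd]
        nlinarith
      · intro p' _ hpp
        refine Finset.sum_eq_zero fun i _ => ?_
        rw [cellFun, Set.indicator_of_notMem (hp' p' hpp), mul_zero]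
      · simp

/-- The number of geometric cells needed for the approximation of the tail operator is of smaller
order than `y ^ (1 / β)`, where `1 / y` is the accuracy. -/
theorem exists_cell_count {m : ℕ} {κ : ℝ} (hκ : 0 < κ) {y : ℝ} (hy : 1 ≤ y) :
    ∃ I : ℕ, 1 < (1 / y) ^ 2 * (1 + y ^ (-(1 / (m + 1 : ℝ)))) ^ I ∧
      (6 / (1 / y)) ^ (I * (m + 1)) ≤
        exp ((m + 1) * (4 / κ + 1) * (5 + 1 / κ) * y ^ (1 / (m + 1 : ℝ) + 2 * κ)) := by
  have hy0 : 0 < y := by linarith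
  set θ : ℝ := 1 / (m + 1 : ℝ) with hθ
  have hθ0 : 0 < θ := by positivity
  set h := y ^ (-θ) with hh
  have hh0 : 0 < h := by positivity
  have hh1 : h ≤ 1 := rpow_le_one_of_one_le_of_nonpos hy (by linarith)
  have hlog : 0 ≤ log y := log_nonneg hy
  have hyκ : 1 ≤ y ^ κ := one_le_rpow hy hκ.le
  have hyθκ : 1 ≤ y ^ (θ + κ) := one_le_rpow hy (by positivity)
  have hlogκ : log y ≤ y ^ κ / κ := log_le_rpow_div hy0.le hκ
  refine ⟨⌊4 * log y / h⌋₊ + 1, ?_, ?_⟩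
  · have h1 : 4 * log y / h < ((⌊4 * log y / h⌋₊ + 1 : ℕ) : ℝ) := by
      push_cast; exact Nat.lt_floor_add_one _
    rw [div_lt_iff₀ hh0] at h1
    set I := ⌊4 * log y / h⌋₊ + 1
    have h2 : h / 2 ≤ log (1 + h) := by
      refine le_trans ?_ (le_log_one_add_of_nonneg hh0.le)
      rw [div_le_div_iff₀ (by norm_num) (by linarith)]
      nlinarith
    have h3 : 2 * log y < I * log (1 + h) := by
      have : (I : ℝ) * (h / 2) ≤ I * log (1 + h) := by gcongr
      linarith
    have h4 : y ^ 2 < (1 + h) ^ I := by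
      rw [← log_lt_log_iff (by positivity) (by positivity), log_pow, log_pow]
      exact_mod_cast h3
    rw [one_div, inv_pow, ← div_eq_inv_mul]
    exact (one_lt_div (by positivity)).2 h4
  · have hI : ((⌊4 * log y / h⌋₊ + 1 : ℕ) : ℝ) ≤ (4 / κ + 1) * y ^ (θ + κ) := by
      push_cast
      have e : 4 * log y / h = 4 * log y * y ^ θ := by
        rw [hh, rpow_neg hy0.le, div_inv_eq_mul]
      have : (⌊4 * log y / h⌋₊ : ℝ) ≤ 4 * log y * y ^ θ :=
        (Nat.floor_le (by positivity)).trans_eq e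
      calc (⌊4 * log y / h⌋₊ : ℝ) + 1 ≤ 4 * (y ^ κ / κ) * y ^ θ + y ^ (θ + κ) := by
            refine add_le_add (this.trans ?_) hyθκ
            gcongr
        _ = _ := by rw [rpow_add hy0]; ring
    set I := ⌊4 * log y / h⌋₊ + 1
    have h6 : log (6 / (1 / y)) ≤ (5 + 1 / κ) * y ^ κ := by
      rw [div_div_eq_mul_div, div_one, log_mul (by norm_num) hy0.ne']
      have : log 6 ≤ 5 := by
        have := log_le_sub_one_of_pos (show (0 : ℝ) < 6 by norm_num)
        linarith
      have e : (5 + 1 / κ) * y ^ κ = 5 * y ^ κ + y ^ κ / κ := by ring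
      rw [e]
      linarith
    rw [← log_le_iff_le_exp (by positivity), log_pow]
    push_cast
    have h0 : 0 ≤ log (6 / (1 / y)) := by
      rw [div_div_eq_mul_div, div_one]
      exact log_nonneg (by linarith)
    calc (I : ℝ) * (m + 1) * log (6 / (1 / y))
        ≤ ((4 / κ + 1) * y ^ (θ + κ)) * (m + 1) * ((5 + 1 / κ) * y ^ κ) := by gcongr
      _ = _ := by
        rw [show θ + 2 * κ = (θ + κ) + κ by ring, rpow_add hy0 (θ + κ)]; ring

theorem entropyUpper_tailKer {β l : ℝ} (hβ : 1 / 2 < β) (hl : 0 < l) :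
    EntropyUpper β (kernelBall (tailKer β l)) 0 := by
  intro L' hL'
  obtain ⟨C, hC⟩ := exists_l2Kernel_tailKer hβ hl
  have hβ0 : 0 < β := by linarith
  obtain ⟨m, hm⟩ := exists_nat_one_div_lt (show (0 : ℝ) < 1 / β by positivity)
  obtain ⟨c, M, hM0, hM⟩ := exists_taylor_one_add_rpow (β - 1) m
  set θ : ℝ := 1 / (m + 1 : ℝ) with hθ
  set κ := (1 / β - θ) / 4 with hκ
  have hκ0 : 0 < κ := by rw [hκ]; linarith
  set D := max 1 (max (2 * C) (2 * M * C)) with hD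
  have hD1 : 1 ≤ D := le_max_left _ _
  set A := (m + 1) * (4 / κ + 1) * (5 + 1 / κ) with hA
  have hA0 : 0 < A := by positivity
  have hy : Tendsto (fun ε : ℝ => 2 * D / ε) (nhdsWithin (0 : ℝ) (Set.Ioi 0)) atTop :=
    tendsto_inv_nhdsGT_zero.const_mul_atTop (by positivity)
  have hsmall : Tendsto (fun ε : ℝ => A * (2 * D) ^ (1 / β) * (2 * D / ε) ^ (-(2 * κ)))
      (nhdsWithin (0 : ℝ) (Set.Ioi 0)) (nhds 0) := by
    simpa using ((tendsto_rpow_neg_atTop (show 0 < 2 * κ by positivity)).comp hy).const_mul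
      (A * (2 * D) ^ (1 / β))
  filter_upwards [hy.eventually_ge_atTop 1, hsmall.eventually_le_const hL', self_mem_nhdsWithin]
    with ε hy1 hsm hε
  have hε : 0 < ε := hε
  set y := 2 * D / ε with hyd
  have hy0 : 0 < y := by positivity
  obtain ⟨I, hI, hN⟩ := exists_cell_count (m := m) hκ0 hy1
  have hpow : (y ^ (-θ)) ^ (m + 1) = 1 / y := by
    rw [← rpow_natCast, ← rpow_mul hy0.le, one_div, ← rpow_neg_one]
    congr 1
    push_cast
    rw [hθ]
    field_simp
  have hcov := coverable_kernelBall_tailKer hβ hl hC hM0 hM hD1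
    ((le_max_left _ _).trans (le_max_right _ _)) ((le_max_right _ _).trans (le_max_right _ _))
    (show 0 < 1 / y by positivity) ((div_le_one hy0).2 hy1) (show 0 < y ^ (-θ) by positivity)
    (rpow_le_one_of_one_le_of_nonpos hy1 (by simp only [hθ, Left.neg_nonpos_iff]; positivity))
    hpow hI
  refine hcov.mono subset_rfl (le_of_eq ?_) (hN.trans (exp_le_exp.2 ?_))
  · rw [hyd]; field_simp
  · have e1 : y ^ (θ + 2 * κ) = y ^ (-(2 * κ)) * ((2 * D) ^ (1 / β) * ε ^ (-(1 / β))) := by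
      rw [rpow_neg hε.le, ← div_eq_mul_inv, ← div_rpow (by positivity) hε.le, ← hyd,
        ← rpow_add hy0]
      congr 1
      rw [hκ]; ring
    calc A * y ^ (θ + 2 * κ)
        = (A * (2 * D) ^ (1 / β) * y ^ (-(2 * κ))) * ε ^ (-(1 / β)) := by rw [e1]; ring
      _ ≤ _ := by gcongr

theorem entropy_causalKer {β l : ℝ} (hβ : 1 / 2 < β) (hl : 0 < l) :
    EntropyUpper β (kernelBall (causalKer β l)) (β / π) ∧
      EntropyLower β (kernelBall (causalKer β l)) (β / π) := by
  obtain ⟨C, hC⟩ := exists_l2Kernel_tailKer hβ hl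
  have h := l2Kernel_causalKer hβ hl
  have ht := entropyUpper_tailKer hβ hl
  exact ⟨(entropyUpper_periodicKer hβ hl).add ht (h.kernelBall_subset_add hC),
    (entropyLower_periodicKer hβ hl).add ht (h.kernelBall_add_subset hC)⟩

theorem memLp_const_mul_exp_mul (c l : ℝ) (x : Lp ℝ 2 μ01) :
    MemLp (fun t => c * exp (l * t) * x t) 2 μ01 := by
  refine (Lp.memLp x).of_le_mul (c := |c| * exp |l|)
    (AEStronglyMeasurable.mul (by fun_prop) (Lp.aestronglyMeasurable x)) ?_
  filter_upwards [ae_mem_μ01] with t ht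
  rw [norm_mul, norm_mul, norm_eq_abs, norm_eq_abs (exp _), abs_exp]
  have : l * t ≤ |l| := calc
    l * t ≤ |l| * t := mul_le_mul_of_nonneg_right (le_abs_self l) ht.1
    _ ≤ |l| := mul_le_of_le_one_right (abs_nonneg l) ht.2
  gcongr

/-- Multiplication by `t ↦ c * exp (l * t)` on `L²([0,1])`. -/
noncomputable def expMul (c l : ℝ) (x : Lp ℝ 2 μ01) : Lp ℝ 2 μ01 :=
  (memLp_const_mul_exp_mul c l x).toLp _

theorem coeFn_expMul (c l : ℝ) (x : Lp ℝ 2 μ01) :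
    expMul c l x =ᵐ[μ01] fun t => c * exp (l * t) * x t :=
  (memLp_const_mul_exp_mul c l x).coeFn_toLp

theorem norm_expMul_sub_le {c l C : ℝ} (hC : ∀ t ∈ Set.Icc (0 : ℝ) 1, |c * exp (l * t)| ≤ C)
    (x y : Lp ℝ 2 μ01) : ‖expMul c l x - expMul c l y‖ ≤ C * ‖x - y‖ := by
  refine Lp.norm_le_mul_norm_of_ae_le_mul ?_
  filter_upwards [ae_mem_μ01, coeFn_expMul c l x, coeFn_expMul c l y, Lp.coeFn_sub x y,
    Lp.coeFn_sub (expMul c l x) (expMul c l y)] with t ht hx hy h1 h2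
  rw [h2, h1, Pi.sub_apply, Pi.sub_apply, hx, hy, ← mul_sub, norm_mul]
  exact mul_le_mul_of_nonneg_right (hC t ht) (norm_nonneg _)

theorem norm_expMul_le {c l C : ℝ} (hC : ∀ t ∈ Set.Icc (0 : ℝ) 1, |c * exp (l * t)| ≤ C)
    (x : Lp ℝ 2 μ01) : ‖expMul c l x‖ ≤ C * ‖x‖ := by
  refine Lp.norm_le_mul_norm_of_ae_le_mul ?_
  filter_upwards [ae_mem_μ01, coeFn_expMul c l x] with t ht hx
  rw [hx, norm_mul]
  exact mul_le_mul_of_nonneg_right (hC t ht) (norm_nonneg _)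

theorem expMul_expMul_neg {c c' : ℝ} (hc : c * c' = 1) (l : ℝ) (x : Lp ℝ 2 μ01) :
    expMul c l (expMul c' (-l) x) = x := by
  refine Lp.ext ?_
  filter_upwards [coeFn_expMul c l (expMul c' (-l) x), coeFn_expMul c' (-l) x] with t h1 h2
  rw [h1, h2]
  calc c * exp (l * t) * (c' * exp (-l * t) * x t)
      = (c * c') * (exp (l * t) * exp (-l * t)) * x t := by ring
    _ = x t := by rw [hc, ← exp_add]; simp

theorem expKer_mul_exp (β l l' t s : ℝ) :
    expKer β l (t - s) * exp (l' * s) = exp (l' * t) * expKer β (l + l') (t - s) := by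
  rcases le_or_gt (t - s) 0 with h | h
  · rw [expKer_of_nonpos h, expKer_of_nonpos h]; simp
  · rw [expKer_of_pos h, expKer_of_pos h]
    have : exp (-(l * (t - s))) * exp (l' * s) = exp (l' * t) * exp (-((l + l') * (t - s))) := by
      rw [← exp_add, ← exp_add]; ring_nf
    linear_combination (t - s) ^ (β - 1) / Gamma β * this

theorem kernelFun_causalKer_expMul (β c l l' t : ℝ) (g : Lp ℝ 2 μ01) :
    kernelFun (causalKer β l) (expMul c l' g) t =
      c * exp (l' * t) * kernelFun (causalKer β (l + l')) g t := by
  rw [kernelFun, kernelFun, ← integral_const_mul]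
  refine integral_congr_ae ?_
  filter_upwards [coeFn_expMul c l' g] with s hs
  rw [hs]
  have := expKer_mul_exp β l l' t s
  simp only [causalKer]
  linear_combination c * g s * this

theorem expMul_ae_eq_kernelFun {β l l' : ℝ} (c : ℝ) {g h : Lp ℝ 2 μ01}
    (hh : h =ᵐ[μ01] kernelFun (causalKer β (l + l')) g) :
    expMul c l' h =ᵐ[μ01] kernelFun (causalKer β l) (expMul c l' g) := by
  filter_upwards [hh, coeFn_expMul c l' h] with t ht h'
  rw [h', ht, kernelFun_causalKer_expMul]

theorem kernelFun_causalKer_zero (β : ℝ) {t : ℝ} (ht : t ∈ Set.Icc (0 : ℝ) 1) (g : ℝ → ℝ) :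
    kernelFun (causalKer β 0) g t =
      (Gamma β)⁻¹ * ∫ s in (0 : ℝ)..t, (t - s) ^ (β - 1) * g s := by
  have hind : ∀ s, causalKer β 0 t s * g s =
      (Set.Iio t).indicator (fun s => (Gamma β)⁻¹ * ((t - s) ^ (β - 1) * g s)) s := by
    intro s
    by_cases hs : s < t
    · rw [Set.indicator_of_mem (Set.mem_Iio.2 hs), causalKer, expKer_of_pos (sub_pos.2 hs)]
      simp only [zero_mul, neg_zero, exp_zero]
      ring
    · rw [Set.indicator_of_notMem (by simpa using hs), causalKer,
        expKer_of_nonpos (by linarith), zero_mul]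
  rw [kernelFun]
  simp only [hind]
  rw [integral_indicator measurableSet_Iio, integral_const_mul, μ01,
    Measure.restrict_restrict measurableSet_Iio, intervalIntegral.integral_of_le ht.1,
    integral_Ioc_eq_integral_Ioo, ← integral_Ico_eq_integral_Ioo]
  congr 3
  ext s
  simp only [Set.mem_inter_iff, Set.mem_Iio, Set.mem_Icc, Set.mem_Ico]
  exact ⟨fun h => ⟨h.2.1, h.1⟩, fun h => ⟨h.2, h.1, h.2.le.trans ht.2⟩⟩

theorem mem_sobolevBall_iff {ρ : ℝ} (hρ : 0 < ρ) {h : Lp ℝ 2 μ01} :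
    h ∈ sobolevBall ρ ↔ ∃ g : Lp ℝ 2 μ01, ‖g‖ ≤ Gamma (ρ + 1 / 2) ∧
      h =ᵐ[μ01] kernelFun (causalKer (ρ + 1 / 2) 0) g := by
  have hΓ : 0 < Gamma (ρ + 1 / 2) := Gamma_pos_of_pos (by linarith)
  rw [sobolevBall, Set.mem_ofPred_eq]
  refine exists_congr fun g => and_congr ?_ ⟨fun H => ?_, fun H => ?_⟩
  · rw [← integral_μ01, ← Lp.norm_sq_eq_integral, sq_le_sq₀ (norm_nonneg _) hΓ.le]
  all_goals
    filter_upwards [H, ae_mem_μ01] with t e ht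
    rw [e, kernelFun_causalKer_zero _ ht]

theorem abs_const_mul_exp_le {c l : ℝ} (hc : 0 ≤ c) (hl : 0 ≤ l) :
    ∀ t ∈ Set.Icc (0 : ℝ) 1, |c * exp (l * t)| ≤ c * exp l := by
  intro t ht
  rw [abs_of_nonneg (by positivity)]
  gcongr
  exact mul_le_of_le_one_right hl ht.2

theorem abs_const_mul_exp_neg_le {c l : ℝ} (hc : 0 ≤ c) (hl : 0 ≤ l) :
    ∀ t ∈ Set.Icc (0 : ℝ) 1, |c * exp (-l * t)| ≤ c := by
  intro t ht
  rw [abs_of_nonneg (by positivity)]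
  refine mul_le_of_le_one_right hc (exp_le_one_iff.2 ?_)
  nlinarith [ht.1]

theorem sobolevBall_subset_image {ρ l : ℝ} (hρ : 0 < ρ) (hl : 0 < l) :
    sobolevBall ρ ⊆ expMul (Gamma (ρ + 1 / 2)) l '' kernelBall (causalKer (ρ + 1 / 2) l) := by
  have hΓ : 0 < Gamma (ρ + 1 / 2) := Gamma_pos_of_pos (by linarith)
  intro h hh
  obtain ⟨g, hg, hh⟩ := (mem_sobolevBall_iff hρ).1 hh
  refine ⟨expMul (Gamma (ρ + 1 / 2))⁻¹ (-l) h, ⟨expMul (Gamma (ρ + 1 / 2))⁻¹ (-l) g, ?_,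
    expMul_ae_eq_kernelFun _ (by rwa [add_neg_cancel])⟩,
    expMul_expMul_neg (mul_inv_cancel₀ hΓ.ne') l h⟩
  calc _ ≤ (Gamma (ρ + 1 / 2))⁻¹ * ‖g‖ :=
        norm_expMul_le (abs_const_mul_exp_neg_le (by positivity) hl.le) g
    _ ≤ (Gamma (ρ + 1 / 2))⁻¹ * Gamma (ρ + 1 / 2) := by gcongr
    _ = 1 := inv_mul_cancel₀ hΓ.ne'

theorem kernelBall_subset_image_sobolevBall {ρ l : ℝ} (hρ : 0 < ρ) (hl : 0 < l) :
    kernelBall (causalKer (ρ + 1 / 2) l) ⊆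
      expMul ((Gamma (ρ + 1 / 2))⁻¹ * exp l) (-l) '' sobolevBall ρ := by
  have hΓ : 0 < Gamma (ρ + 1 / 2) := Gamma_pos_of_pos (by linarith)
  rintro h ⟨g, hg, hh⟩
  have hc : (Gamma (ρ + 1 / 2))⁻¹ * exp l * (Gamma (ρ + 1 / 2) * exp (-l)) = 1 := by
    rw [exp_neg]; field_simp
  refine ⟨expMul (Gamma (ρ + 1 / 2) * exp (-l)) l h, (mem_sobolevBall_iff hρ).2
    ⟨expMul (Gamma (ρ + 1 / 2) * exp (-l)) l g, ?_,
    expMul_ae_eq_kernelFun _ (by rwa [zero_add])⟩, ?_⟩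
  · calc _ ≤ Gamma (ρ + 1 / 2) * exp (-l) * exp l * ‖g‖ :=
          norm_expMul_le (abs_const_mul_exp_le (by positivity) hl.le) g
      _ = Gamma (ρ + 1 / 2) * ‖g‖ := by rw [exp_neg]; field_simp
      _ ≤ Gamma (ρ + 1 / 2) := mul_le_of_le_one_right hΓ.le hg
  · simpa using expMul_expMul_neg hc (-l) h

theorem zero_mem_sobolevBall {ρ : ℝ} (hρ : 0 < ρ) : 0 ∈ sobolevBall ρ := by
  refine (mem_sobolevBall_iff hρ).2
    ⟨0, by simpa using (Gamma_pos_of_pos (by linarith : 0 < ρ + 1 / 2)).le, ?_⟩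
  filter_upwards [Lp.coeFn_zero ℝ 2 μ01] with t ht
  rw [ht, kernelFun, integral_eq_zero_of_ae, Pi.zero_apply]
  filter_upwards [Lp.coeFn_zero ℝ 2 μ01] with s hs
  rw [hs, Pi.zero_apply, mul_zero]

theorem isBounded_sobolevBall {ρ : ℝ} (hρ : 0 < ρ) : Bornology.IsBounded (sobolevBall ρ) := by
  have hΓ : 0 < Gamma (ρ + 1 / 2) := Gamma_pos_of_pos (by linarith)
  obtain ⟨C, hk⟩ : ∃ C, L2Kernel (causalKer (ρ + 1 / 2) 1) C :=
    ⟨_, l2Kernel_causalKer (by linarith) one_pos⟩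
  refine isBounded_iff_forall_norm_le.2 ⟨Gamma (ρ + 1 / 2) * exp 1 * C, fun h hh => ?_⟩
  obtain ⟨x, hx, rfl⟩ := sobolevBall_subset_image hρ one_pos hh
  refine (norm_expMul_le (abs_const_mul_exp_le hΓ.le zero_le_one) x).trans ?_
  gcongr
  exact hk.norm_le_of_mem_kernelBall hx

theorem entropyUpper_sobolevBall {ρ : ℝ} (hρ : 0 < ρ) :
    EntropyUpper (ρ + 1 / 2) (sobolevBall ρ)
      ((ρ + 1 / 2) / π * Gamma (ρ + 1 / 2) ^ (1 / (ρ + 1 / 2))) := by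
  have hΓ : 0 < Gamma (ρ + 1 / 2) := Gamma_pos_of_pos (by linarith)
  refine EntropyUpper.of_tendsto (u := fun n : ℕ => (ρ + 1 / 2) / π *
    (Gamma (ρ + 1 / 2) * exp (1 / ((n : ℝ) + 1))) ^ (1 / (ρ + 1 / 2))) ?_ fun n => ?_
  · have h := (continuous_exp.tendsto 0).comp (tendsto_one_div_add_atTop_nhds_zero_nat (𝕜 := ℝ))
    simpa using ((h.const_mul (Gamma (ρ + 1 / 2))).rpow_const
      (Or.inl (by simpa using hΓ.ne')) (p := 1 / (ρ + 1 / 2))).const_mul ((ρ + 1 / 2) / π)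
  · have hl : (0 : ℝ) < 1 / ((n : ℝ) + 1) := by positivity
    exact (entropy_causalKer (by linarith) hl).1.image (by positivity) _
      (norm_expMul_sub_le (abs_const_mul_exp_le hΓ.le hl.le)) (sobolevBall_subset_image hρ hl)

theorem entropyLower_sobolevBall {ρ : ℝ} (hρ : 0 < ρ) :
    EntropyLower (ρ + 1 / 2) (sobolevBall ρ)
      ((ρ + 1 / 2) / π * Gamma (ρ + 1 / 2) ^ (1 / (ρ + 1 / 2))) := by
  have hΓ : 0 < Gamma (ρ + 1 / 2) := Gamma_pos_of_pos (by linarith)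
  refine EntropyLower.of_tendsto (u := fun n : ℕ => (ρ + 1 / 2) / π /
    ((Gamma (ρ + 1 / 2))⁻¹ * exp (1 / ((n : ℝ) + 1))) ^ (1 / (ρ + 1 / 2))) ?_ fun n => ?_
  · have h := (continuous_exp.tendsto 0).comp (tendsto_one_div_add_atTop_nhds_zero_nat (𝕜 := ℝ))
    have h' := (tendsto_const_nhds (x := (ρ + 1 / 2) / π)).div
      ((h.const_mul (Gamma (ρ + 1 / 2))⁻¹).rpow_const
        (Or.inl (by simpa using hΓ.ne')) (p := 1 / (ρ + 1 / 2)))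
      (by rw [exp_zero, mul_one]; positivity)
    rw [exp_zero, mul_one, inv_rpow hΓ.le, div_inv_eq_mul] at h'
    exact h'
  · have hl : (0 : ℝ) < 1 / ((n : ℝ) + 1) := by positivity
    exact (entropy_causalKer (by linarith) hl).2.image (by positivity) _
      (norm_expMul_sub_le (abs_const_mul_exp_neg_le (by positivity) hl.le))
      (kernelBall_subset_image_sobolevBall hρ hl)

/-- Sharp entropy asymptotics for fractional Sobolev balls:
`e_n(U_ρ) ~ ((ρ+1/2)/π)^{ρ+1/2} Γ(ρ+1/2) (log n)^{-(ρ+1/2)}`. -/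
theorem sobolev_ball_entropy
    (ρ : ℝ) (hρ : 0 < ρ) :
    Tendsto (fun n : ℕ =>
        entropyNum (sobolevBall ρ) n /
          (((ρ + 1/2) / Real.pi) ^ (ρ + 1/2) * Real.Gamma (ρ + 1/2) *
            (Real.log n) ^ (-(ρ + 1/2))))
      atTop (nhds 1) := by
  have hβ : 0 < ρ + 1 / 2 := by linarith
  have hΓ : 0 < Gamma (ρ + 1 / 2) := Gamma_pos_of_pos hβ
  have h := tendsto_entropyNum hβ (by positivity) ⟨0, zero_mem_sobolevBall hρ⟩
    (isBounded_sobolevBall hρ) (entropyUpper_sobolevBall hρ) (entropyLower_sobolevBall hρ)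
  rw [mul_rpow (by positivity) (by positivity), ← rpow_mul hΓ.le, one_div_mul_cancel hβ.ne',
    rpow_one] at h
  have hc : 0 < ((ρ + 1 / 2) / π) ^ (ρ + 1 / 2) * Gamma (ρ + 1 / 2) := by positivity
  have h' := h.div_const (((ρ + 1 / 2) / π) ^ (ρ + 1 / 2) * Gamma (ρ + 1 / 2))
  rw [div_self hc.ne'] at h'
  refine h'.congr' ?_
  filter_upwards with n
  rw [rpow_neg (log_natCast_nonneg n), ← div_div _ _ (log n ^ (ρ + 1 / 2))⁻¹, div_inv_eq_mul,
    div_mul_eq_mul_div]
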